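/- There exists a constant c_0 > 0 such that for every constant c ≥ c_0 the following holds for all sufficiently large odd integers N: with D = \sqrt{N} L^{-c}, r_1(m) = \sum_{d | m, d \le D} χ(d) and r_2(m) = \sum_{d | m, D < d < N/D} χ(d), one has \sum_{p_1+p_2+p_3=N} r_1(p_1-1) r_2(p_2-1) (\log p_1)(\log p_2)(\log p_3) \ll N^2 L^{-\theta_0} (\log L)^7, the sum being over ordered triples of primes, θ_0 = 1/2 - (1/4) e log 2, and the implied constant depending only on c. -/

import Mathlib

open Finset

noncomputable section

/-- The non-principal Dirichlet character modulo 4. -/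
def chi4 (n : ℕ) : ℝ := if n % 4 = 1 then 1 else if n % 4 = 3 then -1 else 0

/-- θ₀ = 1/2 - (1/4) e log 2. -/
def theta0 : ℝ := 1 / 2 - (1 / 4) * Real.exp 1 * Real.log 2

/-- Weighted sum over ordered triples of primes with p₁ + p₂ + p₃ = N. -/
def tripleSum (N : ℕ) (w1 w2 : ℕ → ℝ) : ℝ :=
  ∑ p1 ∈ Finset.range (N + 1), ∑ p2 ∈ Finset.range (N + 1), ∑ p3 ∈ Finset.range (N + 1),
    if p1.Prime ∧ p2.Prime ∧ p3.Prime ∧ p1 + p2 + p3 = N then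
      w1 p1 * w2 p2 * Real.log p1 * Real.log p2 * Real.log p3
    else 0

/-- r₁(m) = ∑_{d ∣ m, d ≤ D} χ(d). -/
def r1 (D : ℝ) (m : ℕ) : ℝ := ∑ d ∈ m.divisors, if (d : ℝ) ≤ D then chi4 d else 0

/-- r₂(m) = ∑_{d ∣ m, D < d < N/D} χ(d). -/
def r2 (D NR : ℝ) (m : ℕ) : ℝ :=
  ∑ d ∈ m.divisors, if D < (d : ℝ) ∧ (d : ℝ) < NR / D then chi4 d else 0

/-- r₃(m) = ∑_{d ∣ m, d ≥ N/D} χ(d). -/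
def r3 (D NR : ℝ) (m : ℕ) : ℝ :=
  ∑ d ∈ m.divisors, if NR / D ≤ (d : ℝ) then chi4 d else 0

lemma chi4_mul (m n : ℕ) : chi4 (m * n) = chi4 m * chi4 n := by
  unfold chi4
  rw [Nat.mul_mod]
  have h1 := Nat.mod_lt m (show 0 < 4 by norm_num)
  have h2 := Nat.mod_lt n (show 0 < 4 by norm_num)
  interval_cases m % 4 <;> interval_cases n % 4 <;> norm_num

lemma abs_chi4_le (n : ℕ) : |chi4 n| ≤ 1 := by
  unfold chi4; split_ifs <;> norm_num

lemma chi4_one : chi4 1 = 1 := by norm_num [chi4]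

/-- Alternating sums of `chi4 k * f k` are bounded by the first value of a decreasing `f`. -/
lemma abs_sum_Ioc_chi4_mul_le {f : ℕ → ℝ} (hf : ∀ k, 1 ≤ k → f (k + 1) ≤ f k)
    (hf0 : ∀ k, 0 ≤ f k) (u v : ℕ) :
    |∑ k ∈ Ioc u v, chi4 k * f k| ≤ f (u + 1) := by
  have key : ∀ n u, v = u + n →
      0 ≤ (if u % 4 = 0 ∨ u % 4 = 3 then (1 : ℝ) else -1) * ∑ k ∈ Ioc u v, chi4 k * f k ∧
      (if u % 4 = 0 ∨ u % 4 = 3 then (1 : ℝ) else -1) * ∑ k ∈ Ioc u v, chi4 k * f k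
        ≤ f (u + 1) := by
    intro n
    induction n with
    | zero => rintro u rfl; simp [hf0]
    | succ n ih =>
      intro u hu
      have h := ih (u + 1) (by omega)
      have hs : ∑ k ∈ Ioc u v, chi4 k * f k
          = chi4 (u + 1) * f (u + 1) + ∑ k ∈ Ioc (u + 1) v, chi4 k * f k := by
        rw [← Finset.sum_Ioc_consecutive _ (Nat.le_succ u) (by omega : u.succ ≤ v)]
        simp
      rw [hs]
      have h3 := hf (u + 1) (by omega)
      have h4 := hf0 (u + 1)
      have h5 : u % 4 = 0 ∨ u % 4 = 1 ∨ u % 4 = 2 ∨ u % 4 = 3 := by omega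
      rcases h5 with h5 | h5 | h5 | h5
      · have h6 : (u + 1) % 4 = 1 := by omega
        simp only [chi4, h5, h6] at h ⊢
        norm_num at h ⊢
        constructor <;> linarith [h.1, h.2]
      · have h6 : (u + 1) % 4 = 2 := by omega
        simp only [chi4, h5, h6] at h ⊢
        norm_num at h ⊢
        constructor <;> linarith [h.1, h.2]
      · have h6 : (u + 1) % 4 = 3 := by omega
        simp only [chi4, h5, h6] at h ⊢
        norm_num at h ⊢
        constructor <;> linarith [h.1, h.2]
      · have h6 : (u + 1) % 4 = 0 := by omega
        simp only [chi4, h5, h6] at h ⊢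
        norm_num at h ⊢
        constructor <;> linarith [h.1, h.2]
  rcases le_total v u with h | h
  · rw [Finset.Ioc_eq_empty (by omega)]; simp [hf0]
  · have := key (v - u) u (by omega)
    rw [abs_le]
    split_ifs at this <;> constructor <;> linarith [this.1, this.2]

lemma abs_one_sub_sum_powerset_le (T : Finset ℕ) (R : ℕ) :
    |(if T = ∅ then (1 : ℝ) else 0) - ∑ S ∈ T.powerset with S.card ≤ R, (-1 : ℝ) ^ S.card|
      ≤ (T.powersetCard (R + 1)).card := by
  have h1 : ∑ S ∈ T.powerset with S.card ≤ R, (-1 : ℝ) ^ S.card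
      = ((∑ j ∈ range (R + 1), (-1 : ℤ) ^ j * T.card.choose j : ℤ) : ℝ) := by
    rw [← Finset.sum_fiberwise_of_maps_to (s := {S ∈ T.powerset | S.card ≤ R})
      (t := range (R + 1)) (g := Finset.card)]
    · push_cast
      refine Finset.sum_congr rfl fun j hj => ?_
      have : ({S ∈ {S ∈ T.powerset | S.card ≤ R} | S.card = j}) = T.powersetCard j := by
        ext S; simp only [mem_filter, mem_powerset, mem_powersetCard, mem_range] at hj ⊢
        constructor
        · rintro ⟨⟨a, b⟩, c⟩; exact ⟨a, c⟩
        · rintro ⟨a, c⟩; exact ⟨⟨a, by omega⟩, c⟩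
      rw [this, Finset.sum_congr rfl (g := fun _ => (-1 : ℝ) ^ j)]
      · simp [mul_comm]
      · intro S hS; rw [(mem_powersetCard.1 hS).2]
    · intro S hS; simp at hS ⊢; omega
  rw [h1]
  rcases T.eq_empty_or_nonempty with h | h
  · subst h
    simp [Finset.sum_range_succ']
  · rw [if_neg h.ne_empty]
    obtain ⟨t, ht⟩ : ∃ t, T.card = t + 1 := ⟨T.card - 1, by have := h.card_pos; omega⟩
    rw [ht, Int.alternating_sum_range_choose_eq_choose, card_powersetCard, ht]
    push_cast
    rw [zero_sub, abs_neg, abs_mul, abs_pow]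
    simp only [abs_neg, abs_one, one_pow, one_mul]
    rw [abs_of_nonneg (by positivity)]
    have := Nat.choose_succ_succ t R
    norm_cast
    simp only [Nat.succ_eq_add_one] at this
    simp
    omega

lemma abs_sum_sieve_sub_le (bad : ℕ → ℕ → Prop) [∀ p n, Decidable (bad p n)]
    (I P : Finset ℕ) (c : ℕ → ℝ) (R : ℕ) :
    |∑ n ∈ I with ∀ p ∈ P, ¬ bad p n, c n
      - ∑ S ∈ P.powerset with S.card ≤ R, (-1 : ℝ) ^ S.card *
          ∑ n ∈ I with ∀ p ∈ S, bad p n, c n|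
      ≤ ∑ S ∈ P.powersetCard (R + 1), ∑ n ∈ I with ∀ p ∈ S, bad p n, |c n| := by
  have e1 : ∑ S ∈ P.powerset with S.card ≤ R, (-1 : ℝ) ^ S.card *
          ∑ n ∈ I with ∀ p ∈ S, bad p n, c n
      = ∑ n ∈ I, c n * ∑ S ∈ ({p ∈ P | bad p n}).powerset with S.card ≤ R, (-1 : ℝ) ^ S.card := by
    simp_rw [Finset.mul_sum, Finset.sum_filter (s := I)]
    rw [Finset.sum_comm]
    refine Finset.sum_congr rfl fun n _ => ?_
    rw [← Finset.sum_filter]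
    refine Finset.sum_congr ?_ fun S _ => mul_comm _ _
    ext S
    simp only [mem_filter, mem_powerset, subset_iff]
    constructor
    · rintro ⟨⟨a, b⟩, c⟩; exact ⟨fun p hp => ⟨a hp, c p hp⟩, b⟩
    · rintro ⟨a, b⟩; exact ⟨⟨fun p hp => (a hp).1, b⟩, fun p hp => (a hp).2⟩
  have e2 : ∑ S ∈ P.powersetCard (R + 1), ∑ n ∈ I with ∀ p ∈ S, bad p n, |c n|
      = ∑ n ∈ I, |c n| * (({p ∈ P | bad p n}).powersetCard (R + 1)).card := by
    simp_rw [Finset.sum_filter (s := I)]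
    rw [Finset.sum_comm]
    refine Finset.sum_congr rfl fun n _ => ?_
    rw [← Finset.sum_filter, Finset.sum_const, nsmul_eq_mul, mul_comm]
    congr 3
    ext S
    simp only [mem_filter, mem_powersetCard, subset_iff]
    constructor
    · rintro ⟨⟨a, b⟩, c⟩; exact ⟨fun p hp => ⟨a hp, c p hp⟩, b⟩
    · rintro ⟨a, b⟩; exact ⟨⟨fun p hp => (a hp).1, b⟩, fun p hp => (a hp).2⟩
  have e3 : ∑ n ∈ I with ∀ p ∈ P, ¬ bad p n, c n
      = ∑ n ∈ I, c n * (if ({p ∈ P | bad p n}) = ∅ then (1 : ℝ) else 0) := by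
    rw [Finset.sum_filter]
    refine Finset.sum_congr rfl fun n _ => ?_
    simp only [Finset.filter_eq_empty_iff, mul_ite, mul_one, mul_zero]
  rw [e1, e2, e3, ← Finset.sum_sub_distrib]
  refine (Finset.abs_sum_le_sum_abs _ _).trans (Finset.sum_le_sum fun n _ => ?_)
  rw [← mul_sub, abs_mul]
  exact mul_le_mul_of_nonneg_left (abs_one_sub_sum_powerset_le _ _) (abs_nonneg _)

lemma prod_one_add_le_exp_sum {ι : Type*} (P : Finset ι) (g : ι → ℝ) (hg : ∀ p ∈ P, 0 ≤ g p) :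
    ∏ p ∈ P, (1 + g p) ≤ Real.exp (∑ p ∈ P, g p) := by
  rw [Real.exp_sum]
  refine Finset.prod_le_prod (fun p hp => by linarith [hg p hp]) fun p _ => ?_
  linarith [Real.add_one_le_exp (g p)]

lemma sum_powerset_prod_tail_le {ι : Type*} (P : Finset ι) (g : ι → ℝ)
    (hg : ∀ p ∈ P, 0 ≤ g p) (R : ℕ) :
    ∑ S ∈ P.powerset with R ≤ S.card, ∏ p ∈ S, g p
      ≤ Real.exp (Real.exp 1 * ∑ p ∈ P, g p - R) := by
  have h1 : ∑ S ∈ P.powerset with R ≤ S.card, ∏ p ∈ S, g p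
      ≤ ∑ S ∈ P.powerset, Real.exp (-R) * ∏ p ∈ S, (Real.exp 1 * g p) := by
    rw [Finset.sum_filter]
    refine Finset.sum_le_sum fun S hS => ?_
    have h0 : 0 ≤ ∏ p ∈ S, g p := Finset.prod_nonneg fun p hp => hg p (mem_powerset.1 hS hp)
    rw [Finset.prod_mul_distrib, Finset.prod_const, ← Real.exp_nat_mul, ← mul_assoc,
      ← Real.exp_add]
    split_ifs with h
    · have : (1 : ℝ) ≤ Real.exp (-R + S.card * 1) := by
        apply Real.one_le_exp
        have : (R : ℝ) ≤ S.card := by exact_mod_cast h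
        linarith
      nlinarith
    · positivity
  refine h1.trans ?_
  rw [← Finset.mul_sum, ← Finset.prod_one_add, sub_eq_neg_add, Real.exp_add, Finset.mul_sum]
  gcongr
  exact prod_one_add_le_exp_sum _ _ fun p hp => mul_nonneg (Real.exp_pos _).le (hg p hp)

lemma sum_powerset_prod_small_le {ι : Type*} (P : Finset ι) (x : ι → ℝ)
    (hx : ∀ p ∈ P, 0 ≤ x p) {T : ℝ} (hT : 1 ≤ T) (R : ℕ) :
    ∑ S ∈ P.powerset with S.card ≤ R, ∏ p ∈ S, x p
      ≤ T ^ R * Real.exp ((∑ p ∈ P, x p) / T) := by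
  have h1 : ∑ S ∈ P.powerset with S.card ≤ R, ∏ p ∈ S, x p
      ≤ ∑ S ∈ P.powerset, T ^ R * ∏ p ∈ S, (x p / T) := by
    rw [Finset.sum_filter]
    refine Finset.sum_le_sum fun S hS => ?_
    have h0 : 0 ≤ ∏ p ∈ S, x p := Finset.prod_nonneg fun p hp => hx p (mem_powerset.1 hS hp)
    rw [Finset.prod_div_distrib, Finset.prod_const]
    split_ifs with h
    · rw [← mul_div_assoc, le_div_iff₀ (by positivity), mul_comm]
      gcongr
    · positivity
  refine h1.trans ?_
  rw [← Finset.mul_sum, ← Finset.prod_one_add, Finset.sum_div]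
  gcongr
  exact prod_one_add_le_exp_sum _ _ fun p hp => div_nonneg (hx p hp) (by linarith)

/-- Every nonzero number splits along a predicate on primes. -/
lemma exists_mul_eq_prime_split (Q : ℕ → Prop) {m : ℕ} (hm : m ≠ 0) :
    ∃ a b, m = a * b ∧ (∀ p, p.Prime → p ∣ a → Q p) ∧ (∀ p, p.Prime → p ∣ b → ¬ Q p) := by
  induction m using Nat.recOnMul with
  | zero => exact absurd rfl hm
  | one => exact ⟨1, 1, rfl, fun p hp h => absurd (Nat.dvd_one.1 h) hp.one_lt.ne',
      fun p hp h => absurd (Nat.dvd_one.1 h) hp.one_lt.ne'⟩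
  | prime q hq =>
    by_cases h : Q q
    · exact ⟨q, 1, by simp, fun p hp hd => by rwa [(Nat.prime_dvd_prime_iff_eq hp hq).1 hd],
        fun p hp h => absurd (Nat.dvd_one.1 h) hp.one_lt.ne'⟩
    · exact ⟨1, q, by simp, fun p hp h => absurd (Nat.dvd_one.1 h) hp.one_lt.ne',
        fun p hp hd => by rwa [(Nat.prime_dvd_prime_iff_eq hp hq).1 hd]⟩
  | mul x y hx hy =>
    obtain ⟨a, b, h, ha, hb⟩ := hx (left_ne_zero_of_mul hm)
    obtain ⟨a', b', h', ha', hb'⟩ := hy (right_ne_zero_of_mul hm)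
    refine ⟨a * a', b * b', by rw [h, h']; ring, fun p hp hd => ?_, fun p hp hd => ?_⟩
    · exact ((Nat.Prime.dvd_mul hp).1 hd).elim (ha p hp) (ha' p hp)
    · exact ((Nat.Prime.dvd_mul hp).1 hd).elim (hb p hp) (hb' p hp)

lemma coprime_of_prime_split {Q : ℕ → Prop} {a b : ℕ} (ha : ∀ p, p.Prime → p ∣ a → Q p)
    (hb : ∀ p, p.Prime → p ∣ b → ¬ Q p) : a.Coprime b :=
  Nat.Coprime.symm <| Nat.coprime_of_dvd fun p hp h1 h2 => hb p hp h1 (ha p hp h2)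

lemma sum_le_sum_of_cover {ι κ : Type*} [DecidableEq κ] (s : Finset ι) (T : Finset κ)
    (f : κ → ι) (F : ι → ℝ) (hF : ∀ t ∈ T, 0 ≤ F (f t)) (h : ∀ a ∈ s, ∃ t ∈ T, f t = a) :
    ∑ a ∈ s, F a ≤ ∑ t ∈ T, F (f t) := by
  rcases T.eq_empty_or_nonempty with rfl | ⟨t₀, -⟩
  · have hs : s = ∅ := Finset.eq_empty_of_forall_notMem fun a ha => by simpa using h a ha
    simp [hs]
  have : Nonempty κ := ⟨t₀⟩
  choose! g hg using h
  have hinj : Set.InjOn g s := fun a ha b hb hab => by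
    rw [← (hg a ha).2, ← (hg b hb).2, hab]
  calc ∑ a ∈ s, F a = ∑ a ∈ s, F (f (g a)) := Finset.sum_congr rfl fun a ha => by rw [(hg a ha).2]
    _ = ∑ t ∈ s.image g, F (f t) := by rw [Finset.sum_image hinj]
    _ ≤ _ := Finset.sum_le_sum_of_subset_of_nonneg
      (fun t ht => by obtain ⟨a, ha, rfl⟩ := mem_image.1 ht; exact (hg a ha).1)
      fun t ht _ => hF t ht

/-- Upper bound for a sum of a coprime-submultiplicative function over numbers with prime factors
in `P`. -/
lemma sum_le_prod_one_add {φ : ℕ → ℝ} (h0 : ∀ n, 0 ≤ φ n) (h1 : φ 1 ≤ 1)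
    (hmul : ∀ m n, m.Coprime n → φ (m * n) ≤ φ m * φ n) (P : Finset ℕ) (hP : ∀ p ∈ P, p.Prime) (c : ℕ → ℝ)
    (hc : ∀ p ∈ P, ∀ K, ∑ k ∈ range K, φ (p ^ (k + 1)) ≤ c p) (S : Finset ℕ)
    (hS : ∀ a ∈ S, a ≠ 0 ∧ ∀ p, p.Prime → p ∣ a → p ∈ P) :
    ∑ a ∈ S, φ a ≤ ∏ p ∈ P, (1 + c p) := by
  induction P using Finset.induction_on generalizing S with
  | empty =>
    have : S ⊆ {1} := fun a ha => by
      by_contra h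
      obtain ⟨p, hp, hd⟩ := Nat.exists_prime_and_dvd (n := a) (by simpa using h)
      exact absurd ((hS a ha).2 p hp hd) (by simp)
    calc ∑ a ∈ S, φ a ≤ ∑ a ∈ {1}, φ a := Finset.sum_le_sum_of_subset_of_nonneg this fun _ _ _ => h0 _
      _ ≤ _ := by simpa using h1
  | insert q P hq ih =>
    have hqp : q.Prime := hP q (mem_insert_self _ _)
    rw [Finset.prod_insert hq]
    set K := S.sup id with hK
    set S' : Finset ℕ := S.image (fun a => ordCompl[q] a) with hS'
    have hfac : ∀ a ∈ S, ∃ t ∈ range (K + 1) ×ˢ S', q ^ t.1 * t.2 = a := by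
      intro a ha
      refine ⟨(a.factorization q, ordCompl[q] a), ?_, Nat.ordProj_mul_ordCompl_eq_self a q⟩
      rw [mem_product]
      refine ⟨?_, mem_image_of_mem _ ha⟩
      have h2 : a ≤ K := Finset.le_sup (f := id) ha
      have h3 := Nat.factorization_lt q (hS a ha).1
      simp; omega
    have hS'2 : ∀ b ∈ S', b ≠ 0 ∧ ∀ p, p.Prime → p ∣ b → p ∈ P := by
      intro b hb
      obtain ⟨a, ha, rfl⟩ := mem_image.1 hb
      refine ⟨(Nat.ordCompl_pos q (hS a ha).1).ne', fun p hp hd => ?_⟩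
      have h3 := (hS a ha).2 p hp (hd.trans (Nat.ordCompl_dvd a q))
      rcases mem_insert.1 h3 with rfl | h3
      · exact absurd hd (Nat.not_dvd_ordCompl hqp (hS a ha).1)
      · exact h3
    have hcop : ∀ b ∈ S', ∀ k, (q ^ k).Coprime b := by
      intro b hb k
      apply Nat.Coprime.pow_left
      rw [Nat.Prime.coprime_iff_not_dvd hqp]
      exact fun hd => hq ((hS'2 b hb).2 q hqp hd)
    have hcq : 0 ≤ c q := by simpa using hc q (mem_insert_self _ _) 0
    have hih := ih (fun p hp => hP p (mem_insert_of_mem hp)) (fun p hp => hc p (mem_insert_of_mem hp)) S' hS'2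
    calc ∑ a ∈ S, φ a ≤ ∑ t ∈ range (K + 1) ×ˢ S', φ (q ^ t.1 * t.2) :=
          sum_le_sum_of_cover S _ (fun t : ℕ × ℕ => q ^ t.1 * t.2) φ (fun _ _ => h0 _) hfac
      _ ≤ ∑ t ∈ range (K + 1) ×ˢ S', φ (q ^ t.1) * φ t.2 :=
          Finset.sum_le_sum fun t ht => hmul _ _ (hcop _ (mem_product.1 ht).2 _)
      _ = (∑ k ∈ range (K + 1), φ (q ^ k)) * ∑ b ∈ S', φ b := by
          rw [Finset.sum_product, Finset.sum_mul_sum]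
      _ ≤ (1 + c q) * ∏ p ∈ P, (1 + c p) := by
          apply mul_le_mul _ hih (Finset.sum_nonneg fun _ _ => h0 _) (by linarith)
          rw [Finset.sum_range_succ', pow_zero]
          linarith [hc q (mem_insert_self _ _) K]

lemma sum_Icc_inv_le (n : ℕ) (x : ℝ) (hx : 1 ≤ x) (h : (n : ℝ) ≤ x) :
    ∑ k ∈ Icc 1 n, (1 : ℝ) / k ≤ 1 + Real.log x := by
  have h1 := harmonic_le_one_add_log n
  rw [harmonic_eq_sum_Icc] at h1
  push_cast at h1
  simp_rw [one_div]
  refine h1.trans ?_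
  rcases Nat.eq_zero_or_pos n with rfl | hn
  · simp; exact Real.log_nonneg hx
  · have : (0 : ℝ) < n := by exact_mod_cast hn
    linarith [Real.log_le_log this h]

lemma sum_divisors_mul_of_coprime {m n : ℕ} (h : m.Coprime n) (f : ℕ → ℝ) :
    ∑ d ∈ (m * n).divisors, f d = ∑ d ∈ m.divisors, ∑ e ∈ n.divisors, f (d * e) := by
  rw [Nat.divisors_mul, Finset.mul_def, Finset.sum_image, Finset.sum_product]
  exact h.mul_injOn_divisors

/-- The convolution of the constant function with `chi4`. -/
def rSum (n : ℕ) : ℝ := ∑ d ∈ n.divisors, chi4 d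

lemma rSum_mul {m n : ℕ} (h : m.Coprime n) : rSum (m * n) = rSum m * rSum n := by
  unfold rSum
  rw [sum_divisors_mul_of_coprime h, Finset.sum_mul_sum]
  simp_rw [chi4_mul]

lemma chi4_pow (n k : ℕ) : chi4 (n ^ k) = chi4 n ^ k := by
  induction k with
  | zero => simp [chi4_one]
  | succ k ih => rw [pow_succ, chi4_mul, ih, pow_succ]

lemma rSum_prime_pow {p : ℕ} (hp : p.Prime) (k : ℕ) :
    rSum (p ^ k) = ∑ i ∈ range (k + 1), chi4 p ^ i := by
  unfold rSum
  rw [Nat.divisors_prime_pow hp, Finset.sum_map]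
  exact Finset.sum_congr rfl fun i _ => chi4_pow p i

lemma chi4_eq (n : ℕ) : chi4 n = 1 ∨ chi4 n = -1 ∨ chi4 n = 0 := by
  unfold chi4; split_ifs <;> simp

lemma sum_range_neg_one_pow_nonneg (k : ℕ) : (0 : ℝ) ≤ ∑ i ∈ range k, (-1 : ℝ) ^ i := by
  rw [neg_one_geom_sum]; split_ifs <;> simp

lemma rSum_nonneg (n : ℕ) : 0 ≤ rSum n := by
  induction n using Nat.recOnPosPrimePosCoprime with
  | zero => simp [rSum]
  | one => simp [rSum, chi4_one]
  | prime_pow p k hp hk =>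
    rw [rSum_prime_pow hp]
    rcases chi4_eq p with h | h | h <;> rw [h]
    · simp; positivity
    · exact sum_range_neg_one_pow_nonneg _
    · exact Finset.sum_nonneg fun i _ => by positivity
  | coprime a b ha hb hab iha ihb => rw [rSum_mul hab]; positivity

/-- The primes up to `x`. -/
def primesUpTo (x : ℕ) : Finset ℕ := {p ∈ Ioc 1 x | p.Prime}

lemma mem_primesUpTo {x p : ℕ} : p ∈ primesUpTo x ↔ p.Prime ∧ p ≤ x := by
  simp only [primesUpTo, mem_filter, mem_Ioc]
  exact ⟨fun h => ⟨h.2, h.1.2⟩, fun h => ⟨⟨h.1.one_lt, h.2⟩, h.1⟩⟩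

lemma prime_of_mem {x p : ℕ} (h : p ∈ primesUpTo x) : p.Prime := (mem_primesUpTo.1 h).1

lemma sum_inv_sq_le_one {P : Finset ℕ} (hP : ∀ p ∈ P, 2 ≤ p) :
    ∑ p ∈ P, (1 : ℝ) / p ^ 2 ≤ 1 := by
  have h1 : P ⊆ Ioc 1 (P.sup id + 1) := fun p hp => by
    have := Finset.le_sup (f := id) hp
    simp at this ⊢
    have := hP p hp
    omega
  calc ∑ p ∈ P, (1 : ℝ) / p ^ 2 ≤ ∑ p ∈ Ioc 1 (P.sup id + 1), (1 : ℝ) / p ^ 2 :=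
        Finset.sum_le_sum_of_subset_of_nonneg h1 fun _ _ _ => by positivity
    _ ≤ _ := by
        have := sum_Ioc_inv_sq_le_sub (α := ℝ) (k := 1) (n := P.sup id + 1) (by simp) (by omega)
        simp_rw [one_div]
        refine this.trans ?_
        simp; positivity

lemma exp_sub_sq_le {t : ℝ} (h0 : 0 ≤ t) : Real.exp (t - t ^ 2) ≤ 1 + t := by
  have h1 : 1 / (1 + t) ≤ Real.exp (t ^ 2 - t) := by
    refine le_trans ?_ (Real.add_one_le_exp _)
    rw [div_le_iff₀ (by linarith)]
    nlinarith [pow_nonneg h0 3]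
  rw [show t - t ^ 2 = -(t ^ 2 - t) by ring, Real.exp_neg]
  rw [inv_le_comm₀ (Real.exp_pos _) (by linarith), ← one_div]
  exact h1

lemma exp_sum_le_prod {P : Finset ℕ} (hP : ∀ p ∈ P, 2 ≤ p) {k : ℝ} (hk : 0 ≤ k) :
    Real.exp (∑ p ∈ P, k / p) ≤ Real.exp (k ^ 2) * ∏ p ∈ P, (1 + k / p) := by
  have h1 : Real.exp (∑ p ∈ P, (k / p - (k / p) ^ 2)) ≤ ∏ p ∈ P, (1 + k / p) := by
    rw [Real.exp_sum]
    exact Finset.prod_le_prod (fun _ _ => (Real.exp_pos _).le)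
      fun p _ => exp_sub_sq_le (by positivity)
  have h2 : ∑ p ∈ P, k / p ≤ k ^ 2 + ∑ p ∈ P, (k / p - (k / p) ^ 2) := by
    rw [Finset.sum_sub_distrib]
    have : ∑ p ∈ P, (k / (p : ℝ)) ^ 2 = k ^ 2 * ∑ p ∈ P, 1 / (p : ℝ) ^ 2 := by
      rw [Finset.mul_sum]; exact Finset.sum_congr rfl fun p _ => by ring
    rw [this]
    nlinarith [sum_inv_sq_le_one hP, sq_nonneg k]
  calc _ ≤ Real.exp (k ^ 2 + ∑ p ∈ P, (k / p - (k / p) ^ 2)) := Real.exp_le_exp.2 h2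
    _ ≤ _ := by rw [Real.exp_add]; gcongr

lemma prod_one_add_div_le {Q : ℕ} (hQ : 1 ≤ Q) {P : Finset ℕ} (hP : P ⊆ primesUpTo Q) {k : ℝ}
    (hk : 0 ≤ k) (f : ℕ → ℝ) (hf : ∀ n, 0 ≤ f n) (hfS : ∀ S ⊆ P, k ^ S.card ≤ f (∏ p ∈ S, p))
    (hsum : ∀ X, 1 ≤ X → ∑ a ∈ Icc 1 X, f a / a ≤ 1 + Real.log X) {r : ℕ}
    (hr : Real.exp 1 * ∑ p ∈ P, k / p ≤ r) :
    ∏ p ∈ P, (1 + k / p) ≤ 2 + r * Real.log Q := by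
  have hprime : ∀ p ∈ P, p.Prime := fun p hp => prime_of_mem (hP hp)
  rw [Finset.prod_one_add, ← Finset.sum_filter_add_sum_filter_not _ (fun S => r ≤ S.card)]
  have h1 := sum_powerset_prod_tail_le P (fun p => k / p) (fun p _ => by positivity) r
  have h2 : Real.exp (Real.exp 1 * ∑ p ∈ P, k / p - r) ≤ 1 := Real.exp_le_one_iff.2 (by linarith)
  have h3 : ∑ S ∈ P.powerset with ¬ r ≤ S.card, ∏ p ∈ S, k / (p : ℝ) ≤ 1 + r * Real.log Q := by
    have h4 := hsum (Q ^ r) (Nat.one_le_pow _ _ hQ)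
    push_cast at h4
    rw [Real.log_pow] at h4
    refine le_trans ?_ h4
    have hinj : Set.InjOn (fun S : Finset ℕ => ∏ p ∈ S, p)
        (({S ∈ P.powerset | ¬ r ≤ S.card} : Finset (Finset ℕ)) : Set (Finset ℕ)) := by
      intro S hS T hT hST
      simp only [coe_filter, mem_powerset, Set.mem_ofPred_eq] at hS hT
      have h5 : ∀ U ⊆ P, (∏ p ∈ U, p).primeFactors = U := fun U hU =>
        Nat.primeFactors_prod fun p hp => hprime p (hU hp)
      rw [← h5 S hS.1, ← h5 T hT.1]
      exact congrArg _ hST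
    calc ∑ S ∈ P.powerset with ¬ r ≤ S.card, ∏ p ∈ S, k / (p : ℝ)
        ≤ ∑ S ∈ P.powerset with ¬ r ≤ S.card, f (∏ p ∈ S, p) / (∏ p ∈ S, p : ℕ) := by
          refine Finset.sum_le_sum fun S hS => ?_
          rw [Finset.prod_div_distrib, Finset.prod_const]
          push_cast
          gcongr
          exact hfS S (mem_powerset.1 (mem_filter.1 hS).1)
      _ = ∑ a ∈ ({S ∈ P.powerset | ¬ r ≤ S.card}).image (fun S : Finset ℕ => ∏ p ∈ S, p),
            f a / a := by rw [Finset.sum_image hinj]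
      _ ≤ _ := by
          refine Finset.sum_le_sum_of_subset_of_nonneg ?_
            fun a _ _ => div_nonneg (hf a) (Nat.cast_nonneg _)
          intro a ha
          obtain ⟨S, hS, rfl⟩ := mem_image.1 ha
          simp only [mem_filter, mem_powerset] at hS
          rw [mem_Icc]
          refine ⟨Finset.prod_pos fun p hp => (hprime p (hS.1 hp)).pos, ?_⟩
          calc ∏ p ∈ S, p ≤ Q ^ S.card :=
                Finset.prod_le_pow_card _ _ _ fun p hp => (mem_primesUpTo.1 (hP (hS.1 hp))).2
            _ ≤ Q ^ r := Nat.pow_le_pow_right hQ (by omega)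
  linarith

lemma sum_inv_le_one_add_log {X : ℕ} (hX : 1 ≤ X) :
    ∑ a ∈ Icc 1 X, (1 : ℝ) / a ≤ 1 + Real.log X :=
  sum_Icc_inv_le X X (by exact_mod_cast hX) le_rfl

lemma sum_rSum_div_le {X : ℕ} (hX : 1 ≤ X) : ∑ a ∈ Icc 1 X, rSum a / a ≤ 1 + Real.log X := by
  have h1 : ∑ a ∈ Icc 1 X, rSum a / a
      = ∑ m ∈ Icc 1 X, (1 : ℝ) / m * ∑ d ∈ Ioc 0 (X / m), chi4 d * (1 / d) := by
    have e1 : ∀ a ∈ Icc 1 X, rSum a / a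
        = ∑ x ∈ a.divisorsAntidiagonal, (1 : ℝ) / x.1 * (chi4 x.2 * (1 / x.2)) := by
      intro a ha
      rw [Nat.sum_divisorsAntidiagonal' (fun i j => (1 : ℝ) / i * (chi4 j * (1 / j))), rSum,
        Finset.sum_div]
      refine Finset.sum_congr rfl fun d hd => ?_
      obtain ⟨⟨c, rfl⟩, h0⟩ := Nat.mem_divisors.1 hd
      have hd0 : d ≠ 0 := left_ne_zero_of_mul h0
      rw [Nat.mul_div_cancel_left _ (Nat.pos_of_ne_zero hd0)]
      push_cast
      ring_nf
    rw [Finset.sum_congr rfl e1, Finset.sum_sigma']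
    simp_rw [Finset.mul_sum]
    rw [Finset.sum_sigma']
    refine Finset.sum_bij' (fun x _ => ⟨x.2.1, x.2.2⟩) (fun x _ => ⟨x.1 * x.2, (x.1, x.2)⟩)
      ?_ ?_ ?_ ?_ ?_
    · rintro ⟨a, m, d⟩ h
      simp only [mem_sigma, mem_Icc, Nat.mem_divisorsAntidiagonal, mem_Ioc] at h ⊢
      obtain ⟨⟨h1, h2⟩, rfl, h3⟩ := h
      have hm : 0 < m := Nat.pos_of_ne_zero (left_ne_zero_of_mul h3)
      have hd : 0 < d := Nat.pos_of_ne_zero (right_ne_zero_of_mul h3)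
      refine ⟨⟨hm, (Nat.le_mul_of_pos_right m hd).trans h2⟩, hd, ?_⟩
      rw [Nat.le_div_iff_mul_le hm]; linarith [mul_comm m d]
    · rintro ⟨m, d⟩ h
      simp only [mem_sigma, mem_Icc, Nat.mem_divisorsAntidiagonal, mem_Ioc] at h ⊢
      obtain ⟨⟨h1, h2⟩, h3, h4⟩ := h
      rw [Nat.le_div_iff_mul_le h1] at h4
      exact ⟨⟨Nat.mul_pos h1 h3, by linarith [mul_comm m d]⟩, trivial, (Nat.mul_pos h1 h3).ne'⟩
    · rintro ⟨a, m, d⟩ h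
      simp only [mem_sigma, Nat.mem_divisorsAntidiagonal] at h
      obtain ⟨_, rfl, _⟩ := h
      rfl
    · rintro ⟨m, d⟩ h; rfl
    · rintro ⟨a, m, d⟩ h; rfl
  rw [h1]
  refine le_trans (Finset.sum_le_sum fun m _ => ?_) (sum_inv_le_one_add_log hX)
  have := abs_sum_Ioc_chi4_mul_le (f := fun k => (1 : ℝ) / k)
    (fun k hk => one_div_le_one_div_of_le (by exact_mod_cast hk) (by simp))
    (fun k => by positivity) 0 (X / m)
  have h2 := (le_abs_self _).trans this
  simp only [zero_add, Nat.cast_one, div_one] at h2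
  exact mul_le_of_le_one_right (by positivity) h2

/-- The sum of reciprocals of the primes up to `x`. -/
def primeRecip (x : ℕ) : ℝ := ∑ p ∈ primesUpTo x, (1 : ℝ) / p

lemma primeRecip_nonneg (x : ℕ) : 0 ≤ primeRecip x := Finset.sum_nonneg fun _ _ => by positivity

lemma primeRecip_mono {x y : ℕ} (h : x ≤ y) : primeRecip x ≤ primeRecip y :=
  Finset.sum_le_sum_of_subset_of_nonneg
    (fun p hp => mem_primesUpTo.2 ⟨(mem_primesUpTo.1 hp).1, (mem_primesUpTo.1 hp).2.trans h⟩)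
    fun _ _ _ => by positivity

lemma exp_one_lt_three : Real.exp 1 < 3 := by
  have := Real.exp_one_lt_d9; norm_num at this ⊢; linarith

lemma one_le_log_of_three_le {x : ℕ} (hx : 3 ≤ x) : 1 ≤ Real.log x := by
  rw [Real.le_log_iff_exp_le (by positivity)]
  have : (3 : ℝ) ≤ x := by exact_mod_cast hx
  linarith [exp_one_lt_three]

lemma exp_primeRecip_le_of_primeRecip {x : ℕ} (hx : 3 ≤ x) :
    Real.exp (primeRecip x) ≤ 3 * (2 + (3 * primeRecip x + 1) * Real.log x) := by
  have hlog := one_le_log_of_three_le hx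
  have hg := primeRecip_nonneg x
  have h1 := exp_sum_le_prod (P := primesUpTo x) (fun p hp => (prime_of_mem hp).two_le)
    (k := 1) zero_le_one
  have h2 := prod_one_add_div_le (Q := x) (by omega) (subset_refl _) (k := 1) zero_le_one
    (fun _ => 1) (fun _ => zero_le_one) (fun S _ => by simp)
    (fun X hX => sum_inv_le_one_add_log hX) (r := ⌈Real.exp 1 * primeRecip x⌉₊) (Nat.le_ceil _)
  have h3 : (⌈Real.exp 1 * primeRecip x⌉₊ : ℝ) ≤ 3 * primeRecip x + 1 := by
    have := Nat.ceil_lt_add_one (a := Real.exp 1 * primeRecip x) (by positivity)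
    nlinarith [exp_one_lt_three]
  have h4 : (0 : ℝ) ≤ ∏ p ∈ primesUpTo x, (1 + 1 / (p : ℝ)) :=
    Finset.prod_nonneg fun _ _ => by positivity
  rw [one_pow] at h1
  calc Real.exp (primeRecip x) ≤ Real.exp 1 * ∏ p ∈ primesUpTo x, (1 + 1 / (p : ℝ)) := h1
    _ ≤ 3 * (2 + (3 * primeRecip x + 1) * Real.log x) := by
      apply mul_le_mul exp_one_lt_three.le (h2.trans _) h4 (by norm_num)
      gcongr

lemma primeRecip_le {x : ℕ} (hx : 3 ≤ x) :
    primeRecip x ≤ 2 * Real.log (Real.log x) + 8 := by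
  have hlog := one_le_log_of_three_le hx
  have hg := primeRecip_nonneg x
  have h1 := exp_primeRecip_le_of_primeRecip hx
  set g := primeRecip x
  have h2 : 1 + g / 2 ≤ Real.exp (g / 2) := by linarith [Real.add_one_le_exp (g / 2)]
  have h3 : Real.exp g = Real.exp (g / 2) * Real.exp (g / 2) := by rw [← Real.exp_add]; ring_nf
  have h4 : Real.exp (g / 2) ≤ 24 * Real.log x := by
    have h5 : 0 < Real.exp (g / 2) := Real.exp_pos _
    have h6 : Real.exp (g / 2) * Real.exp (g / 2) ≤ Real.exp (g / 2) * (24 * Real.log x) := by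
      rw [← h3]
      nlinarith
    exact le_of_mul_le_mul_left h6 h5
  have h5 : g / 2 ≤ Real.log (24 * Real.log x) := by
    rw [Real.le_log_iff_exp_le (by positivity)]; exact h4
  rw [Real.log_mul (by norm_num) (by positivity)] at h5
  have h6 : Real.log 24 ≤ 4 := by
    rw [Real.log_le_iff_le_exp (by norm_num)]
    have h7 := Real.exp_one_gt_d9
    have : Real.exp 4 = Real.exp 1 ^ 4 := by rw [← Real.exp_nat_mul]; norm_num
    rw [this]
    calc (24 : ℝ) ≤ 2.7 ^ 4 := by norm_num
      _ ≤ _ := by gcongr; linarith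
  linarith

lemma exp_primeRecip_le {x : ℕ} (hx : 3 ≤ x) :
    Real.exp (primeRecip x) ≤ 100 * (1 + Real.log (Real.log x)) * Real.log x := by
  have hlog := one_le_log_of_three_le hx
  have h1 := exp_primeRecip_le_of_primeRecip hx
  have h2 := primeRecip_le hx
  have h3 := Real.log_nonneg hlog
  nlinarith

lemma log_le_exp_primeRecip (x : ℕ) : Real.log x ≤ 9 * Real.exp (primeRecip x) := by
  rcases Nat.eq_zero_or_pos x with rfl | hx
  · simp; positivity
  have h1 : Real.log x ≤ ∑ a ∈ Icc 1 x, (1 : ℝ) / a := by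
    have := log_add_one_le_harmonic x
    rw [harmonic_eq_sum_Icc] at this
    push_cast at this
    simp_rw [one_div]
    refine le_trans (Real.log_le_log (by exact_mod_cast hx) (by linarith)) this
  have h2 : ∑ a ∈ Icc 1 x, (1 : ℝ) / a ≤ ∏ p ∈ primesUpTo x, (1 + (1 / (p : ℝ) + 2 * (1 / p ^ 2))) := by
    apply sum_le_prod_one_add (φ := fun n : ℕ => (1 : ℝ) / n) (fun n => by positivity) (by simp)
      (fun m n _ => by push_cast; rw [one_div_mul_one_div]) _ (fun p hp => prime_of_mem hp)
    · intro p hp K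
      have hp2 : (2 : ℝ) ≤ p := by exact_mod_cast (prime_of_mem hp).two_le
      have h3 : ∑ k ∈ range K, 1 / ((p ^ (k + 1) : ℕ) : ℝ) ≤ 1 / (p - 1) := by
        have : ∀ K : ℕ, ∑ k ∈ range K, 1 / ((p ^ (k + 1) : ℕ) : ℝ)
            = (1 - 1 / (p : ℝ) ^ K) / (p - 1) := by
          intro K
          induction K with
          | zero => simp
          | succ K ih =>
            rw [Finset.sum_range_succ, ih]
            push_cast
            have : (p : ℝ) - 1 ≠ 0 := by linarith
            field_simp
            ring
        rw [this]
        apply div_le_div_of_nonneg_right _ (by linarith)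
        have : (0 : ℝ) ≤ 1 / (p : ℝ) ^ K := by positivity
        linarith
      refine h3.trans ?_
      rw [div_le_iff₀ (by linarith)]
      field_simp
      nlinarith
    · intro a ha
      rw [mem_Icc] at ha
      exact ⟨by omega, fun p hp hd => mem_primesUpTo.2 ⟨hp, (Nat.le_of_dvd (by omega) hd).trans ha.2⟩⟩
  have h3 := prod_one_add_le_exp_sum (primesUpTo x) (fun p => 1 / (p : ℝ) + 2 * (1 / p ^ 2))
    (fun p _ => by positivity)
  rw [Finset.sum_add_distrib, ← Finset.mul_sum] at h3
  have h4 := sum_inv_sq_le_one (P := primesUpTo x) (fun p hp => (prime_of_mem hp).two_le)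
  refine h1.trans (h2.trans (h3.trans ?_))
  have h5 : Real.exp 2 ≤ 9 := by
    have : Real.exp 2 = Real.exp 1 ^ 2 := by rw [← Real.exp_nat_mul]; norm_num
    rw [this]; nlinarith [exp_one_lt_three, Real.exp_pos 1]
  calc _ ≤ Real.exp (primeRecip x + 2) := by
        apply Real.exp_le_exp.2; unfold primeRecip; linarith
    _ = Real.exp 2 * Real.exp (primeRecip x) := by rw [Real.exp_add, mul_comm]
    _ ≤ _ := by gcongr

lemma rSum_prod_of_mod_four_eq_one {S : Finset ℕ} (hS : ∀ p ∈ S, p.Prime ∧ p % 4 = 1) :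
    rSum (∏ p ∈ S, p) = 2 ^ S.card := by
  induction S using Finset.induction_on with
  | empty => simp [rSum, chi4_one]
  | insert q S hq ih =>
    rw [Finset.prod_insert hq, rSum_mul, ih fun p hp => hS p (mem_insert_of_mem hp),
      card_insert_of_notMem hq, pow_succ']
    · have h := hS q (mem_insert_self _ _)
      have := rSum_prime_pow h.1 1
      rw [pow_one] at this
      rw [this]
      have h4 : chi4 q = 1 := by simp [chi4, h.2]
      simp [h4, one_add_one_eq_two]
    · apply Nat.Coprime.prod_right
      intro p hp
      rw [Nat.coprime_primes (hS q (mem_insert_self _ _)).1 (hS p (mem_insert_of_mem hp)).1]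
      rintro rfl; exact hq hp

lemma exp_sum_one_add_chi4_le {x : ℕ} (hx : 3 ≤ x) :
    Real.exp (∑ p ∈ primesUpTo x, (1 + chi4 p) / p)
      ≤ 10000 * (1 + Real.log (Real.log x)) * Real.log x := by
  have hlog := one_le_log_of_three_le hx
  have hll := Real.log_nonneg hlog
  set P := {p ∈ primesUpTo x | p % 4 = 1} with hPdef
  have hPs : P ⊆ primesUpTo x := Finset.filter_subset _ _
  have h0 : ∑ p ∈ P, (2 : ℝ) / p ≤ 2 * primeRecip x := by
    unfold primeRecip
    rw [Finset.mul_sum]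
    calc ∑ p ∈ P, (2 : ℝ) / p = ∑ p ∈ P, 2 * (1 / (p : ℝ)) :=
          Finset.sum_congr rfl fun p _ => by ring
      _ ≤ _ := Finset.sum_le_sum_of_subset_of_nonneg hPs fun _ _ _ => by positivity
  have hs0 : 0 ≤ ∑ p ∈ P, (2 : ℝ) / p := Finset.sum_nonneg fun _ _ => by positivity
  have h1 := exp_sum_le_prod (P := P) (fun p hp => (prime_of_mem (hPs hp)).two_le)
    (k := 2) zero_le_two
  have h2 := prod_one_add_div_le (Q := x) (by omega) hPs (k := 2) zero_le_two
    rSum rSum_nonneg (fun S hS => (rSum_prod_of_mod_four_eq_one fun p hp =>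
      ⟨prime_of_mem (hPs (hS hp)), (mem_filter.1 (hS hp)).2⟩).ge)
    (fun X hX => sum_rSum_div_le hX) (r := ⌈Real.exp 1 * ∑ p ∈ P, (2 : ℝ) / p⌉₊) (Nat.le_ceil _)
  have h3 : (⌈Real.exp 1 * ∑ p ∈ P, (2 : ℝ) / p⌉₊ : ℝ) ≤ 6 * primeRecip x + 1 := by
    have := Nat.ceil_lt_add_one (a := Real.exp 1 * ∑ p ∈ P, (2 : ℝ) / p) (by positivity)
    nlinarith [exp_one_lt_three]
  have h4 := primeRecip_le hx
  have h5 : ∑ p ∈ primesUpTo x, (1 + chi4 p) / p ≤ 1 / 2 + ∑ p ∈ P, (2 : ℝ) / p := by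
    have h6 : ∑ p ∈ primesUpTo x, (1 + chi4 p) / p
        ≤ ∑ p ∈ primesUpTo x, ((if p = 2 then (1 / 2 : ℝ) else 0)
          + if p % 4 = 1 then (2 : ℝ) / p else 0) := by
      refine Finset.sum_le_sum fun p hp => ?_
      rcases (prime_of_mem hp).eq_two_or_odd with rfl | h
      · norm_num [chi4]
      · have h7 : p % 4 = 1 ∨ p % 4 = 3 := by omega
        have h8 : p ≠ 2 := by rintro rfl; omega
        rcases h7 with h7 | h7 <;> simp [chi4, h7, h8]
        norm_num
    refine h6.trans ?_
    rw [Finset.sum_add_distrib, hPdef, Finset.sum_filter]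
    gcongr
    rw [Finset.sum_ite_eq']
    split_ifs <;> norm_num
  have h8 : Real.exp (1 / 2 + 4) ≤ 100 := by
    have h9 : Real.exp (1 / 2 + 4) ^ 2 = Real.exp 1 ^ 9 := by
      rw [← Real.exp_nat_mul, ← Real.exp_nat_mul]; norm_num
    have h10 : Real.exp 1 ^ 9 ≤ 2.7183 ^ 9 := by
      have := Real.exp_one_lt_d9
      gcongr; linarith
    have h11 : (2.7183 : ℝ) ^ 9 ≤ 100 ^ 2 := by norm_num
    exact le_of_sq_le_sq (by linarith) (by norm_num)
  calc Real.exp (∑ p ∈ primesUpTo x, (1 + chi4 p) / p)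
      ≤ Real.exp (1 / 2) * Real.exp (∑ p ∈ P, (2 : ℝ) / p) := by
        rw [← Real.exp_add]; exact Real.exp_le_exp.2 h5
    _ ≤ Real.exp (1 / 2) * (Real.exp 4 * (2 + (6 * primeRecip x + 1) * Real.log x)) := by
        refine mul_le_mul_of_nonneg_left (h1.trans ?_) (Real.exp_pos _).le
        norm_num only [show (2 : ℝ) ^ 2 = 4 by norm_num]
        refine mul_le_mul_of_nonneg_left (h2.trans ?_) (Real.exp_pos _).le
        gcongr
    _ = Real.exp (1 / 2 + 4) * (2 + (6 * primeRecip x + 1) * Real.log x) := by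
        rw [Real.exp_add, mul_assoc]
    _ ≤ 100 * (2 + (6 * primeRecip x + 1) * Real.log x) := by
        gcongr
        have := primeRecip_nonneg x
        positivity
    _ ≤ _ := by nlinarith

lemma abs_card_modEq_sub_le (X m r : ℕ) (hm : 0 < m) :
    |(#{n ∈ Ioc 0 X | n ≡ r [MOD m]} : ℝ) - X / m| ≤ 1 := by
  have h := Nat.Ioc_filter_modEq_card 0 X hm r
  have hm' : (0 : ℚ) < m := by exact_mod_cast hm
  have h1 : ⌊((0 : ℕ) - r : ℚ) / m⌋ ≤ ⌊(X - r : ℚ) / m⌋ := by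
    apply Int.floor_le_floor
    gcongr
    simp
  rw [max_eq_left (by linarith)] at h
  have h2 := Int.floor_le ((X - r : ℚ) / m)
  have h3 := Int.lt_floor_add_one ((X - r : ℚ) / m)
  have h4 := Int.floor_le (((0 : ℕ) - r : ℚ) / m)
  have h5 := Int.lt_floor_add_one (((0 : ℕ) - r : ℚ) / m)
  have h6 : ((#{n ∈ Ioc 0 X | n ≡ r [MOD m]} : ℤ) : ℚ)
      = ⌊(X - r : ℚ) / m⌋ - ⌊((0 : ℕ) - r : ℚ) / m⌋ := by
    rw [h]; push_cast; rfl
  have h7 : |(#{n ∈ Ioc 0 X | n ≡ r [MOD m]} : ℚ) - X / m| ≤ 1 := by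
    push_cast at h6
    rw [h6, abs_le]
    have e1 : (X - r : ℚ) / m = X / m - r / m := by ring
    have e2 : ((0 : ℕ) - r : ℚ) / m = - (r / m) := by push_cast; ring
    push_cast at *
    constructor <;> linarith
  have h8 : ((|(#{n ∈ Ioc 0 X | n ≡ r [MOD m]} : ℚ) - X / m| : ℚ) : ℝ) ≤ 1 := by exact_mod_cast h7
  push_cast at h8
  exact h8

lemma abs_card_residues_sub_le (Ω : ℕ → Finset ℕ) (k : ℕ) (S : Finset ℕ)
    (hS : ∀ p ∈ S, p.Prime ∧ Ω p ⊆ range p ∧ (Ω p).card = k) (X m r : ℕ) (hm : 0 < m)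
    (hcop : ∀ p ∈ S, m.Coprime p) :
    |(#{n ∈ Ioc 0 X | n ≡ r [MOD m] ∧ ∀ p ∈ S, n % p ∈ Ω p} : ℝ)
      - X / m * ∏ p ∈ S, ((k : ℝ) / p)| ≤ (k : ℝ) ^ S.card := by
  induction S using Finset.induction_on generalizing m r with
  | empty => simpa using abs_card_modEq_sub_le X m r hm
  | insert q S hq ih =>
    have hqp := hS q (mem_insert_self _ _)
    have hmq := hcop q (mem_insert_self _ _)
    have e1 : (#{n ∈ Ioc 0 X | n ≡ r [MOD m] ∧ ∀ p ∈ insert q S, n % p ∈ Ω p})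
        = ∑ ω ∈ Ω q, #{n ∈ Ioc 0 X | n ≡ (Nat.chineseRemainder hmq r ω : ℕ) [MOD m * q] ∧
            ∀ p ∈ S, n % p ∈ Ω p} := by
      rw [Finset.card_eq_sum_card_fiberwise (f := fun n => n % q) (t := Ω q)]
      · refine Finset.sum_congr rfl fun ω hω => ?_
        congr 1
        ext n
        have hω' : ω < q := mem_range.1 (hqp.2.1 hω)
        have hcr := (Nat.chineseRemainder hmq r ω).2
        have h2 : n ≡ (Nat.chineseRemainder hmq r ω : ℕ) [MOD m * q] ↔ n ≡ r [MOD m] ∧ n % q = ω := by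
          rw [← Nat.modEq_and_modEq_iff_modEq_mul hmq]
          constructor
          · rintro ⟨a, b⟩
            refine ⟨a.trans hcr.1, ?_⟩
            have := b.trans hcr.2
            rwa [Nat.ModEq, Nat.mod_eq_of_lt hω'] at this
          · rintro ⟨a, b⟩
            refine ⟨a.trans hcr.1.symm, Nat.ModEq.trans ?_ hcr.2.symm⟩
            rw [Nat.ModEq, Nat.mod_eq_of_lt hω', b]
        simp only [mem_filter, Finset.forall_mem_insert, h2]
        constructor
        · rintro ⟨⟨a, b, c, d⟩, e⟩; exact ⟨a, ⟨b, e⟩, d⟩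
        · rintro ⟨a, ⟨b, e⟩, d⟩; exact ⟨⟨a, b, e ▸ hω, d⟩, e⟩
      · intro n hn
        simp only [coe_filter, Set.mem_ofPred_eq, Finset.forall_mem_insert] at hn
        exact hn.2.2.1
    rw [e1, Finset.prod_insert hq, Finset.card_insert_of_notMem hq, pow_succ']
    push_cast
    have hq0 : (q : ℝ) ≠ 0 := by exact_mod_cast hqp.1.ne_zero
    have hm0 : (m : ℝ) ≠ 0 := by exact_mod_cast hm.ne'
    have e2 : (X : ℝ) / m * (k / q * ∏ p ∈ S, ((k : ℝ) / p))
        = ∑ ω ∈ Ω q, (X : ℝ) / (m * q : ℕ) * ∏ p ∈ S, ((k : ℝ) / p) := by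
      rw [Finset.sum_const, hqp.2.2, nsmul_eq_mul]
      push_cast
      field_simp
    rw [e2, ← Finset.sum_sub_distrib]
    calc _ ≤ ∑ ω ∈ Ω q, (k : ℝ) ^ S.card := by
          refine (Finset.abs_sum_le_sum_abs _ _).trans (Finset.sum_le_sum fun ω _ => ?_)
          refine ih (fun p hp => hS p (mem_insert_of_mem hp)) _ _ (Nat.mul_pos hm hqp.1.pos) ?_
          intro p hp
          refine Nat.Coprime.mul_left (hcop p (mem_insert_of_mem hp)) ?_
          rw [Nat.coprime_primes hqp.1 (hS p (mem_insert_of_mem hp)).1]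
          rintro rfl; exact hq hp
      _ = _ := by rw [Finset.sum_const, hqp.2.2, nsmul_eq_mul]

lemma card_sifted_le (Ω : ℕ → Finset ℕ) (k : ℕ) (P : Finset ℕ)
    (hP : ∀ p ∈ P, p.Prime ∧ Ω p ⊆ range p ∧ (Ω p).card = k) (X R : ℕ) :
    (#{n ∈ Ioc 0 X | ∀ p ∈ P, n % p ∉ Ω p} : ℝ)
      ≤ X * (Real.exp (-(k * ∑ p ∈ P, (1 : ℝ) / p))
          + 2 * Real.exp (3 * k * ∑ p ∈ P, (1 : ℝ) / p - R))
        + 3 * ((k : ℝ) * P.card + 1) ^ (R + 1) := by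
  set g : ℝ := ∑ p ∈ P, (1 : ℝ) / p with hg
  have hg0 : 0 ≤ g := Finset.sum_nonneg fun _ _ => by positivity
  have hkg : ∑ p ∈ P, (k : ℝ) / p = k * g := by
    rw [hg, Finset.mul_sum]; exact Finset.sum_congr rfl fun p _ => by ring
  set cnt : Finset ℕ → ℝ := fun S => #{n ∈ Ioc 0 X | ∀ p ∈ S, n % p ∈ Ω p} with hcnt
  have hcount : ∀ S ⊆ P, |cnt S - X * ∏ p ∈ S, ((k : ℝ) / p)| ≤ (k : ℝ) ^ S.card := by
    intro S hS
    have := abs_card_residues_sub_le Ω k S (fun p hp => hP p (hS hp)) X 1 0 one_pos (by simp)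
    simpa [Nat.modEq_one, hcnt] using this
  have hb := abs_sum_sieve_sub_le (fun p n => n % p ∈ Ω p) (Ioc 0 X) P (fun _ => 1) R
  simp only [abs_one, Finset.sum_const, nsmul_eq_mul, mul_one] at hb
  have h1 := (abs_le.1 hb).2
  change (#{n ∈ Ioc 0 X | ∀ p ∈ P, n % p ∉ Ω p} : ℝ)
    - ∑ S ∈ P.powerset with S.card ≤ R, (-1 : ℝ) ^ S.card * cnt S
    ≤ ∑ S ∈ P.powersetCard (R + 1), cnt S at h1
  have htail : ∑ S ∈ P.powerset with R + 1 ≤ S.card, ∏ p ∈ S, (k : ℝ) / p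
      ≤ Real.exp (3 * k * g - R) := by
    refine (sum_powerset_prod_tail_le P (fun p => (k : ℝ) / p) (fun _ _ => by positivity) _).trans ?_
    rw [hkg]
    apply Real.exp_le_exp.2
    have : Real.exp 1 * (k * g) ≤ 3 * (k * g) :=
      mul_le_mul_of_nonneg_right exp_one_lt_three.le (by positivity)
    push_cast
    linarith
  have hmain : ∑ S ∈ P.powerset with S.card ≤ R, (-1 : ℝ) ^ S.card * ∏ p ∈ S, (k : ℝ) / p
      ≤ Real.exp (-(k * g)) + Real.exp (3 * k * g - R) := by
    have e1 : ∏ p ∈ P, (1 - (k : ℝ) / p) ≤ Real.exp (-(k * g)) := by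
      rw [← hkg, ← Finset.sum_neg_distrib, Real.exp_sum]
      refine Finset.prod_le_prod (fun p hp => ?_) fun p _ => ?_
      · have h2 : k ≤ p := by
          have := card_le_card (hP p hp).2.1
          rwa [card_range, (hP p hp).2.2] at this
        have : (k : ℝ) / p ≤ 1 := div_le_one_of_le₀ (by exact_mod_cast h2) (by positivity)
        linarith
      · linarith [Real.add_one_le_exp (-((k : ℝ) / p))]
    have e2 : ∏ p ∈ P, (1 - (k : ℝ) / p)
        = ∑ S ∈ P.powerset, (-1 : ℝ) ^ S.card * ∏ p ∈ S, (k : ℝ) / p := by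
      simp_rw [sub_eq_add_neg]
      rw [Finset.prod_one_add]
      refine Finset.sum_congr rfl fun S _ => ?_
      rw [Finset.prod_neg]
    rw [← Finset.sum_filter_add_sum_filter_not _ (fun S => S.card ≤ R)] at e2
    have e3 : -∑ S ∈ P.powerset with ¬ S.card ≤ R, (-1 : ℝ) ^ S.card * ∏ p ∈ S, (k : ℝ) / p
        ≤ Real.exp (3 * k * g - R) := by
      refine le_trans ?_ htail
      rw [← Finset.sum_neg_distrib]
      have : ({S ∈ P.powerset | ¬ S.card ≤ R}) = {S ∈ P.powerset | R + 1 ≤ S.card} := by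
        ext S; simp
      rw [this]
      refine Finset.sum_le_sum fun S _ => ?_
      have h0 : (0 : ℝ) ≤ ∏ p ∈ S, (k : ℝ) / p := Finset.prod_nonneg fun _ _ => by positivity
      rcases neg_one_pow_eq_or ℝ S.card with h | h <;> rw [h] <;> linarith
    linarith
  have hsmall : ∑ S ∈ P.powerset with S.card ≤ R + 1, (k : ℝ) ^ S.card
      ≤ 3 * ((k : ℝ) * P.card + 1) ^ (R + 1) := by
    have hT : (1 : ℝ) ≤ k * P.card + 1 := by
      have : (0 : ℝ) ≤ k * P.card := by positivity
      linarith
    have := sum_powerset_prod_small_le P (fun _ => (k : ℝ)) (fun _ _ => by positivity) hT (R + 1)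
    simp only [Finset.prod_const, Finset.sum_const, nsmul_eq_mul] at this
    refine this.trans ?_
    rw [mul_comm]
    refine mul_le_mul_of_nonneg_right ?_ (by positivity)
    refine le_trans (Real.exp_le_exp.2 ?_) exp_one_lt_three.le
    rw [div_le_one (by linarith)]
    linarith [mul_comm (P.card : ℝ) k]
  have hA : ∑ S ∈ P.powerset with S.card ≤ R, (-1 : ℝ) ^ S.card * cnt S
      ≤ X * ∑ S ∈ P.powerset with S.card ≤ R, (-1 : ℝ) ^ S.card * ∏ p ∈ S, (k : ℝ) / p
        + ∑ S ∈ P.powerset with S.card ≤ R, (k : ℝ) ^ S.card := by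
    rw [Finset.mul_sum, ← Finset.sum_add_distrib]
    refine Finset.sum_le_sum fun S hS => ?_
    have h2 := abs_le.1 (hcount S (mem_powerset.1 (mem_filter.1 hS).1))
    rcases neg_one_pow_eq_or ℝ S.card with h | h <;> rw [h] <;> linarith [h2.1, h2.2]
  have hB : ∑ S ∈ P.powersetCard (R + 1), cnt S
      ≤ X * Real.exp (3 * k * g - R) + ∑ S ∈ P.powersetCard (R + 1), (k : ℝ) ^ S.card := by
    refine le_trans ?_ (add_le_add_left (mul_le_mul_of_nonneg_left htail (Nat.cast_nonneg X)) _)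
    have h3 : ∑ S ∈ P.powersetCard (R + 1), ∏ p ∈ S, (k : ℝ) / p
        ≤ ∑ S ∈ P.powerset with R + 1 ≤ S.card, ∏ p ∈ S, (k : ℝ) / p := by
      refine Finset.sum_le_sum_of_subset_of_nonneg (fun S hS => ?_)
        fun S _ _ => Finset.prod_nonneg fun _ _ => by positivity
      rw [mem_powersetCard] at hS
      simp [hS.1, hS.2]
    refine le_trans ?_ (add_le_add_left (mul_le_mul_of_nonneg_left h3 (Nat.cast_nonneg X)) _)
    rw [Finset.mul_sum, ← Finset.sum_add_distrib]
    refine Finset.sum_le_sum fun S hS => ?_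
    linarith [(abs_le.1 (hcount S (mem_powersetCard.1 hS).1)).2]
  have hC : ∑ S ∈ P.powerset with S.card ≤ R, (k : ℝ) ^ S.card
      + ∑ S ∈ P.powersetCard (R + 1), (k : ℝ) ^ S.card
      = ∑ S ∈ P.powerset with S.card ≤ R + 1, (k : ℝ) ^ S.card := by
    rw [← Finset.sum_union]
    · congr 1
      ext S
      simp only [mem_union, mem_filter, mem_powerset, mem_powersetCard]
      constructor
      · rintro (⟨a, b⟩ | ⟨a, b⟩) <;> exact ⟨a, by omega⟩
      · rintro ⟨a, b⟩
        rcases Nat.lt_or_ge R S.card with h | h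
        · exact Or.inr ⟨a, by omega⟩
        · exact Or.inl ⟨a, h⟩
    · rw [Finset.disjoint_left]
      intro S h1 h2
      simp only [mem_filter, mem_powersetCard] at h1 h2
      omega
  have hX : (X : ℝ) * ∑ S ∈ P.powerset with S.card ≤ R, (-1 : ℝ) ^ S.card * ∏ p ∈ S, (k : ℝ) / p
      ≤ X * (Real.exp (-(k * g)) + Real.exp (3 * k * g - R)) :=
    mul_le_mul_of_nonneg_left hmain (Nat.cast_nonneg X)
  linarith

/-- `R` is a slowly growing integer compared with `log N`, but larger than `log (log N)`. -/
structure Scale (c : ℝ) (N R : ℕ) : Prop where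
  hR : 10 ^ 4 ≤ R
  hll : 10 ^ 4 * (1 + Real.log (Real.log N)) ≤ R
  hc : 10 ^ 4 * (1 + c) * (1 + Real.log (Real.log N)) ≤ R
  hL : (R : ℝ) ^ 10000 ≤ Real.log N

namespace Scale

variable {c : ℝ} {N R : ℕ}

lemma hR' (h : Scale c N R) : (10 ^ 4 : ℝ) ≤ R := by exact_mod_cast h.hR

lemma pow_le (h : Scale c N R) {k : ℕ} (hk : k ≤ 10000) : (R : ℝ) ^ k ≤ Real.log N :=
  (pow_le_pow_right₀ (by linarith [h.hR']) hk).trans h.hL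

lemma le_pow (h : Scale c N R) {j k : ℕ} (hjk : j ≤ k) : (R : ℝ) ^ j ≤ (R : ℝ) ^ k :=
  pow_le_pow_right₀ (by linarith [h.hR']) hjk

lemma mul_le (h : Scale c N R) : 10 ^ 4 * (R : ℝ) ≤ Real.log N := by
  have := h.pow_le (k := 2) (by norm_num)
  nlinarith [h.hR']

lemma log_ge (h : Scale c N R) : 10 ^ 8 ≤ Real.log N := by
  have := h.mul_le
  have := h.hR'
  linarith

lemma loglog_nonneg (h : Scale c N R) : 0 ≤ Real.log (Real.log N) :=
  Real.log_nonneg (by linarith [h.log_ge])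

lemma N_pos (h : Scale c N R) : 0 < N := by
  rcases Nat.eq_zero_or_pos N with rfl | h1
  · have := h.log_ge; norm_num at this
  · exact h1

lemma exp_log (h : Scale c N R) : Real.exp (Real.log N) = N :=
  Real.exp_log (by exact_mod_cast h.N_pos)

lemma log_eq (h : Scale c N R) : Real.log N = Real.exp (Real.log (Real.log N)) :=
  (Real.exp_log (by linarith [h.log_ge])).symm

lemma three_le (h : Scale c N R) : 3 ≤ N := by
  have h1 := h.exp_log
  have h2 := Real.add_one_le_exp (Real.log N)
  have h3 := h.log_ge
  have : (3 : ℝ) ≤ N := by linarith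
  exact_mod_cast this

lemma loglog_le {x : ℕ} (hx : 3 ≤ x) (hxN : x ≤ N) :
    Real.log (Real.log x) ≤ Real.log (Real.log N) := by
  have h1 := one_le_log_of_three_le hx
  apply Real.log_le_log (by linarith)
  exact Real.log_le_log (by positivity) (by exact_mod_cast hxN)

lemma exp_primeRecip (h : Scale c N R) {x : ℕ} (hx : 3 ≤ x) (hxN : x ≤ N) :
    Real.exp (primeRecip x) ≤ R * Real.log x := by
  have h1 := one_le_log_of_three_le hx
  have h2 := exp_primeRecip_le hx
  have h3 := loglog_le hx hxN
  have h4 := h.hll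
  refine h2.trans (mul_le_mul_of_nonneg_right ?_ (by linarith))
  linarith [Real.log_nonneg h1]

lemma exp_sum_one_add_chi4 (h : Scale c N R) {x : ℕ} (hx : 3 ≤ x) (hxN : x ≤ N) :
    Real.exp (∑ p ∈ primesUpTo x, (1 + chi4 p) / p) ≤ R * Real.log x := by
  have h1 := one_le_log_of_three_le hx
  have h2 := exp_sum_one_add_chi4_le hx
  have h3 := loglog_le hx hxN
  have h4 := h.hll
  refine h2.trans (mul_le_mul_of_nonneg_right ?_ (by linarith))
  linarith

lemma primeRecip_le (h : Scale c N R) {x : ℕ} (hxN : x ≤ N) :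
    primeRecip x ≤ 2 * Real.log (Real.log N) + 8 :=
  (primeRecip_mono hxN).trans (_root_.primeRecip_le h.three_le)

end Scale

/-- The sieving level. -/
def sieveLevel (N R : ℕ) : ℕ := ⌊Real.exp (Real.log N / (100 * (R + 1)))⌋₊

namespace Scale

variable {c : ℝ} {N R : ℕ}

lemma sieveLevel_le_exp : (sieveLevel N R : ℝ) ≤ Real.exp (Real.log N / (100 * (R + 1))) :=
  Nat.floor_le (Real.exp_pos _).le

lemma log_sieveLevel (h : Scale c N R) : Real.log N / (400 * R) ≤ Real.log (sieveLevel N R) := by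
  set t := Real.log N / (100 * (R + 1)) with ht
  have hR := h.hR'
  have h2 := h.pow_le (k := 2) (by norm_num)
  have h1 : Real.log N / (400 * R) ≤ t / 2 := by
    rw [ht, div_div]
    apply div_le_div_of_nonneg_left (by linarith [h.log_ge]) (by positivity)
    nlinarith
  have h3 : 2 ≤ t / 2 := by
    refine le_trans ?_ h1
    rw [le_div_iff₀ (by positivity)]
    nlinarith
  refine h1.trans ?_
  have h4 : Real.exp (t / 2) ≤ sieveLevel N R := by
    have h5 : Real.exp t < sieveLevel N R + 1 := Nat.lt_floor_add_one _
    have h6 : Real.exp t = Real.exp (t / 2) * Real.exp (t / 2) := by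
      rw [← Real.exp_add]; ring_nf
    have h7 := Real.add_one_le_exp (t / 2)
    nlinarith
  rw [Real.le_log_iff_exp_le (by linarith [Real.exp_pos (t / 2)])]
  exact h4

lemma sieveLevel_le (h : Scale c N R) : sieveLevel N R ≤ N := by
  have : (sieveLevel N R : ℝ) ≤ N := by
    refine sieveLevel_le_exp.trans ?_
    rw [← h.exp_log, Real.log_exp]
    apply Real.exp_le_exp.2
    apply div_le_self (by linarith [h.log_ge])
    linarith [h.hR']
  exact_mod_cast this

/-- The primes up to the sieving level that do not divide `n`. -/
def _root_.sievePrimes (N R n : ℕ) : Finset ℕ := {p ∈ primesUpTo (sieveLevel N R) | ¬ p ∣ n}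

lemma card_primeFactors_le {n : ℕ} (hn : n ≠ 0) {t : ℝ} (ht : Real.log n ≤ t) :
    (n.primeFactors.card : ℝ) ≤ 3 / 2 * t := by
  have h1 : (2 : ℝ) ^ n.primeFactors.card ≤ n := by
    have h2 : 2 ^ n.primeFactors.card ≤ n :=
      calc 2 ^ n.primeFactors.card ≤ ∏ p ∈ n.primeFactors, p :=
            Finset.pow_card_le_prod _ _ _ fun p hp => (Nat.prime_of_mem_primeFactors hp).two_le
        _ ≤ n := Nat.le_of_dvd (Nat.pos_of_ne_zero hn) (Nat.prod_primeFactors_dvd n)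
    exact_mod_cast h2
  have h3 := Real.log_le_log (by positivity) h1
  rw [Real.log_pow] at h3
  have h4 := Real.log_two_gt_d9
  have h5 : (0 : ℝ) ≤ n.primeFactors.card := by positivity
  norm_num at h4
  nlinarith

lemma exp_neg_sum_sievePrimes (h : Scale c N R) {n : ℕ} (hn : n ≠ 0)
    (hn6 : Real.log n ≤ 6 * Real.log N) :
    Real.exp (-∑ p ∈ sievePrimes N R n, (1 : ℝ) / p) ≤ 10 ^ 8 * R ^ 3 / Real.log N := by
  set L := Real.log N with hLdef
  set M := ⌈L⌉₊ with hM
  set z := sieveLevel N R with hz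
  have hLge := h.log_ge
  have hR := h.hR'
  have hLM : L ≤ M := Nat.le_ceil _
  have hM3 : 3 ≤ M := by
    have : (3 : ℝ) ≤ M := by linarith
    exact_mod_cast this
  have hMlt : (M : ℝ) < L + 1 := Nat.ceil_lt_add_one (by linarith)
  have hdiv : ∑ p ∈ primesUpTo z with p ∣ n, (1 : ℝ) / p ≤ primeRecip M + 9 := by
    have h1 : ∑ p ∈ primesUpTo z with p ∣ n, (1 : ℝ) / p
        ≤ ∑ p ∈ primesUpTo M ∪ n.primeFactors, (if p ∈ primesUpTo M then (1 : ℝ) / p else 1 / L) := by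
      have h2 : ∑ p ∈ primesUpTo z with p ∣ n, (1 : ℝ) / p
          ≤ ∑ p ∈ primesUpTo z with p ∣ n, (if p ∈ primesUpTo M then (1 : ℝ) / p else 1 / L) := by
        refine Finset.sum_le_sum fun p hp => ?_
        split_ifs with hpM
        · exact le_rfl
        · rw [mem_filter, mem_primesUpTo] at hp
          rw [mem_primesUpTo, not_and, not_le] at hpM
          have : (M : ℝ) < p := by exact_mod_cast hpM hp.1.1
          exact one_div_le_one_div_of_le (by linarith) (by linarith)
      refine h2.trans (Finset.sum_le_sum_of_subset_of_nonneg (fun p hp => ?_) fun p _ _ => ?_)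
      · rw [mem_filter, mem_primesUpTo] at hp
        exact mem_union_right _ (Nat.mem_primeFactors.2 ⟨hp.1.1, hp.2, hn⟩)
      · split_ifs <;> positivity
    have h3 : ∑ p ∈ primesUpTo M ∪ n.primeFactors, (if p ∈ primesUpTo M then (1 : ℝ) / p else 1 / L)
        ≤ ∑ p ∈ primesUpTo M, (1 : ℝ) / p + ∑ p ∈ n.primeFactors, 1 / L := by
      rw [← Finset.sum_sdiff (s₁ := primesUpTo M) subset_union_left, add_comm]
      apply add_le_add
      · exact (Finset.sum_congr rfl fun p hp => if_pos hp).le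
      · refine le_trans (Finset.sum_congr rfl fun p hp => if_neg (mem_sdiff.1 hp).2).le ?_
        refine Finset.sum_le_sum_of_subset_of_nonneg (fun p hp => ?_) fun p _ _ => by positivity
        rw [mem_sdiff, mem_union] at hp
        tauto
    have h4 : ∑ p ∈ n.primeFactors, 1 / L ≤ 9 := by
      rw [Finset.sum_const, nsmul_eq_mul, mul_one_div, div_le_iff₀ (by linarith)]
      linarith [card_primeFactors_le hn hn6]
    unfold primeRecip
    linarith
  have hsplit : primeRecip z = ∑ p ∈ primesUpTo z with p ∣ n, (1 : ℝ) / p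
      + ∑ p ∈ sievePrimes N R n, (1 : ℝ) / p :=
    (Finset.sum_filter_add_sum_filter_not _ (fun p => p ∣ n) _).symm
  have hlogz := h.log_sieveLevel
  have hMexp : Real.exp (primeRecip M) ≤ R ^ 2 := by
    have h5 := exp_primeRecip_le hM3
    have h6 := one_le_log_of_three_le hM3
    have h7 : Real.log M ≤ 1 + Real.log L := by
      have : Real.log M ≤ Real.log (Real.exp 1 * L) := by
        apply Real.log_le_log (by positivity)
        have := Real.add_one_le_exp (1 : ℝ)
        nlinarith
      rwa [Real.log_mul (Real.exp_pos _).ne' (by linarith), Real.log_exp] at this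
    have h8 : Real.log (Real.log M) ≤ Real.log M := (Real.log_le_sub_one_of_pos (by linarith)).trans (by linarith)
    have h9 := h.hll
    have h10 := Real.log_nonneg h6
    nlinarith
  have h11 := log_le_exp_primeRecip z
  calc Real.exp (-∑ p ∈ sievePrimes N R n, (1 : ℝ) / p)
      ≤ Real.exp (primeRecip M + 9 - primeRecip z) := Real.exp_le_exp.2 (by linarith)
    _ = Real.exp (primeRecip M) * Real.exp 1 ^ 9 / Real.exp (primeRecip z) := by
        rw [Real.exp_sub, Real.exp_add, ← Real.exp_nat_mul]; norm_num
    _ ≤ R ^ 2 * 3 ^ 9 / (L / (400 * R) / 9) := by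
        have : 0 < L / (400 * R) / 9 := by
          have : 0 < L := by linarith
          have : (0 : ℝ) < R := by linarith
          positivity
        gcongr
        · exact exp_one_lt_three.le
        · linarith
    _ ≤ _ := by
        have h1 : (0 : ℝ) < R := by linarith
        have h2 : 0 < L := by linarith
        rw [div_le_div_iff₀ (by positivity) h2]
        field_simp
        norm_num

lemma card_sifted_le (h : Scale c N R) {k : ℕ} (hk1 : 1 ≤ k) (hk3 : k ≤ 3) {n : ℕ} (hn : n ≠ 0)
    (hn6 : Real.log n ≤ 6 * Real.log N) (Ω : ℕ → Finset ℕ)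
    (hΩ : ∀ p ∈ sievePrimes N R n, Ω p ⊆ range p ∧ (Ω p).card = k) {X : ℕ}
    (hX : Real.exp (Real.log N / 10) ≤ X) :
    (#{m ∈ Ioc 0 X | ∀ p ∈ sievePrimes N R n, m % p ∉ Ω p} : ℝ)
      ≤ (R ^ 6 / Real.log N) ^ k * X := by
  set P := sievePrimes N R n with hP
  have hPsub : P ⊆ primesUpTo (sieveLevel N R) := filter_subset _ _
  have h1 := _root_.card_sifted_le Ω k P (fun p hp => ⟨prime_of_mem (hPsub hp), hΩ p hp⟩) X R
  refine h1.trans ?_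
  set L := Real.log N with hLdef
  set ℓ := Real.log L with hℓ
  set g := ∑ p ∈ P, (1 : ℝ) / p with hg
  have hLge := h.log_ge
  have hR := h.hR'
  have hℓ0 := h.loglog_nonneg
  have hll := h.hll
  have hk3' : (k : ℝ) ≤ 3 := by exact_mod_cast hk3
  have hk0 : (0 : ℝ) ≤ k := by positivity
  have hg0 : 0 ≤ g := Finset.sum_nonneg fun _ _ => by positivity
  have hgle : g ≤ 2 * ℓ + 8 := by
    refine le_trans ?_ (h.primeRecip_le h.sieveLevel_le)
    exact Finset.sum_le_sum_of_subset_of_nonneg hPsub fun _ _ _ => by positivity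
  have hbase : Real.exp (-g) ≤ 10 ^ 8 * R ^ 3 / L := h.exp_neg_sum_sievePrimes hn hn6
  have hmain : Real.exp (-(k * g)) ≤ (10 ^ 8 * R ^ 3 / L) ^ k := by
    rw [show -(k * g) = k * (-g) by ring, Real.exp_nat_mul]
    gcongr
  have hlow : Real.exp (-3 * ℓ) ≤ (10 ^ 8 * R ^ 3 / L) ^ k := by
    have e1 : Real.exp (-ℓ) ≤ 10 ^ 8 * R ^ 3 / L := by
      rw [Real.exp_neg, Real.exp_log (by linarith), inv_eq_one_div]
      gcongr
      have : (1 : ℝ) ≤ R ^ 3 := one_le_pow₀ (by linarith)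
      linarith
    calc Real.exp (-3 * ℓ) ≤ Real.exp (k * (-ℓ)) := Real.exp_le_exp.2 (by nlinarith)
      _ = Real.exp (-ℓ) ^ k := Real.exp_nat_mul _ _
      _ ≤ _ := by gcongr
  have htail : 2 * Real.exp (3 * k * g - R) ≤ Real.exp (-3 * ℓ) := by
    have e1 : (2 : ℝ) ≤ Real.exp 1 := by linarith [Real.add_one_le_exp (1 : ℝ)]
    calc 2 * Real.exp (3 * k * g - R) ≤ Real.exp 1 * Real.exp (3 * k * g - R) := by gcongr
      _ = Real.exp (1 + (3 * k * g - R)) := by rw [Real.exp_add]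
      _ ≤ _ := by
        apply Real.exp_le_exp.2
        have : k * g ≤ 3 * g := mul_le_mul_of_nonneg_right hk3' hg0
        linarith
  have hrem : 3 * ((k : ℝ) * P.card + 1) ^ (R + 1) ≤ X * Real.exp (-3 * ℓ) := by
    have e1 : (P.card : ℝ) ≤ Real.exp (L / (100 * (R + 1))) := by
      refine le_trans ?_ sieveLevel_le_exp
      have : P.card ≤ sieveLevel N R := by
        refine (card_le_card hPsub).trans ((card_filter_le _ _).trans ?_)
        simp
      exact_mod_cast this
    have e2 : (k : ℝ) * P.card + 1 ≤ Real.exp 2 * Real.exp (L / (100 * (R + 1))) := by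
      have e3 : (1 : ℝ) ≤ Real.exp (L / (100 * (R + 1))) :=
        Real.one_le_exp (div_nonneg (by linarith) (by positivity))
      have e4 : (4 : ℝ) ≤ Real.exp 2 := by
        have : Real.exp 2 = Real.exp 1 ^ 2 := by rw [← Real.exp_nat_mul]; norm_num
        rw [this]
        nlinarith [Real.add_one_le_exp (1 : ℝ)]
      nlinarith
    have e5 : (3 : ℝ) ≤ Real.exp 2 := by linarith [Real.add_one_le_exp (2 : ℝ)]
    calc 3 * ((k : ℝ) * P.card + 1) ^ (R + 1)
        ≤ Real.exp 2 * (Real.exp 2 * Real.exp (L / (100 * (R + 1)))) ^ (R + 1) := by gcongr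
      _ = Real.exp (2 + 2 * (R + 1) + L / 100) := by
          rw [mul_pow, ← Real.exp_nat_mul, ← Real.exp_nat_mul, ← Real.exp_add, ← Real.exp_add]
          congr 1
          push_cast
          field_simp
          ring
      _ ≤ Real.exp (L / 10 + (-3 * ℓ)) := by
          apply Real.exp_le_exp.2
          have := h.mul_le
          linarith
      _ ≤ _ := by rw [Real.exp_add]; gcongr
  set B := (10 ^ 8 * (R : ℝ) ^ 3 / L) ^ k with hB
  have hfin : 3 * B ≤ (R ^ 6 / L) ^ k := by
    have hB0 : 0 ≤ B := by positivity
    calc 3 * B ≤ 3 ^ k * B := by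
          gcongr
          exact le_self_pow₀ (by norm_num) (by omega)
      _ = (3 * (10 ^ 8 * (R : ℝ) ^ 3) / L) ^ k := by rw [hB, ← mul_pow]; ring
      _ ≤ _ := by
          gcongr
          have : (3 * 10 ^ 8 : ℝ) ≤ R ^ 3 :=
            le_trans (by norm_num) (pow_le_pow_left₀ (by norm_num) hR 3)
          have h3 : (0 : ℝ) ≤ R ^ 3 := by positivity
          linarith [mul_le_mul_of_nonneg_right this h3, show (R : ℝ) ^ 6 = R ^ 3 * R ^ 3 by ring]
  have hX0 : (0 : ℝ) ≤ X := by positivity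
  nlinarith [mul_le_mul_of_nonneg_left hmain hX0, mul_le_mul_of_nonneg_left htail hX0,
    mul_le_mul_of_nonneg_left hlow hX0, mul_le_mul_of_nonneg_left hfin hX0]

end Scale

lemma sum_inv_pow_le {p : ℕ} (hp : 2 ≤ p) (K : ℕ) :
    ∑ k ∈ range K, 1 / ((p ^ (k + 1) : ℕ) : ℝ) ≤ 1 / (p : ℝ) + 2 * (1 / p ^ 2) := by
  have hp2 : (2 : ℝ) ≤ p := by exact_mod_cast hp
  have h1 : (p : ℝ) - 1 ≠ 0 := by linarith
  have h2 : ∑ k ∈ range K, 1 / ((p ^ (k + 1) : ℕ) : ℝ) = (1 - 1 / (p : ℝ) ^ K) / (p - 1) := by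
    induction K with
    | zero => simp
    | succ K ih =>
      rw [Finset.sum_range_succ, ih]
      push_cast
      field_simp
      ring
  have h3 : ∑ k ∈ range K, 1 / ((p ^ (k + 1) : ℕ) : ℝ) ≤ 1 / (p - 1) := by
    rw [h2]
    apply div_le_div_of_nonneg_right _ (by linarith)
    have : (0 : ℝ) ≤ 1 / (p : ℝ) ^ K := by positivity
    linarith
  refine h3.trans ?_
  rw [div_le_iff₀ (by linarith)]
  field_simp
  nlinarith

lemma sum_inv_smooth_le {s : Finset ℕ} (hs : ∀ p ∈ s, p.Prime) (S : Finset ℕ)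
    (hS : ∀ a ∈ S, a ≠ 0 ∧ a.primeFactors ⊆ s) :
    ∑ a ∈ S, (1 : ℝ) / a ≤ Real.exp (∑ p ∈ s, (1 : ℝ) / p + 2) := by
  have h2 : ∑ a ∈ S, (1 : ℝ) / a ≤ ∏ p ∈ s, (1 + (1 / (p : ℝ) + 2 * (1 / p ^ 2))) :=
    sum_le_prod_one_add (φ := fun n : ℕ => (1 : ℝ) / n) (fun n => by positivity) (by simp)
      (fun m n _ => by push_cast; rw [one_div_mul_one_div]) _ hs _
      (fun p hp K => sum_inv_pow_le (hs p hp).two_le K) S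
      fun a ha => ⟨(hS a ha).1, fun p hp hd =>
        (hS a ha).2 (Nat.mem_primeFactors.2 ⟨hp, hd, (hS a ha).1⟩)⟩
  have h3 := prod_one_add_le_exp_sum s (fun p => 1 / (p : ℝ) + 2 * (1 / p ^ 2))
    (fun p _ => by positivity)
  rw [Finset.sum_add_distrib, ← Finset.mul_sum] at h3
  have h4 := sum_inv_sq_le_one (P := s) (fun p hp => (hs p hp).two_le)
  exact h2.trans (h3.trans (Real.exp_le_exp.2 (by linarith)))

/-- The weight `1 / a` restricted to numbers with prime factors in `s`. -/
def smoothWeight (s : Finset ℕ) (a : ℕ) : ℝ := if a ≠ 0 ∧ a.primeFactors ⊆ s then 1 / a else 0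

lemma smoothWeight_nonneg (s : Finset ℕ) (a : ℕ) : 0 ≤ smoothWeight s a := by
  unfold smoothWeight; split_ifs <;> positivity

lemma sum_smoothWeight_le {s : Finset ℕ} (hs : ∀ p ∈ s, p.Prime) (S : Finset ℕ) :
    ∑ a ∈ S, smoothWeight s a ≤ Real.exp (∑ p ∈ s, (1 : ℝ) / p + 2) := by
  unfold smoothWeight
  rw [← Finset.sum_filter]
  exact sum_inv_smooth_le hs _ fun a ha => (mem_filter.1 ha).2

lemma summable_smoothWeight {s : Finset ℕ} (hs : ∀ p ∈ s, p.Prime) : Summable (smoothWeight s) :=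
  summable_of_sum_le (smoothWeight_nonneg s) (sum_smoothWeight_le hs)

lemma tsum_smoothWeight_le {s : Finset ℕ} (hs : ∀ p ∈ s, p.Prime) :
    ∑' a, smoothWeight s a ≤ Real.exp (∑ p ∈ s, (1 : ℝ) / p + 2) :=
  Real.tsum_le_of_sum_le (smoothWeight_nonneg s) (sum_smoothWeight_le hs)

lemma hasSum_smoothWeight_dvd {s : Finset ℕ} (hs : ∀ p ∈ s, p.Prime) {m : ℕ} (hm : m ≠ 0)
    (hms : m.primeFactors ⊆ s) :
    HasSum (fun a => if m ∣ a then smoothWeight s a else 0) ((∑' a, smoothWeight s a) / m) := by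
  have hinj : Function.Injective (fun b : ℕ => m * b) := fun a b hab =>
    Nat.eq_of_mul_eq_mul_left (Nat.pos_of_ne_zero hm) hab
  rw [← hinj.hasSum_iff]
  · have h1 : ((fun a => if m ∣ a then smoothWeight s a else 0) ∘ fun b : ℕ => m * b)
        = fun b => smoothWeight s b / m := by
      funext b
      simp only [Function.comp, dvd_mul_right, if_true, smoothWeight]
      by_cases hb : b = 0
      · simp [hb]
      · rw [Nat.primeFactors_mul hm hb]
        have : m.primeFactors ∪ b.primeFactors ⊆ s ↔ b.primeFactors ⊆ s :=
          ⟨fun h => subset_union_right.trans h, fun h => union_subset hms h⟩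
        simp only [ne_eq, mul_eq_zero, hm, hb, or_self, not_false_eq_true, true_and, this]
        split_ifs
        · push_cast; field_simp
        · simp
    rw [h1]
    exact (summable_smoothWeight hs).hasSum.div_const _
  · intro a ha
    rw [if_neg]
    rintro ⟨b, rfl⟩
    exact ha ⟨b, rfl⟩

lemma second_moment_le {s : Finset ℕ} (hs : ∀ p ∈ s, p.Prime) (g : ℕ → ℝ) (Y : ℕ) {D : Finset ℕ}
    (hD : D ⊆ {d ∈ Icc 1 Y | d.primeFactors ⊆ s}) (A : Finset ℕ)
    (hA : ∀ a ∈ A, a ≠ 0 ∧ a.primeFactors ⊆ s) :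
    ∑ a ∈ A, (1 : ℝ) / a * (∑ d ∈ D with d ∣ a, g d) ^ 2
      ≤ (∑' a, smoothWeight s a) * ∑ e ∈ Icc 1 Y with e.primeFactors ⊆ s,
          (e : ℝ) * (∑ d ∈ D with e ∣ d, g d / d) ^ 2 := by
  set Z := ∑' a, smoothWeight s a with hZ
  have hZ0 : 0 ≤ Z := tsum_nonneg (smoothWeight_nonneg s)
  have hDmem : ∀ d ∈ D, d ≠ 0 ∧ d ≤ Y ∧ d.primeFactors ⊆ s := fun d hd => by
    have := hD hd
    simp only [mem_filter, mem_Icc] at this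
    exact ⟨by omega, this.1.2, this.2⟩
  have hsum : HasSum (fun a => smoothWeight s a * (∑ d ∈ D with d ∣ a, g d) ^ 2)
      (∑ d₁ ∈ D, ∑ d₂ ∈ D, g d₁ * g d₂ * (Z / (Nat.lcm d₁ d₂ : ℕ))) := by
    have e1 : (fun a => smoothWeight s a * (∑ d ∈ D with d ∣ a, g d) ^ 2)
        = fun a => ∑ d₁ ∈ D, ∑ d₂ ∈ D, g d₁ * g d₂ *
            (if Nat.lcm d₁ d₂ ∣ a then smoothWeight s a else 0) := by
      funext a
      rw [sq, Finset.sum_filter, Finset.sum_mul_sum, Finset.mul_sum]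
      refine Finset.sum_congr rfl fun d₁ _ => ?_
      rw [Finset.mul_sum]
      refine Finset.sum_congr rfl fun d₂ _ => ?_
      simp only [Nat.lcm_dvd_iff]
      by_cases h1 : d₁ ∣ a <;> by_cases h2 : d₂ ∣ a <;> simp [h1, h2]
      ring
    rw [e1]
    refine hasSum_sum fun d₁ h₁ => hasSum_sum fun d₂ h₂ => HasSum.mul_left _ ?_
    obtain ⟨a1, -, b1⟩ := hDmem d₁ h₁
    obtain ⟨a2, -, b2⟩ := hDmem d₂ h₂
    refine hasSum_smoothWeight_dvd hs (Nat.lcm_ne_zero a1 a2) ?_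
    intro p hp
    obtain ⟨hpp, hpd, -⟩ := Nat.mem_primeFactors.1 hp
    have := (Nat.Prime.dvd_mul hpp).1 (hpd.trans (Nat.lcm_dvd_mul d₁ d₂))
    rcases this with h | h
    · exact b1 (Nat.mem_primeFactors.2 ⟨hpp, h, a1⟩)
    · exact b2 (Nat.mem_primeFactors.2 ⟨hpp, h, a2⟩)
  have hle : ∑ a ∈ A, (1 : ℝ) / a * (∑ d ∈ D with d ∣ a, g d) ^ 2
      ≤ ∑ d₁ ∈ D, ∑ d₂ ∈ D, g d₁ * g d₂ * (Z / (Nat.lcm d₁ d₂ : ℕ)) := by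
    refine le_trans (le_of_eq (Finset.sum_congr rfl fun a ha => ?_))
      (sum_le_hasSum A (fun a _ => mul_nonneg (smoothWeight_nonneg s a) (sq_nonneg _)) hsum)
    rw [smoothWeight, if_pos (hA a ha)]
  have hdiag : ∑ d₁ ∈ D, ∑ d₂ ∈ D, g d₁ * g d₂ * (Z / (Nat.lcm d₁ d₂ : ℕ))
      = Z * ∑ e ∈ Icc 1 Y with e.primeFactors ⊆ s,
          (e.totient : ℝ) * (∑ d ∈ D with e ∣ d, g d / d) ^ 2 := by
    have e1 : ∀ d₁ ∈ D, ∀ d₂ ∈ D, g d₁ * g d₂ * (Z / (Nat.lcm d₁ d₂ : ℕ))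
        = Z * ∑ e ∈ Icc 1 Y with e.primeFactors ⊆ s, (e.totient : ℝ) *
          ((if e ∣ d₁ then g d₁ / d₁ else 0) * (if e ∣ d₂ then g d₂ / d₂ else 0)) := by
      intro d₁ h₁ d₂ h₂
      obtain ⟨a1, c1, b1⟩ := hDmem d₁ h₁
      obtain ⟨a2, -, b2⟩ := hDmem d₂ h₂
      have hg0 : Nat.gcd d₁ d₂ ≠ 0 := Nat.gcd_ne_zero_left a1
      have h3 : ∑ e ∈ Icc 1 Y with e.primeFactors ⊆ s, (e.totient : ℝ) *
          ((if e ∣ d₁ then g d₁ / d₁ else 0) * (if e ∣ d₂ then g d₂ / d₂ else 0))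
          = ∑ e ∈ (Nat.gcd d₁ d₂).divisors, (e.totient : ℝ) * (g d₁ / d₁ * (g d₂ / d₂)) := by
        rw [← Finset.sum_subset (s₁ := (Nat.gcd d₁ d₂).divisors)]
        · refine Finset.sum_congr rfl fun e he => ?_
          have := (Nat.dvd_gcd_iff.1 (Nat.dvd_of_mem_divisors he))
          rw [if_pos this.1, if_pos this.2]
        · intro e he
          have h4 := Nat.dvd_gcd_iff.1 (Nat.dvd_of_mem_divisors he)
          simp only [mem_filter, mem_Icc]
          exact ⟨⟨Nat.pos_of_dvd_of_pos h4.1 (Nat.pos_of_ne_zero a1),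
            (Nat.le_of_dvd (Nat.pos_of_ne_zero a1) h4.1).trans c1⟩,
            (Nat.primeFactors_mono h4.1 a1).trans b1⟩
        · intro e _ he
          have : ¬ (e ∣ d₁ ∧ e ∣ d₂) := fun h4 =>
            he (Nat.mem_divisors.2 ⟨Nat.dvd_gcd h4.1 h4.2, hg0⟩)
          by_cases h4 : e ∣ d₁
          · have h5 : ¬ e ∣ d₂ := fun h5 => this ⟨h4, h5⟩
            simp [h5]
          · simp [h4]
      rw [h3, ← Finset.sum_mul, ← Nat.cast_sum, Nat.sum_totient]
      have h5 : (Nat.gcd d₁ d₂ : ℝ) * (Nat.lcm d₁ d₂ : ℕ) = d₁ * d₂ := by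
        exact_mod_cast Nat.gcd_mul_lcm d₁ d₂
      have h6 : ((Nat.lcm d₁ d₂ : ℕ) : ℝ) ≠ 0 := by exact_mod_cast Nat.lcm_ne_zero a1 a2
      have h7 : (d₁ : ℝ) ≠ 0 := by exact_mod_cast a1
      have h8 : (d₂ : ℝ) ≠ 0 := by exact_mod_cast a2
      field_simp
      linear_combination (-(g d₁ * g d₂ * Z)) * h5
    rw [Finset.sum_congr rfl fun d₁ h₁ => Finset.sum_congr rfl fun d₂ h₂ => e1 d₁ h₁ d₂ h₂]
    simp_rw [← Finset.mul_sum]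
    congr 1
    rw [Finset.sum_congr rfl fun d₁ h₁ => Finset.sum_comm, Finset.sum_comm]
    refine Finset.sum_congr rfl fun e _ => ?_
    simp_rw [← Finset.mul_sum]
    rw [sq, Finset.sum_filter, Finset.sum_mul_sum]
    simp_rw [← Finset.mul_sum]
  rw [hdiag] at hle
  refine hle.trans (mul_le_mul_of_nonneg_left (Finset.sum_le_sum fun e _ => ?_) hZ0)
  exact mul_le_mul_of_nonneg_right (by exact_mod_cast Nat.totient_le e) (sq_nonneg _)

/-- The sum of `chi4 d` over divisors `d` of `a` such that `d * n` lies in `(x, y]`. -/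
def windowSum (a n : ℕ) (x y : ℝ) : ℝ :=
  ∑ d ∈ a.divisors, if x < (d * n : ℝ) ∧ (d * n : ℝ) ≤ y then chi4 d else 0

/-- The sum of `chi4 c / c` over `c ∈ (x, y]` with prime factors in `s`. -/
def smoothLSum (s : Finset ℕ) (N : ℕ) (x y : ℝ) : ℝ :=
  ∑ c ∈ (Icc 1 N).filter fun c : ℕ => c.primeFactors ⊆ s ∧ x < (c : ℝ) ∧ (c : ℝ) ≤ y, chi4 c / c

lemma sum_windowSum_sq_le {s : Finset ℕ} (hs : ∀ p ∈ s, p.Prime) {N n : ℕ} (hn : 1 ≤ n) {x y : ℝ}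
    (hy : y ≤ N) (A : Finset ℕ) (hA : ∀ a ∈ A, a ≠ 0 ∧ a.primeFactors ⊆ s) :
    ∑ a ∈ A, (1 : ℝ) / a * windowSum a n x y ^ 2
      ≤ (∑' a, smoothWeight s a) * ∑ e ∈ Icc 1 N with e.primeFactors ⊆ s,
          (1 : ℝ) / e * smoothLSum s N (x / (e * n)) (y / (e * n)) ^ 2 := by
  have hn0 : (1 : ℝ) ≤ n := by exact_mod_cast hn
  have hZ0 : 0 ≤ ∑' a, smoothWeight s a := tsum_nonneg (smoothWeight_nonneg s)
  set D : Finset ℕ := {d ∈ Icc 1 N | d.primeFactors ⊆ s ∧ x < (d * n : ℝ) ∧ (d * n : ℝ) ≤ y} with hD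
  have h1 := second_moment_le hs chi4 N (D := D)
    (fun d hd => by simp only [hD, mem_filter] at hd ⊢; exact ⟨hd.1, hd.2.1⟩) A hA
  have h2 : ∀ a ∈ A, windowSum a n x y = ∑ d ∈ D with d ∣ a, chi4 d := by
    intro a ha
    rw [windowSum, ← Finset.sum_filter]
    refine Finset.sum_congr ?_ fun _ _ => rfl
    ext d
    simp only [hD, mem_filter, Nat.mem_divisors, mem_Icc]
    constructor
    · rintro ⟨⟨h3, h4⟩, h5, h6⟩
      have h7 : 1 ≤ d := Nat.pos_of_dvd_of_pos h3 (Nat.pos_of_ne_zero h4)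
      have h8 : (d : ℝ) ≤ N := by
        have : (d : ℝ) ≤ d * n := le_mul_of_one_le_right (by positivity) hn0
        linarith
      exact ⟨⟨⟨h7, by exact_mod_cast h8⟩, (Nat.primeFactors_mono h3 h4).trans (hA a ha).2, h5, h6⟩, h3⟩
    · rintro ⟨⟨_, _, h5⟩, h3⟩
      exact ⟨⟨h3, (hA a ha).1⟩, h5⟩
  rw [Finset.sum_congr rfl fun a ha => by rw [h2 a ha]]
  refine h1.trans (mul_le_mul_of_nonneg_left (Finset.sum_le_sum fun e he => ?_) hZ0)
  simp only [mem_filter, mem_Icc] at he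
  have he0 : (1 : ℝ) ≤ e := by exact_mod_cast he.1.1
  have h3 : ∑ d ∈ D with e ∣ d, chi4 d / d
      = chi4 e / e * smoothLSum s N (x / (e * n)) (y / (e * n)) := by
    rw [smoothLSum, Finset.mul_sum]
    symm
    refine Finset.sum_bij (fun c _ => e * c) ?_ ?_ ?_ ?_
    · intro c hc
      simp only [mem_filter, mem_Icc, hD] at hc ⊢
      obtain ⟨⟨h4, h5⟩, h6, h7, h8⟩ := hc
      rw [div_lt_iff₀ (by positivity)] at h7
      rw [le_div_iff₀ (by positivity)] at h8
      have h9 : ((e * c : ℕ) : ℝ) * n ≤ y := by push_cast; linarith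
      have h10 : ((e * c : ℕ) : ℝ) ≤ N := by
        have : ((e * c : ℕ) : ℝ) ≤ ((e * c : ℕ) : ℝ) * n := le_mul_of_one_le_right (by positivity) hn0
        linarith
      refine ⟨⟨⟨Nat.mul_pos he.1.1 h4, by exact_mod_cast h10⟩, ?_, ?_, h9⟩, dvd_mul_right _ _⟩
      · rw [Nat.primeFactors_mul (by omega) (by omega)]
        exact union_subset he.2 h6
      · push_cast; linarith
    · intro a _ b _ hab
      exact Nat.eq_of_mul_eq_mul_left he.1.1 hab
    · intro d hd
      simp only [mem_filter, mem_Icc, hD] at hd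
      obtain ⟨⟨⟨h4, h5⟩, h6, h7, h8⟩, c, rfl⟩ := hd
      refine ⟨c, ?_, rfl⟩
      have hc0 : c ≠ 0 := by rintro rfl; simp at h4
      simp only [mem_filter, mem_Icc]
      refine ⟨⟨by omega, (Nat.le_mul_of_pos_left c he.1.1).trans h5⟩,
        (Nat.primeFactors_mono (dvd_mul_left c e) (by omega)).trans h6, ?_, ?_⟩
      · rw [div_lt_iff₀ (by positivity)]; push_cast at h7; linarith
      · rw [le_div_iff₀ (by positivity)]; push_cast at h8; linarith
    · intro c _
      rw [chi4_mul]
      push_cast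
      ring
  rw [h3]
  have h4 : chi4 e ^ 2 ≤ 1 := by
    rw [sq_le_one_iff_abs_le_one]; exact abs_chi4_le e
  calc (e : ℝ) * (chi4 e / e * smoothLSum s N (x / (e * n)) (y / (e * n))) ^ 2
      = chi4 e ^ 2 * (1 / e * smoothLSum s N (x / (e * n)) (y / (e * n)) ^ 2) := by
        field_simp
    _ ≤ _ := mul_le_of_le_one_left (by positivity) h4

lemma sum_Ioc_dvd (f : ℕ → ℝ) {d : ℕ} (hd : 0 < d) (u v : ℕ) :
    ∑ n ∈ Ioc u v with d ∣ n, f n = ∑ k ∈ Ioc (u / d) (v / d), f (d * k) := by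
  symm
  refine Finset.sum_bij (fun k _ => d * k) ?_ ?_ ?_ fun _ _ => rfl
  · intro k hk
    simp only [mem_filter, mem_Ioc] at hk ⊢
    rw [Nat.div_lt_iff_lt_mul hd, Nat.le_div_iff_mul_le hd] at hk
    exact ⟨⟨by linarith [mul_comm k d], by linarith [mul_comm k d]⟩, dvd_mul_right _ _⟩
  · intro a _ b _ hab
    exact Nat.eq_of_mul_eq_mul_left hd hab
  · intro n hn
    simp only [mem_filter, mem_Ioc] at hn
    obtain ⟨⟨h1, h2⟩, k, rfl⟩ := hn
    refine ⟨k, ?_, rfl⟩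
    rw [mem_Ioc, Nat.div_lt_iff_lt_mul hd, Nat.le_div_iff_mul_le hd]
    exact ⟨by linarith [mul_comm k d], by linarith [mul_comm k d]⟩

lemma abs_sum_Ioc_chi4_div_dvd_le {d : ℕ} (hd : 0 < d) (u v : ℕ) :
    |∑ n ∈ Ioc u v with d ∣ n, chi4 n / n| ≤ 1 / ((u : ℝ) + 1) := by
  have hd' : (0 : ℝ) < d := by exact_mod_cast hd
  rw [sum_Ioc_dvd (fun n => chi4 n / n) hd]
  have h1 : ∑ k ∈ Ioc (u / d) (v / d), chi4 (d * k) / (d * k : ℕ)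
      = chi4 d / d * ∑ k ∈ Ioc (u / d) (v / d), chi4 k * (1 / (k : ℝ)) := by
    rw [Finset.mul_sum]
    refine Finset.sum_congr rfl fun k _ => ?_
    rw [chi4_mul]; push_cast; ring
  have h2 := abs_sum_Ioc_chi4_mul_le (f := fun k : ℕ => 1 / (k : ℝ))
    (fun k hk => one_div_le_one_div_of_le (by positivity) (by push_cast; linarith))
    (fun k => by positivity) (u / d) (v / d)
  rw [h1, abs_mul, abs_div, Nat.abs_cast]
  have h3 : (u : ℝ) + 1 ≤ d * ((u / d + 1 : ℕ) : ℝ) := by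
    exact_mod_cast Nat.lt_mul_div_succ u hd
  calc |chi4 d| / d * |∑ k ∈ Ioc (u / d) (v / d), chi4 k * (1 / (k : ℝ))|
      ≤ 1 / d * (1 / ((u / d + 1 : ℕ) : ℝ)) := by
        refine mul_le_mul ?_ h2 (abs_nonneg _) (by positivity)
        exact div_le_div_of_nonneg_right (abs_chi4_le d) hd'.le
    _ = 1 / (d * ((u / d + 1 : ℕ) : ℝ)) := by rw [one_div_mul_one_div]
    _ ≤ _ := one_div_le_one_div_of_le (by positivity) h3

lemma sum_Ioc_abs_chi4_div_dvd_le {d N : ℕ} (hd : 0 < d) (hN : 1 ≤ N) (u : ℕ) {v : ℕ}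
    (hv : v ≤ N) :
    ∑ n ∈ Ioc u v with d ∣ n, |chi4 n / n| ≤ 1 / d * (1 + Real.log N) := by
  have hd' : (0 : ℝ) < d := by exact_mod_cast hd
  rw [sum_Ioc_dvd (fun n => |chi4 n / n|) hd]
  calc ∑ k ∈ Ioc (u / d) (v / d), |chi4 (d * k) / (d * k : ℕ)|
      ≤ ∑ k ∈ Ioc (u / d) (v / d), 1 / d * (1 / (k : ℝ)) := by
        refine Finset.sum_le_sum fun k _ => ?_
        rw [abs_div, Nat.abs_cast, one_div_mul_one_div]
        push_cast
        exact div_le_div_of_nonneg_right (abs_chi4_le _) (by positivity)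
    _ ≤ ∑ k ∈ Icc 1 N, 1 / d * (1 / (k : ℝ)) := by
        refine Finset.sum_le_sum_of_subset_of_nonneg (fun k hk => ?_) fun k _ _ => by positivity
        rw [mem_Ioc] at hk
        rw [mem_Icc]
        exact ⟨Nat.one_le_iff_ne_zero.2 fun h0 => by simp [h0] at hk, hk.2.trans ((Nat.div_le_self v d).trans hv)⟩
    _ ≤ _ := by
        rw [← Finset.mul_sum]
        exact mul_le_mul_of_nonneg_left (sum_inv_le_one_add_log hN) (by positivity)

/-- The primes in `(q, N]`. -/
def roughPrimes (q N : ℕ) : Finset ℕ := {p ∈ primesUpTo N | q < p}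

lemma mem_roughPrimes {q N p : ℕ} : p ∈ roughPrimes q N ↔ p.Prime ∧ p ≤ N ∧ q < p := by
  rw [roughPrimes, mem_filter, mem_primesUpTo, and_assoc]

lemma prime_of_mem_roughPrimes {q N p : ℕ} (h : p ∈ roughPrimes q N) : p.Prime :=
  (mem_roughPrimes.1 h).1

lemma primeFactors_subset_roughPrimes_iff {q N c : ℕ} (hc : c ≠ 0) (hcN : c ≤ N) :
    c.primeFactors ⊆ roughPrimes q N ↔ ∀ p ∈ primesUpTo q, ¬ p ∣ c := by
  constructor
  · intro h p hp hd
    have h1 := mem_primesUpTo.1 hp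
    have := mem_roughPrimes.1 (h (Nat.mem_primeFactors.2 ⟨h1.1, hd, hc⟩))
    omega
  · intro h p hp
    obtain ⟨h1, h2, -⟩ := Nat.mem_primeFactors.1 hp
    refine mem_roughPrimes.2 ⟨h1, (Nat.le_of_dvd (Nat.pos_of_ne_zero hc) h2).trans hcN, ?_⟩
    by_contra h3
    exact h p (mem_primesUpTo.2 ⟨h1, by omega⟩) h2

lemma abs_smoothLSum_rough_le {q N : ℕ} (hN : 1 ≤ N) (R : ℕ) {x y : ℝ} (hx : 0 < x)
    (hy : y ≤ N) :
    |smoothLSum (roughPrimes q N) N x y| ≤ 3 * (q + 1 : ℝ) ^ R / x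
      + (1 + Real.log N) * Real.exp (3 * primeRecip q - R) := by
  set P := primesUpTo q with hP
  set I := Ioc ⌊x⌋₊ ⌊y⌋₊ with hI
  have hyN : ⌊y⌋₊ ≤ N := Nat.floor_le_of_le hy
  have hLN : 0 ≤ Real.log N := Real.log_natCast_nonneg N
  have h1 : smoothLSum (roughPrimes q N) N x y
      = ∑ n ∈ I with ∀ p ∈ P, ¬ p ∣ n, chi4 n / n := by
    rw [smoothLSum]
    refine Finset.sum_congr ?_ fun _ _ => rfl
    ext c
    simp only [hI, mem_filter, mem_Icc, mem_Ioc, Nat.floor_lt hx.le]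
    constructor
    · rintro ⟨⟨h1, h2⟩, h3, h4, h5⟩
      exact ⟨⟨h4, Nat.le_floor h5⟩,
        (primeFactors_subset_roughPrimes_iff (by omega) h2).1 h3⟩
    · rintro ⟨⟨h4, h5⟩, h3⟩
      have h0 : 1 ≤ c := by
        have : (0 : ℝ) < c := hx.trans h4
        exact_mod_cast this
      refine ⟨⟨h0, h5.trans hyN⟩,
        (primeFactors_subset_roughPrimes_iff (by omega) (h5.trans hyN)).2 h3, h4, ?_⟩
      exact (Nat.le_floor_iff' (by omega)).1 h5
  have hdvd : ∀ S ∈ P.powerset, ∀ n, (∀ p ∈ S, p ∣ n) ↔ (∏ p ∈ S, p) ∣ n := by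
    intro S hS n
    constructor
    · intro h
      exact Finset.prod_primes_dvd n (fun p hp =>
        (prime_of_mem (mem_powerset.1 hS hp)).prime) h
    · intro h p hp
      exact (Finset.dvd_prod_of_mem _ hp).trans h
  have hpos : ∀ S ∈ P.powerset, 0 < ∏ p ∈ S, p := fun S hS =>
    Finset.prod_pos fun p hp => (prime_of_mem (mem_powerset.1 hS hp)).pos
  have h2 := abs_sum_sieve_sub_le (fun p n => p ∣ n) I P (fun n => chi4 n / n) R
  rw [← h1] at h2
  have h3 : |∑ S ∈ P.powerset with S.card ≤ R, (-1 : ℝ) ^ S.card *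
      ∑ n ∈ I with ∀ p ∈ S, p ∣ n, chi4 n / n| ≤ 3 * (q + 1 : ℝ) ^ R / x := by
    have h4 : ∀ S ∈ P.powerset.filter (fun S => S.card ≤ R), |(-1 : ℝ) ^ S.card *
        ∑ n ∈ I with ∀ p ∈ S, p ∣ n, chi4 n / n| ≤ (∏ p ∈ S, (1 : ℝ)) * (1 / x) := by
      intro S hS
      have hS' := (mem_filter.1 hS).1
      rw [abs_mul, abs_pow, abs_neg, abs_one, one_pow, Finset.prod_const_one]
      refine mul_le_mul_of_nonneg_left ?_ zero_le_one
      simp only [hdvd S hS']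
      refine (abs_sum_Ioc_chi4_div_dvd_le (hpos S hS') _ _).trans ?_
      exact one_div_le_one_div_of_le hx (Nat.lt_floor_add_one x).le
    refine (Finset.abs_sum_le_sum_abs _ _).trans ((Finset.sum_le_sum h4).trans ?_)
    rw [← Finset.sum_mul]
    have h5 := sum_powerset_prod_small_le P (fun _ => (1 : ℝ)) (fun _ _ => zero_le_one)
      (T := (q : ℝ) + 1) (by linarith [Nat.cast_nonneg (α := ℝ) q]) R
    have h6 : Real.exp ((∑ p ∈ P, (1 : ℝ)) / (q + 1)) ≤ 3 := by
      have : (∑ p ∈ P, (1 : ℝ)) / (q + 1) ≤ 1 := by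
        rw [div_le_one (by positivity), Finset.sum_const, nsmul_one]
        have : P.card ≤ q := by
          have : P ⊆ Icc 1 q := fun p hp => by
            have := mem_primesUpTo.1 hp
            exact mem_Icc.2 ⟨this.1.pos, this.2⟩
          simpa using Finset.card_le_card this
        have : (P.card : ℝ) ≤ q := by exact_mod_cast this
        linarith
      exact (Real.exp_le_exp.2 this).trans exp_one_lt_three.le
    rw [mul_one_div]
    apply div_le_div_of_nonneg_right _ hx.le
    refine h5.trans ?_
    rw [mul_comm]
    exact mul_le_mul_of_nonneg_right h6 (by positivity)
  have h7 : ∑ S ∈ P.powersetCard (R + 1), ∑ n ∈ I with ∀ p ∈ S, p ∣ n, |chi4 n / n|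
      ≤ (1 + Real.log N) * Real.exp (3 * primeRecip q - R) := by
    have h8 : ∀ S ∈ P.powersetCard (R + 1), ∑ n ∈ I with ∀ p ∈ S, p ∣ n, |chi4 n / n|
        ≤ (∏ p ∈ S, 1 / (p : ℝ)) * (1 + Real.log N) := by
      intro S hS
      have hS' : S ∈ P.powerset := mem_powerset.2 (mem_powersetCard.1 hS).1
      simp only [hdvd S hS']
      refine (sum_Ioc_abs_chi4_div_dvd_le (hpos S hS') hN _ hyN).trans (le_of_eq ?_)
      rw [Finset.prod_div_distrib]
      simp
    refine (Finset.sum_le_sum h8).trans ?_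
    rw [← Finset.sum_mul, mul_comm]
    refine mul_le_mul_of_nonneg_left ?_ (by linarith)
    have h9 := sum_powerset_prod_tail_le P (fun p => 1 / (p : ℝ)) (fun p _ => by positivity) R
    have h10 : ∑ S ∈ P.powersetCard (R + 1), ∏ p ∈ S, 1 / (p : ℝ)
        ≤ ∑ S ∈ P.powerset with R ≤ S.card, ∏ p ∈ S, 1 / (p : ℝ) := by
      refine Finset.sum_le_sum_of_subset_of_nonneg (fun S hS => ?_) fun S _ _ =>
        Finset.prod_nonneg fun p _ => by positivity
      rw [mem_powersetCard] at hS
      rw [mem_filter, mem_powerset]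
      exact ⟨hS.1, by omega⟩
    refine h10.trans (h9.trans (Real.exp_le_exp.2 ?_))
    have h11 : Real.exp 1 * primeRecip q ≤ 3 * primeRecip q :=
      mul_le_mul_of_nonneg_right exp_one_lt_three.le (primeRecip_nonneg q)
    have h12 : ∑ p ∈ P, 1 / (p : ℝ) = primeRecip q := rfl
    rw [h12]
    linarith
  have h13 := abs_le.1 h3
  have h14 := abs_le.1 (h2.trans h7)
  rw [abs_le]
  constructor <;> linarith [h13.1, h13.2, h14.1, h14.2]

lemma sum_Ioc_inv_le {a b : ℕ} (h : a < b) :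
    ∑ n ∈ Ioc a b, (1 : ℝ) / n ≤ 1 + Real.log ((b : ℝ) / (a + 1)) := by
  induction b, h using Nat.le_induction with
  | base =>
    have : (Ioc a (a + 1)) = {a + 1} := by ext; simp
    have h2 : (1 : ℝ) / ((a + 1 : ℕ) : ℝ) ≤ 1 := by
      rw [div_le_one (by positivity)]; push_cast; linarith [Nat.cast_nonneg (α := ℝ) a]
    have h3 : (((a + 1 : ℕ) : ℝ)) / (a + 1) = 1 := by
      push_cast; exact div_self (by positivity)
    rw [Nat.succ_eq_add_one, this, Finset.sum_singleton, h3, Real.log_one]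
    linarith
  | succ b hb ih =>
    have hb1 : a + 1 ≤ b := hb
    have hb0 : (0 : ℝ) < b := by exact_mod_cast (by omega : 0 < b)
    rw [Finset.sum_Ioc_succ_top (by omega)]
    have h1 : (1 : ℝ) / ((b + 1 : ℕ) : ℝ) ≤ Real.log (((b + 1 : ℕ) : ℝ) / b) := by
      have := Real.one_sub_inv_le_log_of_pos (x := ((b + 1 : ℕ) : ℝ) / b) (by positivity)
      refine le_trans (le_of_eq ?_) this
      push_cast
      field_simp
      ring
    have h2 : Real.log (((b + 1 : ℕ) : ℝ) / (a + 1))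
        = Real.log ((b : ℝ) / (a + 1)) + Real.log (((b + 1 : ℕ) : ℝ) / b) := by
      rw [← Real.log_mul (by positivity) (by positivity)]
      congr 1
      field_simp
    rw [h2]
    linarith

lemma sum_inv_window_le (N : ℕ) {u v : ℝ} (hu : 0 < u) (huv : u ≤ v) :
    ∑ n ∈ (Icc 1 N).filter (fun n : ℕ => u < (n : ℝ) ∧ (n : ℝ) ≤ v), (1 : ℝ) / n
      ≤ 1 + Real.log (v / u) := by
  have h0 : 0 ≤ Real.log (v / u) := Real.log_nonneg ((one_le_div hu).2 huv)
  have h1 : ∑ n ∈ (Icc 1 N).filter (fun n : ℕ => u < (n : ℝ) ∧ (n : ℝ) ≤ v), (1 : ℝ) / n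
      ≤ ∑ n ∈ Ioc ⌊u⌋₊ ⌊v⌋₊, (1 : ℝ) / n := by
    refine Finset.sum_le_sum_of_subset_of_nonneg (fun n hn => ?_) fun _ _ _ => by positivity
    simp only [mem_filter] at hn
    rw [mem_Ioc, Nat.floor_lt hu.le]
    exact ⟨hn.2.1, Nat.le_floor hn.2.2⟩
  refine h1.trans ?_
  rcases le_or_gt ⌊v⌋₊ ⌊u⌋₊ with h2 | h2
  · rw [Finset.Ioc_eq_empty (by omega), Finset.sum_empty]
    linarith
  · refine (sum_Ioc_inv_le h2).trans ?_
    have h3 : (⌊v⌋₊ : ℝ) ≤ v := Nat.floor_le (hu.le.trans huv)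
    have h4 : u < ⌊u⌋₊ + 1 := Nat.lt_floor_add_one u
    have h5 : (0 : ℝ) < ⌊v⌋₊ := by exact_mod_cast (by omega : 0 < ⌊v⌋₊)
    have h6 : Real.log ((⌊v⌋₊ : ℝ) / (⌊u⌋₊ + 1)) ≤ Real.log (v / u) := by
      apply Real.log_le_log (by positivity)
      exact div_le_div₀ (hu.le.trans huv) h3 hu h4.le
    linarith

lemma log_succ_le_exp_primeRecip {q : ℕ} (hq : 1 ≤ q) :
    Real.log (q + 1) ≤ 18 * Real.exp (primeRecip q) := by
  have h0 := Real.one_le_exp (primeRecip_nonneg q)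
  rcases Nat.lt_or_ge q 2 with h | h
  · have : q = 1 := by omega
    subst this
    have h1 := Real.log_le_sub_one_of_pos (x := (1 : ℕ) + 1) (by norm_num)
    norm_num at h1 ⊢
    linarith
  · have h1 : (2 : ℝ) ≤ q := by exact_mod_cast h
    have h2 : Real.log (q + 1) ≤ 2 * Real.log q := by
      have : Real.log ((q : ℝ) ^ 2) = 2 * Real.log q := by rw [Real.log_pow]; norm_num
      rw [← this]
      exact Real.log_le_log (by positivity) (by nlinarith)
    linarith [log_le_exp_primeRecip q]

lemma log_two_le_log_succ {q : ℕ} (hq : 1 ≤ q) : (2 / 3 : ℝ) ≤ Real.log (q + 1) := by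
  have h1 : (1 : ℝ) ≤ q := by exact_mod_cast hq
  have : Real.log 2 ≤ Real.log (q + 1) := Real.log_le_log (by norm_num) (by linarith)
  linarith [Real.log_two_gt_d9]

lemma sum_roughPrimes_eq {q N : ℕ} (h : q ≤ N) :
    ∑ p ∈ roughPrimes q N, (1 : ℝ) / p = primeRecip N - primeRecip q := by
  rw [eq_sub_iff_add_eq, primeRecip, primeRecip]
  have : primesUpTo q = {p ∈ primesUpTo N | ¬ q < p} := by
    ext p
    simp only [mem_filter, mem_primesUpTo, not_lt]
    exact ⟨fun hp => ⟨⟨hp.1, hp.2.trans h⟩, hp.2⟩, fun hp => ⟨hp.1.1, hp.2⟩⟩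
  rw [this, roughPrimes]
  exact Finset.sum_filter_add_sum_filter_not _ _ _

namespace Scale

variable {c : ℝ} {N R : ℕ}

lemma exp_roughPrimes_le (h : Scale c N R) {q M : ℕ} (hq : 1 ≤ q) (hM : 3 ≤ M) (hMN : M ≤ N) :
    Real.exp (∑ p ∈ roughPrimes q M, (1 : ℝ) / p + 2)
      ≤ R ^ 2 * (1 + Real.log M / Real.log (q + 1)) := by
  have hR := h.hR'
  have hq1 := log_two_le_log_succ hq
  have hlM := one_le_log_of_three_le hM
  have he : Real.exp 2 ≤ 9 := by
    have : Real.exp 2 = Real.exp 1 * Real.exp 1 := by rw [← Real.exp_add]; norm_num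
    nlinarith [exp_one_lt_three, Real.exp_pos 1]
  rcases le_or_gt q M with hqM | hqM
  · rw [sum_roughPrimes_eq hqM, Real.exp_add, Real.exp_sub]
    have h1 := h.exp_primeRecip hM hMN
    have h2 := log_succ_le_exp_primeRecip hq
    have h3 : Real.exp (primeRecip M) / Real.exp (primeRecip q)
        ≤ 18 * R * (Real.log M / Real.log (q + 1)) := by
      rw [div_le_iff₀ (Real.exp_pos _)]
      calc Real.exp (primeRecip M) ≤ R * Real.log M := h1
        _ = R * (Real.log M / Real.log (q + 1)) * Real.log (q + 1) := by field_simp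
        _ ≤ R * (Real.log M / Real.log (q + 1)) * (18 * Real.exp (primeRecip q)) :=
            mul_le_mul_of_nonneg_left h2 (by positivity)
        _ = _ := by ring
    have h4 : 0 ≤ Real.log M / Real.log (q + 1) := by positivity
    calc Real.exp (primeRecip M) / Real.exp (primeRecip q) * Real.exp 2
        ≤ (18 * R * (Real.log M / Real.log (q + 1))) * 9 :=
          mul_le_mul h3 he (Real.exp_pos _).le (by positivity)
      _ ≤ _ := by
        have h5 : 162 * (R : ℝ) ≤ R ^ 2 := by nlinarith
        nlinarith [mul_le_mul_of_nonneg_right h5 h4, sq_nonneg (R : ℝ)]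
  · have : roughPrimes q M = ∅ := by
      refine Finset.eq_empty_of_forall_notMem fun p hp => ?_
      have := mem_roughPrimes.1 hp
      omega
    rw [this, Finset.sum_empty, zero_add]
    have h4 : 0 ≤ Real.log M / Real.log (q + 1) := by positivity
    nlinarith

lemma exp_roughPrimes_le' (h : Scale c N R) {q : ℕ} (hq : 1 ≤ q) (hqN : q ≤ N) :
    Real.exp (∑ p ∈ roughPrimes q N, (1 : ℝ) / p + 2)
      ≤ R ^ 3 * (Real.log N / Real.log (q + 1)) := by
  refine (h.exp_roughPrimes_le hq h.three_le le_rfl).trans ?_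
  have hR := h.hR'
  have hq1 := log_two_le_log_succ hq
  have h1 : Real.log (q + 1) ≤ 2 * Real.log N := by
    have h2 : (3 : ℝ) ≤ N := by exact_mod_cast h.three_le
    have h3 : (q : ℝ) ≤ N := by exact_mod_cast hqN
    have : Real.log ((N : ℝ) ^ 2) = 2 * Real.log N := by rw [Real.log_pow]; norm_num
    rw [← this]
    exact Real.log_le_log (by positivity) (by nlinarith)
  have h2 : 1 ≤ 2 * (Real.log N / Real.log (q + 1)) := by
    rw [← mul_div_assoc, le_div_iff₀ (by linarith), one_mul]
    exact h1
  have h3 : 0 ≤ (R : ℝ) ^ 2 := by positivity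
  calc (R : ℝ) ^ 2 * (1 + Real.log N / Real.log (q + 1))
      ≤ R ^ 2 * (R * (Real.log N / Real.log (q + 1))) :=
        mul_le_mul_of_nonneg_left (by nlinarith) h3
    _ = _ := by ring

lemma brun_error_le (h : Scale c N R) {q : ℕ} (hq : 1 ≤ q) (hqN : q ≤ N) {x : ℝ}
    (hx : (q + 1 : ℝ) ^ (2 * R) ≤ x) :
    3 * (q + 1 : ℝ) ^ R / x + (1 + Real.log N) * Real.exp (3 * primeRecip q - R)
      ≤ 1 / Real.log N := by
  have hL := h.log_ge
  have hll := h.loglog_nonneg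
  have hR := h.hll
  have hq1 : (1 : ℝ) ≤ q := by exact_mod_cast hq
  have key : ∀ t : ℝ, t ≤ - 3 * (1 + Real.log (Real.log N)) →
      Real.exp t ≤ 1 / (16 * Real.log N ^ 2) := by
    intro t ht
    have h1 : Real.exp t ≤ Real.exp (-3) * (Real.exp (-Real.log (Real.log N))) ^ 3 := by
      rw [← Real.exp_nat_mul, ← Real.exp_add]
      apply Real.exp_le_exp.2
      push_cast
      linarith
    rw [Real.exp_neg (Real.log (Real.log N)), ← h.log_eq] at h1
    have h2 : Real.exp (-3) ≤ 1 := Real.exp_le_one_iff.2 (by norm_num)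
    refine h1.trans ?_
    rw [inv_pow, ← div_eq_mul_inv, div_le_div_iff₀ (by positivity) (by positivity)]
    have h3 : 0 < Real.log N ^ 2 := by positivity
    have h4 : 16 * Real.log N ^ 2 ≤ Real.log N ^ 3 := by nlinarith
    nlinarith [Real.exp_pos (-3)]
  have h1 : 3 * (q + 1 : ℝ) ^ R / x ≤ 3 / (16 * Real.log N ^ 2) := by
    have h2 : 3 * (q + 1 : ℝ) ^ R / x ≤ 3 * (q + 1 : ℝ) ^ R / (q + 1 : ℝ) ^ (2 * R) :=
      div_le_div_of_nonneg_left (by positivity) (by positivity) hx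
    have h3 : 3 * (q + 1 : ℝ) ^ R / (q + 1 : ℝ) ^ (2 * R) = 3 * (1 / (q + 1 : ℝ) ^ R) := by
      rw [two_mul, pow_add]; field_simp
    have h4 : Real.exp (R * (1 / 2)) ≤ (q + 1 : ℝ) ^ R := by
      rw [Real.exp_nat_mul]
      refine pow_le_pow_left₀ (Real.exp_pos _).le ?_ _
      have h5 : Real.exp (1 / 2) * Real.exp (1 / 2) = Real.exp 1 := by
        rw [← Real.exp_add]; norm_num
      nlinarith [exp_one_lt_three, Real.exp_pos (1 / 2)]
    have h5 : 1 / (q + 1 : ℝ) ^ R ≤ Real.exp (-(R * (1 / 2))) := by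
      rw [Real.exp_neg, ← one_div]
      exact one_div_le_one_div_of_le (Real.exp_pos _) h4
    have h6 := key (-(R * (1 / 2))) (by linarith)
    rw [h3] at h2
    refine h2.trans ?_
    rw [← mul_one_div 3 (16 * Real.log N ^ 2)]
    linarith
  have h2 : (1 + Real.log N) * Real.exp (3 * primeRecip q - R)
      ≤ (1 + Real.log N) * (1 / (16 * Real.log N ^ 2)) := by
    refine mul_le_mul_of_nonneg_left (key _ ?_) (by linarith)
    have := h.primeRecip_le hqN
    linarith
  refine (add_le_add h1 h2).trans ?_
  rw [mul_one_div, ← add_div, div_le_div_iff₀ (by positivity) (by positivity)]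
  nlinarith

lemma abs_smoothLSum_le_inv (h : Scale c N R) {q : ℕ} (hq : 1 ≤ q) (hqN : q ≤ N) {x y : ℝ}
    (hx : (q + 1 : ℝ) ^ (2 * R) ≤ x) (hy : y ≤ N) :
    |smoothLSum (roughPrimes q N) N x y| ≤ 1 / Real.log N :=
  (abs_smoothLSum_rough_le (by have := h.three_le; omega) R (lt_of_lt_of_le (by positivity) hx) hy).trans
    (h.brun_error_le hq hqN hx)

lemma abs_smoothLSum_le (h : Scale c N R) {q : ℕ} (hq : 1 ≤ q) (hqN : q ≤ N) (x : ℝ) {y : ℝ}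
    (hy : y ≤ N) : |smoothLSum (roughPrimes q N) N x y| ≤ R ^ 4 := by
  have hR := h.hR'
  have hRn := h.hR
  have hl := log_two_le_log_succ hq
  have hL := h.log_ge
  set A := (q + 1) ^ (2 * R) with hA
  set M := min A N with hM
  have hM3 : 3 ≤ M := by
    refine le_min ?_ h.three_le
    calc 3 ≤ 2 ^ 2 := by norm_num
      _ ≤ (q + 1) ^ 2 := Nat.pow_le_pow_left (by omega) 2
      _ ≤ A := Nat.pow_le_pow_right (by omega) (by omega)
  have h1 : smoothLSum (roughPrimes q N) N x y
      = ∑ n ∈ ((Icc 1 N).filter fun n : ℕ => n.primeFactors ⊆ roughPrimes q N ∧ x < (n : ℝ) ∧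
          (n : ℝ) ≤ y) with n ≤ A, chi4 n / n
        + smoothLSum (roughPrimes q N) N (max x A) y := by
    rw [smoothLSum, ← Finset.sum_filter_add_sum_filter_not _ (fun n => n ≤ A)]
    congr 1
    rw [smoothLSum, Finset.filter_filter]
    refine Finset.sum_congr (Finset.filter_congr fun n _ => ?_) fun _ _ => rfl
    rw [max_lt_iff, Nat.cast_lt, not_le]
    tauto
  have h2 : |smoothLSum (roughPrimes q N) N (max x A) y| ≤ 1 / Real.log N := by
    apply h.abs_smoothLSum_le_inv hq hqN _ hy
    rw [hA]; push_cast
    exact le_max_right _ _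
  have h3 : 1 / Real.log N ≤ 1 := by rw [div_le_one (by linarith)]; linarith
  have h4 : |∑ n ∈ ((Icc 1 N).filter fun n : ℕ => n.primeFactors ⊆ roughPrimes q N ∧ x < (n : ℝ) ∧
          (n : ℝ) ≤ y) with n ≤ A, chi4 n / n| ≤ R ^ 2 * (1 + Real.log M / Real.log (q + 1)) := by
    refine (Finset.abs_sum_le_sum_abs _ _).trans ?_
    refine (Finset.sum_le_sum (g := fun n : ℕ => (1 : ℝ) / n) fun n _ => ?_).trans
      ((sum_inv_smooth_le (s := roughPrimes q M) (fun p hp => prime_of_mem_roughPrimes hp) _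
        fun n hn => ?_).trans (h.exp_roughPrimes_le hq hM3 (min_le_right _ _)))
    · rw [abs_div, Nat.abs_cast]
      exact div_le_div_of_nonneg_right (abs_chi4_le n) (by positivity)
    · simp only [mem_filter, mem_Icc] at hn
      refine ⟨by omega, fun p hp => ?_⟩
      have h5 := mem_roughPrimes.1 (hn.1.2.1 hp)
      have h6 : p ≤ n := Nat.le_of_dvd (by omega) (Nat.dvd_of_mem_primeFactors hp)
      exact mem_roughPrimes.2 ⟨h5.1, le_min (h6.trans hn.2) h5.2.1, h5.2.2⟩
  have h5 : Real.log M / Real.log (q + 1) ≤ 2 * R := by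
    rw [div_le_iff₀ (by linarith)]
    have h6 : Real.log M ≤ Real.log A := Real.log_le_log
      (by exact_mod_cast (by omega : 0 < M)) (by exact_mod_cast min_le_left _ _)
    refine h6.trans (le_of_eq ?_)
    rw [hA]; push_cast
    rw [Real.log_pow]; push_cast; ring
  have h6 : (R : ℝ) ^ 2 * (1 + Real.log M / Real.log (q + 1)) ≤ R ^ 2 * (1 + 2 * R) :=
    mul_le_mul_of_nonneg_left (by linarith) (by positivity)
  have h7 : (R : ℝ) ^ 2 * (1 + 2 * R) + 1 ≤ R ^ 4 := by
    have h8 : (2 : ℝ) + 2 * R ≤ R ^ 2 := by nlinarith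
    nlinarith [mul_le_mul_of_nonneg_left h8 (sq_nonneg (R : ℝ))]
  rw [h1]
  exact (abs_add_le _ _).trans (by linarith)

lemma window_moment_le (h : Scale c N R) {q : ℕ} (hq : 1 ≤ q) (hqN : q ≤ N) {y H : ℝ}
    (hy0 : 0 < y) (hy : y ≤ N) (hH : 1 ≤ H) (S : Finset ℕ)
    (hS : ∀ a ∈ S, a ≠ 0 ∧ a.primeFactors ⊆ roughPrimes q N) :
    ∑ n ∈ Icc 1 N, (1 : ℝ) / n * ∑ a ∈ S, (1 : ℝ) / a * windowSum a n (y / H) y ^ 2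
      ≤ R ^ 16 * (Real.log N / Real.log (q + 1)) ^ 2 * (Real.log H + Real.log (q + 1)) := by
  have hR := h.hR'
  have hl := log_two_le_log_succ hq
  have hL := h.log_ge
  have hH0 := Real.log_nonneg hH
  set s := roughPrimes q N with hs
  have hsp : ∀ p ∈ s, p.Prime := fun p hp => prime_of_mem_roughPrimes hp
  set Z := (R : ℝ) ^ 3 * (Real.log N / Real.log (q + 1)) with hZ
  have hZ0 : 0 ≤ Z := by positivity
  set A : ℝ := (q + 1 : ℝ) ^ (2 * R) with hA
  have hA1 : 1 ≤ A := one_le_pow₀ (by linarith [Nat.cast_nonneg (α := ℝ) q])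
  set E := {e ∈ Icc 1 N | e.primeFactors ⊆ s} with hE
  have hEmem : ∀ e ∈ E, (1 : ℝ) ≤ e := fun e he => by
    have := (mem_Icc.1 (mem_filter.1 he).1).1
    exact_mod_cast this
  have h1 : ∑ a ∈ E, (1 : ℝ) / a ≤ Z :=
    (sum_inv_smooth_le hsp E fun a ha => by
      have := mem_filter.1 ha
      exact ⟨by have := mem_Icc.1 this.1; omega, this.2⟩).trans (h.exp_roughPrimes_le' hq hqN)
  have h2 : ∑' a, smoothWeight s a ≤ Z :=
    (tsum_smoothWeight_le hsp).trans (h.exp_roughPrimes_le' hq hqN)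
  have hB : ∀ n ∈ Icc 1 N, ∀ e ∈ E, smoothLSum s N (y / H / (e * n)) (y / (e * n)) ^ 2
      ≤ (1 / Real.log N) ^ 2 + if y / e / (H * A) < n ∧ (n : ℝ) ≤ y / e then (R : ℝ) ^ 8 else 0 := by
    intro n hn e he
    have he1 := hEmem e he
    have hn1 : (1 : ℝ) ≤ n := by exact_mod_cast (mem_Icc.1 hn).1
    have hpos : (0 : ℝ) < (1 / Real.log N) ^ 2 := by positivity
    have hyen : y / (e * n) ≤ N := by
      refine (div_le_self hy0.le ?_).trans hy
      nlinarith
    by_cases h3 : (n : ℝ) ≤ y / e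
    · by_cases h4 : y / e / (H * A) < n
      · rw [if_pos ⟨h4, h3⟩]
        have h5 := h.abs_smoothLSum_le hq hqN (y / H / (e * n)) hyen
        have h6 : smoothLSum s N (y / H / (e * n)) (y / (e * n)) ^ 2 ≤ ((R : ℝ) ^ 4) ^ 2 :=
          sq_le_sq' (abs_le.1 h5).1 (abs_le.1 h5).2
        have h7 : ((R : ℝ) ^ 4) ^ 2 = R ^ 8 := by ring
        linarith
      · rw [if_neg (fun h => h4 h.1), add_zero]
        rw [not_lt, div_div, le_div_iff₀ (by positivity)] at h4
        have h5 := h.abs_smoothLSum_le_inv hq hqN (x := y / H / (e * n)) (by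
          rw [div_div, le_div_iff₀ (by positivity)]
          linarith) hyen
        exact sq_le_sq' (abs_le.1 h5).1 (abs_le.1 h5).2
    · rw [if_neg (fun h => h3 h.2), add_zero]
      have h5 : smoothLSum s N (y / H / (e * n)) (y / (e * n)) = 0 := by
        refine Finset.sum_eq_zero fun d hd => ?_
        exfalso
        simp only [mem_filter, mem_Icc] at hd
        have h6 : (1 : ℝ) ≤ d := by exact_mod_cast hd.1.1
        have h7 := h6.trans hd.2.2.2
        rw [one_le_div (by positivity)] at h7
        apply h3
        rw [le_div_iff₀ (by positivity)]
        linarith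
      rw [h5, sq, zero_mul]
      exact hpos.le
  have h3 : ∀ e ∈ E, ∑ n ∈ Icc 1 N, (1 : ℝ) / n *
      smoothLSum s N (y / H / (e * n)) (y / (e * n)) ^ 2
        ≤ R ^ 10 * (Real.log H + Real.log (q + 1)) := by
    intro e he
    have he1 := hEmem e he
    have h4 : ∑ n ∈ Icc 1 N, (1 : ℝ) / n *
      smoothLSum s N (y / H / (e * n)) (y / (e * n)) ^ 2
        ≤ (1 / Real.log N) ^ 2 * (1 + Real.log N) + R ^ 8 * (1 + Real.log (H * A)) := by
      calc _ ≤ ∑ n ∈ Icc 1 N, (1 : ℝ) / n * ((1 / Real.log N) ^ 2 +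
              if y / e / (H * A) < n ∧ (n : ℝ) ≤ y / e then (R : ℝ) ^ 8 else 0) :=
            Finset.sum_le_sum fun n hn => mul_le_mul_of_nonneg_left (hB n hn e he) (by positivity)
        _ = (1 / Real.log N) ^ 2 * ∑ n ∈ Icc 1 N, (1 : ℝ) / n + R ^ 8 *
            ∑ n ∈ (Icc 1 N).filter (fun n : ℕ => y / e / (H * A) < (n : ℝ) ∧ (n : ℝ) ≤ y / e),
              (1 : ℝ) / n := by
            rw [Finset.sum_filter, Finset.mul_sum, Finset.mul_sum, ← Finset.sum_add_distrib]
            refine Finset.sum_congr rfl fun n _ => ?_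
            split_ifs <;> ring
        _ ≤ _ := by
            have h5 := sum_inv_le_one_add_log (X := N) (by have := h.three_le; omega)
            have hye : 0 < y / e := by positivity
            have h6 := sum_inv_window_le N (u := y / e / (H * A)) (v := y / e) (by positivity)
              (div_le_self hye.le (by nlinarith))
            have h7 : y / e / (y / e / (H * A)) = H * A := by field_simp
            rw [h7] at h6
            exact add_le_add (mul_le_mul_of_nonneg_left h5 (by positivity))
              (mul_le_mul_of_nonneg_left h6 (by positivity))
    have h5 : (1 / Real.log N) ^ 2 * (1 + Real.log N) ≤ 1 := by
      rw [one_div, inv_pow, inv_mul_le_iff₀ (by positivity)]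
      nlinarith
    have h6 : Real.log (H * A) = Real.log H + 2 * R * Real.log (q + 1) := by
      rw [Real.log_mul (by linarith) (by positivity), hA, Real.log_pow]
      push_cast; ring
    rw [h6] at h4
    have h7 : (1 : ℝ) ≤ R ^ 8 := one_le_pow₀ (by linarith)
    have h8 : 2 + Real.log H + 2 * R * Real.log (q + 1)
        ≤ R ^ 2 * (Real.log H + Real.log (q + 1)) := by
      have h9 : 3 + 2 * (R : ℝ) ≤ R ^ 2 := by nlinarith
      have h10 := mul_le_mul_of_nonneg_right h9 (by linarith : 0 ≤ Real.log (q + 1))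
      nlinarith
    have h9 : (R : ℝ) ^ 10 * (Real.log H + Real.log (q + 1))
        = R ^ 8 * (R ^ 2 * (Real.log H + Real.log (q + 1))) := by ring
    rw [h9]
    have h10 := mul_le_mul_of_nonneg_left h8 (by linarith : (0 : ℝ) ≤ R ^ 8)
    linarith
  have hT0 : 0 ≤ (R : ℝ) ^ 10 * (Real.log H + Real.log (q + 1)) := by positivity
  calc ∑ n ∈ Icc 1 N, (1 : ℝ) / n * ∑ a ∈ S, (1 : ℝ) / a * windowSum a n (y / H) y ^ 2
      ≤ ∑ n ∈ Icc 1 N, (1 : ℝ) / n * (Z * ∑ e ∈ E, (1 : ℝ) / e *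
          smoothLSum s N (y / H / (e * n)) (y / (e * n)) ^ 2) := by
        refine Finset.sum_le_sum fun n hn => mul_le_mul_of_nonneg_left ?_ (by positivity)
        refine (sum_windowSum_sq_le hsp (mem_Icc.1 hn).1 hy S hS).trans ?_
        exact mul_le_mul_of_nonneg_right h2 (Finset.sum_nonneg fun e _ => by positivity)
    _ = Z * ∑ e ∈ E, (1 : ℝ) / e * ∑ n ∈ Icc 1 N, (1 : ℝ) / n *
          smoothLSum s N (y / H / (e * n)) (y / (e * n)) ^ 2 := by
        simp_rw [Finset.mul_sum]
        rw [Finset.sum_comm]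
        refine Finset.sum_congr rfl fun e _ => Finset.sum_congr rfl fun n _ => by ring
    _ ≤ Z * ∑ e ∈ E, (1 : ℝ) / e * (R ^ 10 * (Real.log H + Real.log (q + 1))) := by
        refine mul_le_mul_of_nonneg_left (Finset.sum_le_sum fun e he => ?_) hZ0
        exact mul_le_mul_of_nonneg_left (h3 e he) (by positivity)
    _ ≤ Z * (Z * (R ^ 10 * (Real.log H + Real.log (q + 1)))) := by
        rw [← Finset.sum_mul]
        exact mul_le_mul_of_nonneg_left (mul_le_mul_of_nonneg_right h1 hT0) hZ0
    _ = _ := by rw [hZ]; ring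

end Scale

lemma abs_windowSum_le (a n : ℕ) (x y : ℝ) : |windowSum a n x y| ≤ #a.divisors := by
  refine (Finset.abs_sum_le_sum_abs _ _).trans ?_
  rw [Finset.card_eq_sum_ones, Nat.cast_sum]
  refine Finset.sum_le_sum fun d _ => ?_
  split_ifs
  · simpa using abs_chi4_le d
  · simp

lemma windowSum_mul_of_coprime {u v : ℕ} (h : u.Coprime v) (n : ℕ) (x y : ℝ) :
    windowSum (u * v) n x y = ∑ d ∈ u.divisors, chi4 d * windowSum v (d * n) x y := by
  unfold windowSum
  rw [sum_divisors_mul_of_coprime h]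
  refine Finset.sum_congr rfl fun d _ => ?_
  rw [Finset.mul_sum]
  refine Finset.sum_congr rfl fun e _ => ?_
  rw [chi4_mul]
  have : (((d * e : ℕ) : ℝ) * n) = (e * (d * n : ℕ) : ℝ) := by push_cast; ring
  rw [this, mul_ite, mul_zero]

lemma windowSum_mul_left {d : ℕ} (hd : 0 < d) (a n : ℕ) (x y : ℝ) :
    windowSum a (d * n) x y = windowSum a n (x / d) (y / d) := by
  have hd' : (0 : ℝ) < d := by exact_mod_cast hd
  unfold windowSum
  refine Finset.sum_congr rfl fun e _ => ?_
  simp only [div_lt_iff₀ hd', le_div_iff₀ hd', Nat.cast_mul]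
  rw [show (e : ℝ) * (d * n) = e * n * d by ring]

lemma windowSum_zero_sub {a n : ℕ} (hn : 0 < n) {x y : ℝ} (hxy : x ≤ y) :
    windowSum a n 0 y - windowSum a n 0 x = windowSum a n x y := by
  unfold windowSum
  rw [← Finset.sum_sub_distrib]
  refine Finset.sum_congr rfl fun d hd => ?_
  have hd0 : 0 < d := Nat.pos_of_mem_divisors hd
  have h1 : (0 : ℝ) < d * n := by exact_mod_cast Nat.mul_pos hd0 hn
  by_cases h2 : (d * n : ℝ) ≤ x
  · have h3 : ¬ x < (d * n : ℝ) := not_lt.2 h2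
    simp [h1, h2, h3, h2.trans hxy]
  · have h3 : x < (d * n : ℝ) := not_le.1 h2
    simp [h1, h2, h3]

lemma windowSum_prime_mul {q a n : ℕ} (hq : q.Prime) (hq4 : q % 4 = 3) (hqa : q.Coprime a)
    (hn : 0 < n) {y : ℝ} (hy : 0 ≤ y) :
    windowSum (q * a) n 0 y = windowSum a n (y / q) y := by
  have hq0 : (1 : ℝ) ≤ q := by exact_mod_cast hq.one_lt.le
  have hc : chi4 q = -1 := by simp [chi4, hq4]
  rw [windowSum_mul_of_coprime hqa, Nat.Prime.divisors hq, Finset.sum_pair hq.one_lt.ne, chi4_one,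
    hc, one_mul, one_mul, windowSum_mul_left hq.pos, zero_div, neg_one_mul, ← sub_eq_add_neg]
  exact windowSum_zero_sub hn (div_le_self hy hq0)

/-- The number of odd divisors. -/
def oddDivisorCount (n : ℕ) : ℝ := ∑ d ∈ n.divisors, |chi4 d|

lemma oddDivisorCount_nonneg (n : ℕ) : 0 ≤ oddDivisorCount n :=
  Finset.sum_nonneg fun _ _ => abs_nonneg _

lemma abs_windowSum_le_oddDivisorCount (a n : ℕ) (x y : ℝ) :
    |windowSum a n x y| ≤ oddDivisorCount a := by
  refine (Finset.abs_sum_le_sum_abs _ _).trans (Finset.sum_le_sum fun d _ => ?_)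
  split_ifs
  · exact le_rfl
  · simp

lemma oddDivisorCount_mul {m n : ℕ} (h : m.Coprime n) :
    oddDivisorCount (m * n) = oddDivisorCount m * oddDivisorCount n := by
  unfold oddDivisorCount
  rw [sum_divisors_mul_of_coprime h, Finset.sum_mul_sum]
  simp_rw [chi4_mul, abs_mul]

lemma oddDivisorCount_prime_pow_le {p : ℕ} (hp : p.Prime) (k : ℕ) :
    oddDivisorCount (p ^ k) ≤ k + 1 := by
  unfold oddDivisorCount
  rw [Nat.divisors_prime_pow hp, Finset.sum_map]
  calc _ ≤ ∑ i ∈ range (k + 1), (1 : ℝ) := Finset.sum_le_sum fun i _ => abs_chi4_le _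
    _ = _ := by simp

lemma sum_add_three_mul_pow_le {r : ℝ} (hr0 : 0 ≤ r) (hr : r ≤ 5 / 8) (K : ℕ) :
    ∑ k ∈ range K, (k + 3 : ℝ) * r ^ k ≤ 13 := by
  have h1 : ∑ k ∈ range K, (k + 3 : ℝ) * (5 / 8) ^ k ≤ 13 - (8 / 3 * K + 112 / 9) * (5 / 8) ^ K := by
    induction K with
    | zero => norm_num
    | succ K ih =>
      rw [Finset.sum_range_succ, pow_succ]
      push_cast
      have : (0 : ℝ) < (5 / 8) ^ K := by positivity
      nlinarith [mul_nonneg (Nat.cast_nonneg (α := ℝ) K) this.le]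
  calc ∑ k ∈ range K, (k + 3 : ℝ) * r ^ k ≤ ∑ k ∈ range K, (k + 3 : ℝ) * (5 / 8) ^ k :=
        Finset.sum_le_sum fun k _ => mul_le_mul_of_nonneg_left
          (pow_le_pow_left₀ hr0 hr k) (by positivity)
    _ ≤ _ := h1
    _ ≤ 13 := by
      have : (0 : ℝ) ≤ (8 / 3 * K + 112 / 9) * (5 / 8) ^ K := by positivity
      linarith

lemma sum_range_le_of_le_geom {u : ℕ → ℝ} {t r : ℝ} (ht : 0 ≤ t) (hr0 : 0 ≤ r) (hr : r ≤ 5 / 8)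
    (h0 : u 0 ≤ t) (h : ∀ k, u (k + 1) ≤ (k + 3) * r ^ (k + 2)) (K : ℕ) :
    ∑ k ∈ range K, u k ≤ t + 13 * r ^ 2 := by
  rcases K with _ | K
  · simp; positivity
  · rw [Finset.sum_range_succ']
    have h1 : ∑ k ∈ range K, u (k + 1) ≤ ∑ k ∈ range K, r ^ 2 * ((k + 3) * r ^ k) :=
      Finset.sum_le_sum fun k _ => (h k).trans (le_of_eq (by ring))
    rw [← Finset.mul_sum] at h1
    have h2 := mul_le_mul_of_nonneg_left (sum_add_three_mul_pow_le hr0 hr K) (sq_nonneg r)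
    linarith

lemma sum_le_exp_of_prime_pow_le {φ : ℕ → ℝ} (h0 : ∀ n, 0 ≤ φ n) (h1 : φ 1 ≤ 1)
    (hmul : ∀ m n, m.Coprime n → φ (m * n) ≤ φ m * φ n) (P : Finset ℕ) (hP : ∀ p ∈ P, p.Prime)
    (t : ℕ → ℝ) {r : ℝ} (hr0 : 0 ≤ r) (hr : r ≤ 5 / 4) (ht : ∀ p ∈ P, 0 ≤ t p)
    (hp : ∀ p ∈ P, φ p ≤ t p)
    (hpk : ∀ p ∈ P, ∀ k : ℕ, φ (p ^ (k + 2)) ≤ (k + 3) * (r / p) ^ (k + 2))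
    (S : Finset ℕ) (hS : ∀ a ∈ S, a ≠ 0 ∧ ∀ p, p.Prime → p ∣ a → p ∈ P) :
    ∑ a ∈ S, φ a ≤ Real.exp (∑ p ∈ P, t p + 21) := by
  have h2 : ∑ a ∈ S, φ a ≤ ∏ p ∈ P, (1 + (t p + 13 * (r / p) ^ 2)) :=
    sum_le_prod_one_add h0 h1 hmul P hP _ (fun p hpP K => by
      have hp2 : (2 : ℝ) ≤ p := by exact_mod_cast (hP p hpP).two_le
      refine sum_range_le_of_le_geom (u := fun k => φ (p ^ (k + 1))) (ht p hpP) (by positivity) ?_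
        (by simpa using hp p hpP) (fun k => hpk p hpP k) K
      rw [div_le_iff₀ (by linarith)]
      linarith) S hS
  have h3 := prod_one_add_le_exp_sum P (fun p => t p + 13 * (r / (p : ℝ)) ^ 2)
    (fun p hpP => add_nonneg (ht p hpP) (by positivity))
  refine h2.trans (h3.trans (Real.exp_le_exp.2 ?_))
  rw [Finset.sum_add_distrib, add_le_add_iff_left]
  have h4 := sum_inv_sq_le_one (P := P) (fun p hpP => (hP p hpP).two_le)
  calc ∑ p ∈ P, 13 * (r / (p : ℝ)) ^ 2 = 13 * r ^ 2 * ∑ p ∈ P, (1 : ℝ) / p ^ 2 := by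
        rw [Finset.mul_sum]
        exact Finset.sum_congr rfl fun p _ => by rw [div_pow]; ring
    _ ≤ 13 * r ^ 2 * 1 := mul_le_mul_of_nonneg_left h4 (by positivity)
    _ ≤ 21 := by nlinarith

lemma card_divisors_prime_pow {p : ℕ} (hp : p.Prime) (k : ℕ) : #(p ^ k).divisors = k + 1 := by
  rw [Nat.divisors_prime_pow hp, card_map, card_range]

/-- No prime congruent to 3 modulo 4 divides `a` exactly once. -/
def NoSimpleThree (a : ℕ) : Prop := ∀ p, p.Prime → p % 4 = 3 → p ∣ a → p ^ 2 ∣ a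

lemma NoSimpleThree.of_mul {m n : ℕ} (h : m.Coprime n) (hm : NoSimpleThree (m * n)) :
    NoSimpleThree m ∧ NoSimpleThree n := by
  constructor
  · intro p hp hp4 hd
    have h1 := hm p hp hp4 (hd.mul_right n)
    have h2 : (p ^ 2).Coprime n := Nat.Coprime.pow_left 2 (h.coprime_dvd_left hd)
    exact h2.dvd_of_dvd_mul_right h1
  · intro p hp hp4 hd
    have h1 := hm p hp hp4 (hd.mul_left m)
    have h2 : (p ^ 2).Coprime m := Nat.Coprime.pow_left 2 (h.symm.coprime_dvd_left hd)
    exact h2.dvd_of_dvd_mul_left h1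

open Classical in
lemma sum_oddDivisorCount_le (P : Finset ℕ) (hP : ∀ p ∈ P, p.Prime) (S : Finset ℕ)
    (hS : ∀ a ∈ S, NoSimpleThree a ∧ a ≠ 0 ∧ ∀ p, p.Prime → p ∣ a → p ∈ P) :
    ∑ a ∈ S, oddDivisorCount a / a ≤ Real.exp (∑ p ∈ P, (1 + chi4 p) / p + 21) := by
  have h1 : ∑ a ∈ S, oddDivisorCount a / a
      = ∑ a ∈ S, if NoSimpleThree a then oddDivisorCount a / a else 0 :=
    Finset.sum_congr rfl fun a ha => by rw [if_pos (hS a ha).1]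
  rw [h1]
  have hpp : ∀ p : ℕ, p.Prime → ∀ k : ℕ,
      (if NoSimpleThree (p ^ k) then oddDivisorCount (p ^ k) / (p ^ k : ℕ) else 0)
        ≤ (k + 1) * (1 / (p : ℝ)) ^ k := by
    intro p hp k
    split_ifs
    · rw [one_div_pow, mul_one_div]
      push_cast
      exact div_le_div_of_nonneg_right (oddDivisorCount_prime_pow_le hp k) (by positivity)
    · positivity
  refine sum_le_exp_of_prime_pow_le
    (φ := fun a => if NoSimpleThree a then oddDivisorCount a / a else 0)
    (fun n => ?_) ?_ ?_ P hP (fun p => (1 + chi4 p) / p) (r := 1) zero_le_one (by norm_num)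
    (fun p _ => div_nonneg (by linarith [(abs_le.1 (abs_chi4_le p)).1]) (by positivity))
    ?_ ?_ S (fun a ha => (hS a ha).2)
  · split_ifs
    · exact div_nonneg (oddDivisorCount_nonneg n) (by positivity)
    · exact le_rfl
  · split_ifs <;> simp [oddDivisorCount, chi4_one]
  · intro m n hmn
    by_cases h : NoSimpleThree (m * n)
    · have h2 := NoSimpleThree.of_mul hmn h
      simp only [if_pos h, if_pos h2.1, if_pos h2.2]
      rw [oddDivisorCount_mul hmn]
      push_cast
      rw [div_mul_div_comm]
    · simp only [if_neg h]
      refine mul_nonneg ?_ ?_ <;> split_ifs <;>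
        first | exact le_rfl | exact div_nonneg (oddDivisorCount_nonneg _) (by positivity)
  · intro p hpP
    have hp := hP p hpP
    have hp0 : (0 : ℝ) < p := by exact_mod_cast hp.pos
    have hodd : oddDivisorCount p = 1 + |chi4 p| := by
      rw [oddDivisorCount, Nat.Prime.divisors hp, Finset.sum_pair hp.one_lt.ne, chi4_one, abs_one]
    have hnn : 0 ≤ (1 + chi4 p) / p :=
      div_nonneg (by linarith [(abs_le.1 (abs_chi4_le p)).1]) (by positivity)
    by_cases h3 : p % 4 = 3
    · have : ¬ NoSimpleThree p := fun h => by
        have h5 := Nat.le_of_dvd hp.pos (h p hp h3 dvd_rfl)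
        nlinarith [hp.two_le]
      simpa only [if_neg this] using hnn
    · have h4 : |chi4 p| = chi4 p := by
        rw [abs_of_nonneg]
        unfold chi4
        split_ifs <;> norm_num
      split_ifs
      · rw [hodd, h4]
      · exact hnn
  · intro p hpP k
    refine (hpp p (hP p hpP) (k + 2)).trans (le_of_eq ?_)
    push_cast; ring

lemma sum_sqrt_card_divisors_le (P : Finset ℕ) (hP : ∀ p ∈ P, p.Prime) (S : Finset ℕ)
    (hS : ∀ a ∈ S, a ≠ 0 ∧ ∀ p, p.Prime → p ∣ a → p ∈ P) :
    ∑ a ∈ S, √(#a.divisors) / a ≤ Real.exp (√2 * ∑ p ∈ P, (1 : ℝ) / p + 21) := by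
  rw [Finset.mul_sum]
  refine sum_le_exp_of_prime_pow_le (φ := fun a => √(#a.divisors) / a)
    (fun n => by positivity) (by simp) ?_ P hP (fun p => √2 * (1 / p)) (r := 1) zero_le_one
    (by norm_num) (fun p _ => by positivity) ?_ ?_ S hS
  · intro m n hmn
    rw [Nat.Coprime.card_divisors_mul hmn]
    push_cast
    rw [Real.sqrt_mul (by positivity), div_mul_div_comm]
  · intro p hpP
    have := card_divisors_prime_pow (hP p hpP) 1
    rw [pow_one] at this
    rw [this, mul_one_div]
    norm_num
  · intro p hpP k
    rw [card_divisors_prime_pow (hP p hpP), one_div_pow, mul_one_div]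
    push_cast
    refine div_le_div_of_nonneg_right ?_ (by positivity)
    rw [Real.sqrt_le_left (by positivity)]
    nlinarith [Nat.cast_nonneg (α := ℝ) k]

lemma sum_card_divisors_mul_pow_le (P : Finset ℕ) (hP : ∀ p ∈ P, p.Prime) (S : Finset ℕ)
    (hS : ∀ a ∈ S, a ≠ 0 ∧ ∀ p, p.Prime → p ∣ a → p ∈ P) :
    ∑ a ∈ S, #a.divisors * (5 / 4 : ℝ) ^ a.primeFactorsList.length / a
      ≤ Real.exp (5 / 2 * ∑ p ∈ P, (1 : ℝ) / p + 21) := by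
  rw [Finset.mul_sum]
  refine sum_le_exp_of_prime_pow_le
    (φ := fun a => #a.divisors * (5 / 4 : ℝ) ^ a.primeFactorsList.length / a)
    (fun n => by positivity) (by simp) ?_ P hP (fun p => 5 / 2 * (1 / p)) (r := 5 / 4) (by norm_num)
    le_rfl (fun p _ => by positivity) ?_ ?_ S hS
  · intro m n hmn
    rw [Nat.Coprime.card_divisors_mul hmn, (Nat.perm_primeFactorsList_mul_of_coprime hmn).length_eq,
      List.length_append, pow_add]
    push_cast
    rw [div_mul_div_comm]
    exact le_of_eq (by ring)
  · intro p hpP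
    have := card_divisors_prime_pow (hP p hpP) 1
    rw [pow_one] at this
    rw [this, Nat.primeFactorsList_prime (hP p hpP), mul_one_div]
    norm_num
  · intro p hpP k
    rw [card_divisors_prime_pow (hP p hpP), (hP p hpP).primeFactorsList_pow, List.length_replicate,
      div_pow (5 / 4 : ℝ), mul_div_assoc]
    push_cast
    exact le_of_eq (by ring)

lemma sum_inv_mul_sum_inv_abs_le_sqrt (S T : Finset ℕ) (g : ℕ → ℕ → ℝ) {B : ℝ} (hB : 0 ≤ B)
    (h : (∑ a ∈ S, (1 : ℝ) / a) * (∑ n ∈ T, (1 : ℝ) / n)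
      * (∑ n ∈ T, (1 : ℝ) / n * ∑ a ∈ S, (1 : ℝ) / a * g a n ^ 2) ≤ B ^ 2) :
    ∑ a ∈ S, (1 : ℝ) / a * ∑ n ∈ T, (1 : ℝ) / n * |g a n| ≤ B := by
  refine le_of_sq_le_sq ?_ hB
  have h1 := Finset.sum_sq_le_sum_mul_sum_of_sq_le_mul (S ×ˢ T)
    (r := fun x => (1 : ℝ) / x.1 * (1 / x.2 * |g x.1 x.2|))
    (f := fun x => (1 : ℝ) / x.1 * (1 / x.2)) (g := fun x => (1 : ℝ) / x.2 * (1 / x.1 * g x.1 x.2 ^ 2))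
    (fun _ _ => by positivity) (fun _ _ => by positivity)
    (fun x _ => le_of_eq (by rw [mul_pow, mul_pow, sq_abs]; ring))
  rw [Finset.sum_product, Finset.sum_product, Finset.sum_product_right] at h1
  simp_rw [← Finset.mul_sum] at h1
  rw [← Finset.sum_mul] at h1
  exact h1.trans h

namespace Scale

variable {c : ℝ} {N R : ℕ}

lemma exp_twentyone_le (h : Scale c N R) : Real.exp 21 ≤ R ^ 3 := by
  have h1 : Real.exp 21 = Real.exp 1 ^ 21 := by rw [← Real.exp_nat_mul]; norm_num
  calc Real.exp 21 ≤ 3 ^ 21 := by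
        rw [h1]; exact pow_le_pow_left₀ (Real.exp_pos _).le exp_one_lt_three.le _
    _ ≤ (10 ^ 4 : ℝ) ^ 3 := by norm_num
    _ ≤ _ := pow_le_pow_left₀ (by norm_num) h.hR' 3

lemma sum_inv_le (h : Scale c N R) : ∑ n ∈ Icc 1 N, (1 : ℝ) / n ≤ 2 * Real.log N := by
  have := sum_inv_le_one_add_log (X := N) (by have := h.three_le; omega)
  linarith [h.log_ge]

lemma sum_oddDivisorCount_le (h : Scale c N R) {x : ℕ} (hx : 3 ≤ x) (hxN : x ≤ N) (S : Finset ℕ)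
    (hS : ∀ a ∈ S, NoSimpleThree a ∧ a ≠ 0 ∧ ∀ p, p.Prime → p ∣ a → p ≤ x) :
    ∑ a ∈ S, oddDivisorCount a / a ≤ R ^ 4 * Real.log x := by
  have h1 := _root_.sum_oddDivisorCount_le (primesUpTo x) (fun p hp => prime_of_mem hp) S
    (fun a ha => ⟨(hS a ha).1, (hS a ha).2.1, fun p hp hd =>
      mem_primesUpTo.2 ⟨hp, (hS a ha).2.2 p hp hd⟩⟩)
  refine h1.trans ?_
  have h2 := one_le_log_of_three_le hx
  rw [Real.exp_add]
  calc _ ≤ (R * Real.log x) * (R : ℝ) ^ 3 :=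
        mul_le_mul (h.exp_sum_one_add_chi4 hx hxN) h.exp_twentyone_le (Real.exp_pos _).le
          (by positivity)
    _ = _ := by ring

lemma sum_abs_windowSum_rough_le (h : Scale c N R) {q : ℕ} (hq : 1 ≤ q) (hqN : q ≤ N) {y : ℝ}
    (hy0 : 0 < y) (hy : y ≤ N) (S : Finset ℕ)
    (hS : ∀ a ∈ S, a ≠ 0 ∧ a.primeFactors ⊆ roughPrimes q N) :
    ∑ a ∈ S, (1 : ℝ) / a * ∑ n ∈ Icc 1 N, (1 : ℝ) / n * |windowSum a n (y / q) y|
      ≤ R ^ 10 * (Real.log N ^ 2 / Real.log (q + 1)) := by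
  have hl := log_two_le_log_succ hq
  have hL := h.log_ge
  have hR := h.hR'
  have hq1 : (1 : ℝ) ≤ q := by exact_mod_cast hq
  refine sum_inv_mul_sum_inv_abs_le_sqrt S (Icc 1 N) (fun a n => windowSum a n (y / q) y)
    (by positivity) ?_
  have h1 : ∑ a ∈ S, (1 : ℝ) / a ≤ R ^ 3 * (Real.log N / Real.log (q + 1)) :=
    (sum_inv_smooth_le (fun p hp => prime_of_mem_roughPrimes hp) S hS).trans
      (h.exp_roughPrimes_le' hq hqN)
  have h2 := h.window_moment_le hq hqN hy0 hy hq1 S hS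
  have h3 : Real.log q ≤ Real.log (q + 1) := Real.log_le_log (by linarith) (by linarith)
  have h4 : (R : ℝ) ^ 16 * (Real.log N / Real.log (q + 1)) ^ 2 * (Real.log q + Real.log (q + 1))
      ≤ R ^ 16 * (Real.log N / Real.log (q + 1)) ^ 2 * (2 * Real.log (q + 1)) :=
    mul_le_mul_of_nonneg_left (by linarith) (by positivity)
  calc _ ≤ (R ^ 3 * (Real.log N / Real.log (q + 1))) * (2 * Real.log N) *
        (R ^ 16 * (Real.log N / Real.log (q + 1)) ^ 2 * (2 * Real.log (q + 1))) := by
        refine mul_le_mul (mul_le_mul h1 h.sum_inv_le (Finset.sum_nonneg fun _ _ => by positivity)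
          (by positivity)) (h2.trans h4) (Finset.sum_nonneg fun _ _ => mul_nonneg (by positivity)
            (Finset.sum_nonneg fun _ _ => by positivity)) (by positivity)
    _ = 4 * R ^ 19 * (Real.log N ^ 2 / Real.log (q + 1)) ^ 2 := by field_simp; ring
    _ ≤ R * R ^ 19 * (Real.log N ^ 2 / Real.log (q + 1)) ^ 2 :=
        mul_le_mul_of_nonneg_right (mul_le_mul_of_nonneg_right (by linarith) (by positivity))
          (by positivity)
    _ = _ := by ring

end Scale

lemma exists_simple_three_split {a : ℕ} (ha : a ≠ 0) (h : ¬ NoSimpleThree a) :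
    ∃ q a₁ a₃, a₁ * (q * a₃) = a ∧ q.Prime ∧ q % 4 = 3 ∧ NoSimpleThree a₁ ∧
      (∀ p, p.Prime → p ∣ a₁ → p < q) ∧ (∀ p, p.Prime → p ∣ a₃ → q < p) := by
  classical
  have hex : ∃ q, q.Prime ∧ q % 4 = 3 ∧ q ∣ a ∧ ¬ q ^ 2 ∣ a := by
    simp only [NoSimpleThree, not_forall] at h
    obtain ⟨p, h1, h2, h3, h4⟩ := h
    exact ⟨p, h1, h2, h3, h4⟩
  obtain ⟨hq, hq4, hqa, hq2⟩ := Nat.find_spec hex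
  have hmin := fun p => Nat.find_min hex (m := p)
  set q := Nat.find hex with hqdef
  obtain ⟨b, hb⟩ := hqa
  have hb0 : b ≠ 0 := by rintro rfl; exact ha (by simpa using hb)
  have hqb : ¬ q ∣ b := by
    rintro ⟨e, rfl⟩
    exact hq2 ⟨e, by rw [hb]; ring⟩
  obtain ⟨a₁, a₃, h1, h2, h3⟩ := exists_mul_eq_prime_split (fun p => p < q) hb0
  have h3' : ∀ p, p.Prime → p ∣ a₃ → q < p := fun p hp hd => by
    have h4 := h3 p hp hd
    have h5 : p ≠ q := by
      rintro h5
      exact hqb (h1 ▸ (h5 ▸ hd).mul_left a₁)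
    omega
  have heq : a₁ * (q * a₃) = a := by rw [hb, h1]; ring
  refine ⟨q, a₁, a₃, heq, hq, hq4, ?_, h2, h3'⟩
  have hcop : a₁.Coprime (q * a₃) := coprime_of_prime_split (Q := fun p => p < q) h2
    (fun p hp hd => by
      rcases (Nat.Prime.dvd_mul hp).1 hd with h4 | h4
      · rw [(Nat.prime_dvd_prime_iff_eq hp hq).1 h4]; exact lt_irrefl _
      · exact h3 p hp h4)
  intro p hp hp4 hd
  have h6 := hmin p (h2 p hp hd)
  have h7 : p ∣ a := heq ▸ hd.mul_right _
  have h8 : p ^ 2 ∣ a := by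
    by_contra h9
    exact h6 ⟨hp, hp4, h7, h9⟩
  rw [← heq] at h8
  exact (Nat.Coprime.pow_left 2 (hcop.coprime_dvd_left hd)).dvd_of_dvd_mul_right h8

open Classical in
lemma Scale.sum_abs_windowSum_zero_le {c : ℝ} {N R : ℕ} (h : Scale c N R) {y : ℝ} (hy0 : 0 < y)
    (hy : y ≤ N) {A : ℕ} (hA : A ≤ N) :
    ∑ a ∈ Icc 1 A, (1 : ℝ) / a * ∑ n ∈ Icc 1 N, (1 : ℝ) / n * |windowSum a n 0 y|
      ≤ R ^ 16 * Real.log N ^ 2 := by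
  have hL := h.log_ge
  have hR := h.hR'
  set F : ℕ → ℝ := fun a => (1 : ℝ) / a * ∑ n ∈ Icc 1 N, (1 : ℝ) / n * |windowSum a n 0 y| with hF
  have hF0 : ∀ a, 0 ≤ F a := fun a =>
    mul_nonneg (by positivity) (Finset.sum_nonneg fun _ _ => by positivity)
  rw [← Finset.sum_filter_add_sum_filter_not _ NoSimpleThree]
  have hI : ∑ a ∈ Icc 1 A with NoSimpleThree a, F a ≤ R ^ 5 * Real.log N ^ 2 := by
    have h1 := h.sum_oddDivisorCount_le h.three_le le_rfl ({a ∈ Icc 1 A | NoSimpleThree a})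
      (fun a ha => by
        simp only [mem_filter, mem_Icc] at ha
        exact ⟨ha.2, by omega, fun p _ hd => (Nat.le_of_dvd (by omega) hd).trans (by omega)⟩)
    calc _ ≤ ∑ a ∈ Icc 1 A with NoSimpleThree a, oddDivisorCount a / a * (2 * Real.log N) := by
          refine Finset.sum_le_sum fun a _ => ?_
          rw [hF]
          calc (1 : ℝ) / a * ∑ n ∈ Icc 1 N, (1 : ℝ) / n * |windowSum a n 0 y|
              ≤ 1 / a * ∑ n ∈ Icc 1 N, (1 : ℝ) / n * oddDivisorCount a :=
                mul_le_mul_of_nonneg_left (Finset.sum_le_sum fun n _ =>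
                  mul_le_mul_of_nonneg_left (abs_windowSum_le_oddDivisorCount _ _ _ _)
                    (by positivity)) (by positivity)
            _ = oddDivisorCount a / a * ∑ n ∈ Icc 1 N, (1 : ℝ) / n := by
                rw [← Finset.sum_mul]; ring
            _ ≤ _ := mul_le_mul_of_nonneg_left h.sum_inv_le
                (div_nonneg (oddDivisorCount_nonneg a) (by positivity))
      _ ≤ (R ^ 4 * Real.log N) * (2 * Real.log N) := by
          rw [← Finset.sum_mul]
          exact mul_le_mul_of_nonneg_right h1 (by linarith)
      _ = 2 * R ^ 4 * Real.log N ^ 2 := by ring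
      _ ≤ R * R ^ 4 * Real.log N ^ 2 :=
          mul_le_mul_of_nonneg_right (mul_le_mul_of_nonneg_right (by linarith) (by positivity))
            (by positivity)
      _ = _ := by ring
  set T₁ : ℕ → Finset ℕ := fun q =>
    {a ∈ Icc 1 N | NoSimpleThree a ∧ ∀ p, p.Prime → p ∣ a → p < q} with hT₁
  set T₃ : ℕ → Finset ℕ := fun q => {a ∈ Icc 1 N | a.primeFactors ⊆ roughPrimes q N} with hT₃
  set Q : Finset ℕ := {q ∈ primesUpTo N | q % 4 = 3} with hQ
  have hII : ∑ a ∈ Icc 1 A with ¬ NoSimpleThree a, F a ≤ R ^ 15 * Real.log N ^ 2 := by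
    have hcover : ∑ a ∈ Icc 1 A with ¬ NoSimpleThree a, F a
        ≤ ∑ t ∈ Q.sigma fun q => T₁ q ×ˢ T₃ q, F (t.2.1 * (t.1 * t.2.2)) := by
      refine sum_le_sum_of_cover _ _ (fun t : (_ : ℕ) × ℕ × ℕ => t.2.1 * (t.1 * t.2.2)) F
        (fun _ _ => hF0 _) fun a ha => ?_
      simp only [mem_filter, mem_Icc] at ha
      have ha0 : a ≠ 0 := by omega
      obtain ⟨q, a₁, a₃, h1, h2, h3, h4, h5, h6⟩ := exists_simple_three_split ha0 ha.2
      have hle : ∀ d, d ∣ a → 1 ≤ d ∧ d ≤ N := fun d hd =>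
        ⟨Nat.pos_of_dvd_of_pos hd (by omega), (Nat.le_of_dvd (by omega) hd).trans (by omega)⟩
      have k1 := hle a₁ ⟨_, h1.symm⟩
      have k2 := hle q ⟨a₁ * a₃, by rw [← h1]; ring⟩
      have k3 := hle a₃ ⟨a₁ * q, by rw [← h1]; ring⟩
      refine ⟨⟨q, a₁, a₃⟩, ?_, h1⟩
      simp only [mem_sigma, mem_product, hQ, hT₁, hT₃, mem_filter, mem_primesUpTo, mem_Icc]
      refine ⟨⟨⟨h2, k2.2⟩, h3⟩, ⟨k1, h4, h5⟩, k3, fun p hp => ?_⟩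
      obtain ⟨m1, m2, -⟩ := Nat.mem_primeFactors.1 hp
      exact mem_roughPrimes.2 ⟨m1, (Nat.le_of_dvd (by omega) m2).trans k3.2, h6 p m1 m2⟩
    refine hcover.trans ?_
    rw [Finset.sum_sigma]
    have hq : ∀ q ∈ Q, ∑ t ∈ T₁ q ×ˢ T₃ q, F (t.1 * (q * t.2)) ≤ R ^ 14 * Real.log N ^ 2 * (1 / q) := by
      intro q hq
      obtain ⟨hqp, hq4⟩ := mem_filter.1 hq
      obtain ⟨hqp, hqN⟩ := mem_primesUpTo.1 hqp
      have hq3 : 3 ≤ q := by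
        have := hqp.two_le
        omega
      have hq0 : (0 : ℝ) < q := by exact_mod_cast hqp.pos
      have hl := log_two_le_log_succ (q := q) (by omega)
      set W := (R : ℝ) ^ 10 * (Real.log N ^ 2 / Real.log (q + 1)) with hW
      rw [Finset.sum_product]
      have h1 : ∀ a₁ ∈ T₁ q, ∑ a₃ ∈ T₃ q, F (a₁ * (q * a₃))
          ≤ oddDivisorCount a₁ / a₁ * (W * (1 / q)) := by
        intro a₁ ha₁
        simp only [hT₁, mem_filter, mem_Icc] at ha₁
        have hrep : ∀ a₃ ∈ T₃ q, F (a₁ * (q * a₃)) ≤ 1 / a₁ * (1 / q) * ∑ d ∈ a₁.divisors,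
            |chi4 d| * (1 / a₃ * ∑ n ∈ Icc 1 N, (1 : ℝ) / n * |windowSum a₃ n (y / d / q) (y / d)|) := by
          intro a₃ ha₃
          simp only [hT₃, mem_filter, mem_Icc] at ha₃
          have hp3 : ∀ p, p.Prime → p ∣ a₃ → q < p := fun p hp hd =>
            (mem_roughPrimes.1 (ha₃.2 (Nat.mem_primeFactors.2 ⟨hp, hd, by omega⟩))).2.2
          have hcop : a₁.Coprime (q * a₃) := coprime_of_prime_split (Q := fun p => p < q) ha₁.2.2
            (fun p hp hd => by
              rcases (Nat.Prime.dvd_mul hp).1 hd with h4 | h4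
              · rw [(Nat.prime_dvd_prime_iff_eq hp hqp).1 h4]; exact lt_irrefl _
              · exact not_lt.2 (hp3 p hp h4).le)
          have hcop2 : q.Coprime a₃ := (Nat.Prime.coprime_iff_not_dvd hqp).2 fun hd =>
            lt_irrefl _ (hp3 q hqp hd)
          have hw : ∀ n ∈ Icc 1 N, |windowSum (a₁ * (q * a₃)) n 0 y|
              ≤ ∑ d ∈ a₁.divisors, |chi4 d| * |windowSum a₃ n (y / d / q) (y / d)| := by
            intro n hn
            rw [windowSum_mul_of_coprime hcop]
            refine (Finset.abs_sum_le_sum_abs _ _).trans (le_of_eq ?_)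
            refine Finset.sum_congr rfl fun d hd => ?_
            have hd0 := Nat.pos_of_mem_divisors hd
            rw [abs_mul, windowSum_mul_left hd0, zero_div,
              windowSum_prime_mul hqp hq4 hcop2 (mem_Icc.1 hn).1 (by positivity)]
          calc F (a₁ * (q * a₃)) ≤ 1 / ((a₁ * (q * a₃) : ℕ) : ℝ) * ∑ n ∈ Icc 1 N, (1 : ℝ) / n *
                ∑ d ∈ a₁.divisors, |chi4 d| * |windowSum a₃ n (y / d / q) (y / d)| :=
                mul_le_mul_of_nonneg_left (Finset.sum_le_sum fun n hn =>
                  mul_le_mul_of_nonneg_left (hw n hn) (by positivity)) (by positivity)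
            _ = _ := by
                simp_rw [Finset.mul_sum]
                rw [Finset.sum_comm]
                refine Finset.sum_congr rfl fun d _ => Finset.sum_congr rfl fun n _ => ?_
                push_cast
                rw [← one_div_mul_one_div, ← one_div_mul_one_div]
                ring
        refine (Finset.sum_le_sum hrep).trans ?_
        rw [← Finset.mul_sum, Finset.sum_comm]
        simp_rw [← Finset.mul_sum]
        calc 1 / (a₁ : ℝ) * (1 / q) * ∑ d ∈ a₁.divisors, |chi4 d| * ∑ a₃ ∈ T₃ q,
              1 / (a₃ : ℝ) * ∑ n ∈ Icc 1 N, (1 : ℝ) / n * |windowSum a₃ n (y / d / q) (y / d)|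
            ≤ 1 / (a₁ : ℝ) * (1 / q) * ∑ d ∈ a₁.divisors, |chi4 d| * W := by
              refine mul_le_mul_of_nonneg_left (Finset.sum_le_sum fun d hd =>
                mul_le_mul_of_nonneg_left ?_ (abs_nonneg _)) (by positivity)
              have hd1 : (1 : ℝ) ≤ d := by exact_mod_cast Nat.pos_of_mem_divisors hd
              refine h.sum_abs_windowSum_rough_le (by omega) hqN (by positivity)
                ((div_le_self hy0.le hd1).trans hy) _ fun a ha => ?_
              simp only [hT₃, mem_filter, mem_Icc] at ha
              exact ⟨by omega, ha.2⟩
          _ = _ := by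
              rw [← Finset.sum_mul, oddDivisorCount]; ring
      refine (Finset.sum_le_sum h1).trans ?_
      rw [← Finset.sum_mul]
      have h2 := h.sum_oddDivisorCount_le hq3 hqN (T₁ q) (fun a ha => by
        simp only [hT₁, mem_filter, mem_Icc] at ha
        exact ⟨ha.2.1, by omega, fun p hp hd => (ha.2.2 p hp hd).le⟩)
      have h3 : Real.log q ≤ Real.log (q + 1) := Real.log_le_log (by linarith) (by linarith)
      calc _ ≤ ((R : ℝ) ^ 4 * Real.log (q + 1)) * (W * (1 / q)) := by
            refine mul_le_mul_of_nonneg_right (h2.trans ?_) (by positivity)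
            exact mul_le_mul_of_nonneg_left h3 (by positivity)
        _ = _ := by rw [hW]; field_simp
    refine (Finset.sum_le_sum hq).trans ?_
    rw [← Finset.mul_sum]
    have h2 : ∑ q ∈ Q, (1 : ℝ) / q ≤ R := by
      have h3 : ∑ q ∈ Q, (1 : ℝ) / q ≤ primeRecip N :=
        Finset.sum_le_sum_of_subset_of_nonneg (filter_subset _ _) fun _ _ _ => by positivity
      have h4 := h.primeRecip_le le_rfl
      have h5 := h.hll
      have h6 := h.loglog_nonneg
      linarith
    calc _ ≤ (R : ℝ) ^ 14 * Real.log N ^ 2 * R := mul_le_mul_of_nonneg_left h2 (by positivity)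
      _ = _ := by ring
  have h5 : (R : ℝ) ^ 5 ≤ R ^ 15 := h.le_pow (by norm_num)
  have h6 : 2 * (R : ℝ) ^ 15 ≤ R ^ 16 := by
    rw [pow_succ' (R : ℝ) 15]
    exact mul_le_mul_of_nonneg_right (by linarith) (by positivity)
  calc _ ≤ R ^ 5 * Real.log N ^ 2 + R ^ 15 * Real.log N ^ 2 := add_le_add hI hII
    _ = (R ^ 5 + R ^ 15) * Real.log N ^ 2 := by ring
    _ ≤ _ := mul_le_mul_of_nonneg_right (by linarith) (by positivity)

lemma sum_inv_mul_abs_windowSum_le (a N : ℕ) {y H : ℝ} (hy : 0 < y) (hH : 1 ≤ H) :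
    ∑ n ∈ Icc 1 N, (1 : ℝ) / n * |windowSum a n (y / H) y| ≤ #a.divisors * (1 + Real.log H) := by
  calc _ ≤ ∑ n ∈ Icc 1 N, ∑ d ∈ a.divisors,
        if y / d / H < (n : ℝ) ∧ (n : ℝ) ≤ y / d then (1 : ℝ) / n else 0 := by
        refine Finset.sum_le_sum fun n _ => ?_
        rw [windowSum, ← abs_of_nonneg (show (0 : ℝ) ≤ 1 / n by positivity), ← abs_mul,
          Finset.mul_sum]
        refine (Finset.abs_sum_le_sum_abs _ _).trans (Finset.sum_le_sum fun d hd => ?_)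
        have hd0 : (0 : ℝ) < d := by exact_mod_cast Nat.pos_of_mem_divisors hd
        rw [abs_of_nonneg (show (0 : ℝ) ≤ 1 / n by positivity)]
        by_cases hw : y / H < (d * n : ℝ) ∧ (d * n : ℝ) ≤ y
        · have hw' : y / d / H < (n : ℝ) ∧ (n : ℝ) ≤ y / d := by
            rw [div_right_comm, div_lt_iff₀ hd0, le_div_iff₀ hd0]
            exact ⟨by linarith [hw.1], by linarith [hw.2]⟩
          rw [if_pos hw, if_pos hw', abs_mul, abs_of_nonneg (show (0 : ℝ) ≤ 1 / n by positivity)]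
          exact mul_le_of_le_one_right (by positivity) (abs_chi4_le d)
        · rw [if_neg hw, mul_zero, abs_zero]
          split_ifs <;> positivity
    _ = ∑ d ∈ a.divisors, ∑ n ∈ (Icc 1 N).filter
          (fun n : ℕ => y / d / H < (n : ℝ) ∧ (n : ℝ) ≤ y / d), (1 : ℝ) / n := by
        rw [Finset.sum_comm]
        simp_rw [Finset.sum_filter]
    _ ≤ ∑ d ∈ a.divisors, (1 + Real.log H) := by
        refine Finset.sum_le_sum fun d hd => ?_
        have hd0 : (0 : ℝ) < d := by exact_mod_cast Nat.pos_of_mem_divisors hd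
        have hyd : 0 < y / d := by positivity
        refine (sum_inv_window_le N (u := y / d / H) (v := y / d) (by positivity)
          (div_le_self hyd.le hH)).trans (le_of_eq ?_)
        rw [div_div_cancel₀ hyd.ne']
    _ = _ := by rw [Finset.sum_const, nsmul_eq_mul]

namespace Scale

variable {c : ℝ} {N R : ℕ}

lemma sum_sqrt_card_divisors_div_le (h : Scale c N R) (S : Finset ℕ) (hS : ∀ a ∈ S, a ∈ Icc 1 N) :
    ∑ a ∈ S, √(#a.divisors : ℝ) / a ≤ R ^ 5 * Real.log N ^ √2 := by
  have hL := h.log_ge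
  have hR := h.hR'
  have h1 := sum_sqrt_card_divisors_le (primesUpTo N) (fun p hp => prime_of_mem hp) S
    (fun a ha => by
      have h2 := mem_Icc.1 (hS a ha)
      exact ⟨by omega, fun p hp hd => mem_primesUpTo.2 ⟨hp, (Nat.le_of_dvd (by omega) hd).trans h2.2⟩⟩)
  have h3 : Real.exp (√2 * primeRecip N) ≤ R ^ 2 * Real.log N ^ √2 := by
    rw [mul_comm, Real.exp_mul]
    calc Real.exp (primeRecip N) ^ √2 ≤ (R * Real.log N) ^ √2 :=
          Real.rpow_le_rpow (Real.exp_pos _).le (h.exp_primeRecip h.three_le le_rfl) (by positivity)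
      _ = (R : ℝ) ^ √2 * Real.log N ^ √2 := Real.mul_rpow (by linarith) (by linarith)
      _ ≤ (R : ℝ) ^ (2 : ℝ) * Real.log N ^ √2 := by
          refine mul_le_mul_of_nonneg_right (Real.rpow_le_rpow_of_exponent_le (by linarith) ?_)
            (by positivity)
          rw [Real.sqrt_le_left (by norm_num)]
          norm_num
      _ = _ := by norm_cast
  refine h1.trans ?_
  rw [Real.exp_add]
  calc _ ≤ (R ^ 2 * Real.log N ^ √2) * (R : ℝ) ^ 3 :=
        mul_le_mul h3 h.exp_twentyone_le (Real.exp_pos _).le (by positivity)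
    _ = _ := by ring

lemma sum_abs_windowSum_short_le (h : Scale c N R) {y H : ℝ} (hy0 : 0 < y) (hy : y ≤ N)
    (hH : 1 ≤ H) (hHR : Real.log H ≤ R) {A : ℕ} (hA : A ≤ N) :
    ∑ a ∈ Icc 1 A, (1 : ℝ) / a * ∑ n ∈ Icc 1 N, (1 : ℝ) / n * |windowSum a n (y / H) y|
      ≤ R ^ 13 * Real.log N ^ ((√2 + 5 / 2) / 2) := by
  have hL := h.log_ge
  have hL0 : 0 < Real.log N := by linarith
  have hR := h.hR'
  have hH0 := Real.log_nonneg hH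
  set L := Real.log N with hLdef
  set E := L ^ ((√2 + 5 / 2) / 2) with hE
  have hE0 : 0 < E := Real.rpow_pos_of_pos hL0 _
  have hE2 : E ^ 2 = L ^ √2 * (L ^ 2 * √L) := by
    rw [hE, ← Real.rpow_natCast, ← Real.rpow_mul hL0.le, Real.sqrt_eq_rpow L, ← Real.rpow_natCast L 2,
      ← Real.rpow_add hL0, ← Real.rpow_add hL0]
    congr 1; push_cast; ring
  have hEle : L ^ √2 * √L ≤ E := by
    rw [hE, Real.sqrt_eq_rpow L, ← Real.rpow_add hL0]
    refine Real.rpow_le_rpow_of_exponent_le (by linarith) ?_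
    have : √2 ≤ 3 / 2 := by
      rw [Real.sqrt_le_left (by norm_num)]
      norm_num
    linarith
  set S₁ := (Icc 1 A).filter fun a : ℕ => (#a.divisors : ℝ) ≤ L with hS₁
  set S₂ := (Icc 1 A).filter fun a : ℕ => ¬ (#a.divisors : ℝ) ≤ L with hS₂
  have hmem : ∀ a ∈ Icc 1 A, a ∈ Icc 1 N := fun a ha => by
    rw [mem_Icc] at ha ⊢; omega
  have h1 : ∑ a ∈ S₁, (1 : ℝ) / a * ∑ n ∈ Icc 1 N, (1 : ℝ) / n * |windowSum a n (y / H) y|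
      ≤ R ^ 7 * E := by
    calc _ ≤ ∑ a ∈ S₁, √L * (1 + R) * (√(#a.divisors : ℝ) / a) := by
          refine Finset.sum_le_sum fun a ha => ?_
          have h2 := (mem_filter.1 ha).2
          have h3 : (#a.divisors : ℝ) ≤ √L * √(#a.divisors : ℝ) := by
            nth_rw 1 [← Real.mul_self_sqrt (Nat.cast_nonneg (#a.divisors))]
            exact mul_le_mul_of_nonneg_right (Real.sqrt_le_sqrt h2) (Real.sqrt_nonneg _)
          calc _ ≤ (1 : ℝ) / a * ((√L * √(#a.divisors : ℝ)) * (1 + R)) :=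
                mul_le_mul_of_nonneg_left ((sum_inv_mul_abs_windowSum_le a N hy0 hH).trans
                  (mul_le_mul h3 (by linarith) (by linarith) (by positivity))) (by positivity)
            _ = _ := by ring
      _ ≤ √L * (1 + R) * (R ^ 5 * L ^ √2) := by
          rw [← Finset.mul_sum]
          exact mul_le_mul_of_nonneg_left (h.sum_sqrt_card_divisors_div_le S₁
            fun a ha => hmem a (mem_filter.1 ha).1) (by positivity)
      _ = (1 + R) * R ^ 5 * (L ^ √2 * √L) := by ring
      _ ≤ (R * R) * R ^ 5 * E := by
          refine mul_le_mul (mul_le_mul_of_nonneg_right ?_ (by positivity)) hEle (by positivity)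
            (by positivity)
          nlinarith
      _ = _ := by ring
  have h2 : ∑ a ∈ S₂, (1 : ℝ) / a * ∑ n ∈ Icc 1 N, (1 : ℝ) / n * |windowSum a n (y / H) y|
      ≤ R ^ 12 * E := by
    refine sum_inv_mul_sum_inv_abs_le_sqrt S₂ (Icc 1 N) (fun a n => windowSum a n (y / H) y)
      (by positivity) ?_
    have h3 : (∑ a ∈ S₂, (1 : ℝ) / a) * √L ≤ R ^ 5 * L ^ √2 := by
      refine le_trans ?_ (h.sum_sqrt_card_divisors_div_le S₂ fun a ha => hmem a (mem_filter.1 ha).1)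
      rw [Finset.sum_mul]
      refine Finset.sum_le_sum fun a ha => ?_
      rw [div_mul_eq_mul_div, one_mul]
      exact div_le_div_of_nonneg_right (Real.sqrt_le_sqrt (not_le.1 (mem_filter.1 ha).2).le)
        (by positivity)
    have h4 := h.window_moment_le le_rfl (by have := h.three_le; omega) hy0 hy hH S₂ fun a ha => by
      have h5 := mem_Icc.1 (hmem a (mem_filter.1 ha).1)
      refine ⟨by omega, fun p hp => ?_⟩
      obtain ⟨m1, m2, -⟩ := Nat.mem_primeFactors.1 hp
      exact mem_roughPrimes.2 ⟨m1, (Nat.le_of_dvd (by omega) m2).trans h5.2, m1.one_lt⟩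
    have hl := log_two_le_log_succ (le_refl 1)
    have hl' : Real.log ((1 : ℕ) + 1) ≤ 1 := by
      push_cast
      linarith [Real.log_le_sub_one_of_pos (show (0 : ℝ) < 1 + 1 by norm_num)]
    set l := Real.log ((1 : ℕ) + 1) with hldef
    have hs0 : 0 < √L := Real.sqrt_pos.2 hL0
    have h6 : (R : ℝ) ^ 16 * (L / l) ^ 2 * (Real.log H + l) ≤ R ^ 16 * (3 / 2 * L) ^ 2 * (2 * R) := by
      have h7 : L / l ≤ 3 / 2 * L := by
        rw [div_le_iff₀ (by linarith)]
        nlinarith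
      have h8 : 0 ≤ L / l := by positivity
      gcongr
      linarith
    calc _ ≤ (R ^ 5 * L ^ √2 / √L) * (2 * L) * (R ^ 16 * (3 / 2 * L) ^ 2 * (2 * R)) := by
          refine mul_le_mul (mul_le_mul ((le_div_iff₀ hs0).2 h3) h.sum_inv_le
            (Finset.sum_nonneg fun _ _ => by positivity) (by positivity)) (h4.trans h6)
            (Finset.sum_nonneg fun _ _ => mul_nonneg (by positivity)
              (Finset.sum_nonneg fun _ _ => by positivity)) (by positivity)
      _ = 9 * R ^ 22 * (L ^ √2 * (L ^ 2 * (L / √L))) := by ring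
      _ = 9 * R ^ 22 * E ^ 2 := by rw [Real.div_sqrt, hE2]
      _ ≤ (R * R) * R ^ 22 * E ^ 2 := by
          refine mul_le_mul_of_nonneg_right (mul_le_mul_of_nonneg_right ?_ (by positivity))
            (by positivity)
          nlinarith
      _ = _ := by ring
  have h5 : (R : ℝ) ^ 7 ≤ R ^ 12 := h.le_pow (by norm_num)
  rw [← Finset.sum_filter_add_sum_filter_not _ (fun a : ℕ => (#a.divisors : ℝ) ≤ L)]
  calc _ ≤ R ^ 7 * E + R ^ 12 * E := add_le_add h1 h2
    _ ≤ R ^ 12 * E + R ^ 12 * E := by gcongr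
    _ = 2 * (R ^ 12 * E) := by ring
    _ ≤ R * (R ^ 12 * E) := mul_le_mul_of_nonneg_right (by linarith) (by positivity)
    _ = _ := by ring

end Scale

/-- The number of endpoints of the windows `(x / d, y / d]`, `d ∣ a`, inside `(u, v)`. -/
def windowJump (a u v : ℕ) (x y : ℝ) : ℝ :=
  ∑ d ∈ a.divisors, ((if (u : ℝ) < x / d ∧ x / d < v then 1 else 0)
    + if (u : ℝ) < y / d ∧ y / d < v then 1 else 0)

lemma windowJump_nonneg (a u v : ℕ) (x y : ℝ) : 0 ≤ windowJump a u v x y :=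
  Finset.sum_nonneg fun _ _ => by split_ifs <;> norm_num

lemma abs_windowSum_le_add_windowJump (a : ℕ) {u v m n : ℕ} (hm : m ∈ Ioc u v) (hn : n ∈ Ioc u v)
    (x y : ℝ) : |windowSum a m x y| ≤ |windowSum a n x y| + windowJump a u v x y := by
  have h1 : |windowSum a m x y - windowSum a n x y| ≤ windowJump a u v x y := by
    rw [windowSum, windowSum, ← Finset.sum_sub_distrib]
    refine (Finset.abs_sum_le_sum_abs _ _).trans (Finset.sum_le_sum fun d hd => ?_)
    have hd0 : (0 : ℝ) < d := by exact_mod_cast Nat.pos_of_mem_divisors hd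
    have hm1 : (u : ℝ) < m := by exact_mod_cast (mem_Ioc.1 hm).1
    have hm2 : (m : ℝ) ≤ v := by exact_mod_cast (mem_Ioc.1 hm).2
    have hn1 : (u : ℝ) < n := by exact_mod_cast (mem_Ioc.1 hn).1
    have hn2 : (n : ℝ) ≤ v := by exact_mod_cast (mem_Ioc.1 hn).2
    have key : ∀ k : ℕ, (x < (d * k : ℝ) ∧ (d * k : ℝ) ≤ y) ↔ (x / d < (k : ℝ) ∧ (k : ℝ) ≤ y / d) :=
      fun k => by rw [div_lt_iff₀' hd0, le_div_iff₀' hd0]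
    simp only [key]
    have hc := abs_chi4_le d
    by_cases hx : (u : ℝ) < x / d ∧ x / d < v
    · rw [if_pos hx]
      refine le_trans ?_ (le_add_of_nonneg_right (by split_ifs <;> norm_num))
      split_ifs <;> simp [hc]
    · by_cases hy : (u : ℝ) < y / d ∧ y / d < v
      · rw [if_pos hy]
        refine le_trans ?_ (le_add_of_nonneg_left (by split_ifs; norm_num))
        split_ifs <;> simp [hc]
      · have h2 : x / d < m ↔ x / d < n := by
          rw [not_and_or, not_lt, not_lt] at hx
          rcases hx with hx | hx
          · exact ⟨fun _ => by linarith, fun _ => by linarith⟩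
          · exact ⟨fun _ => by linarith, fun _ => by linarith⟩
        have h3 : m ≤ y / d ↔ n ≤ y / d := by
          rw [not_and_or, not_lt, not_lt] at hy
          rcases hy with hy | hy
          · exact ⟨fun _ => by linarith, fun _ => by linarith⟩
          · exact ⟨fun _ => by linarith, fun _ => by linarith⟩
        rw [if_neg hx, if_neg hy]
        simp only [h2, h3, sub_self, abs_zero, add_zero, le_refl]
  have h2 := abs_sub_abs_le_abs_sub (windowSum a m x y) (windowSum a n x y)
  linarith

lemma sum_block_indicator_le_one (J : Finset ℕ) (W : ℕ) (t : ℝ) :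
    ∑ j ∈ J, (if ((j * W : ℕ) : ℝ) < t ∧ t < ((j + 1) * W : ℕ) then (1 : ℝ) else 0) ≤ 1 := by
  rw [Finset.sum_boole]
  have : #{j ∈ J | ((j * W : ℕ) : ℝ) < t ∧ t < ((j + 1) * W : ℕ)} ≤ 1 := by
    rw [Finset.card_le_one]
    have key : ∀ i j : ℕ, t < ((i + 1) * W : ℕ) → ((j * W : ℕ) : ℝ) < t → j ≤ i := by
      intro i j h1 h2
      by_contra h3
      have h4 : (((i + 1) * W : ℕ) : ℝ) ≤ (j * W : ℕ) := by
        exact_mod_cast Nat.mul_le_mul_right W (by omega)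
      linarith
    intro i hi j hj
    have hi := (mem_filter.1 hi).2
    have hj := (mem_filter.1 hj).2
    exact le_antisymm (key j i hj.2 hi.1) (key i j hi.2 hj.1)
  exact_mod_cast this

lemma sum_windowJump_le (J : Finset ℕ) (a W : ℕ) (x y : ℝ) :
    ∑ j ∈ J, windowJump a (j * W) ((j + 1) * W) x y ≤ 2 * #a.divisors := by
  unfold windowJump
  rw [Finset.sum_comm]
  calc _ ≤ ∑ d ∈ a.divisors, (2 : ℝ) := by
        refine Finset.sum_le_sum fun d _ => ?_
        rw [Finset.sum_add_distrib]
        linarith [sum_block_indicator_le_one J W (x / d), sum_block_indicator_le_one J W (y / d)]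
    _ = _ := by rw [Finset.sum_const, nsmul_eq_mul]; ring

lemma sum_inv_mul_block_le {j W : ℕ} (hj : 1 ≤ j) (hW : 1 ≤ W) {F : ℕ → ℝ} {V μ : ℝ}
    (hF0 : ∀ n, 0 ≤ F n) (hV : 0 ≤ V)
    (hF : ∀ m ∈ Ioc (j * W) ((j + 1) * W), ∀ n ∈ Ioc (j * W) ((j + 1) * W), F m ≤ F n + V)
    {S : Finset ℕ} (hS : S ⊆ Ioc (j * W) ((j + 1) * W)) (hcard : (#S : ℝ) ≤ μ * W) :
    ∑ m ∈ S, (1 : ℝ) / m * F m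
      ≤ 2 * μ * (∑ n ∈ Ioc (j * W) ((j + 1) * W), (1 : ℝ) / n * F n) + μ * V / j := by
  set I := Ioc (j * W) ((j + 1) * W) with hI
  have hIc : #I = W := by rw [hI, Nat.card_Ioc]; rw [add_mul]; omega
  have hj0 : (0 : ℝ) < j := by exact_mod_cast hj
  have hj1 : (1 : ℝ) ≤ j := by exact_mod_cast hj
  have hW0 : (0 : ℝ) < W := by exact_mod_cast hW
  have hμ : 0 ≤ μ := by
    have : 0 ≤ μ * W := (Nat.cast_nonneg _).trans hcard
    exact nonneg_of_mul_nonneg_left this hW0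
  set T := ∑ n ∈ I, (1 : ℝ) / n * F n with hT
  have h1 : ∑ n ∈ I, F n ≤ 2 * (j * W) * T := by
    rw [hT, Finset.mul_sum]
    refine Finset.sum_le_sum fun n hn => ?_
    have hn' := mem_Ioc.1 hn
    have hn0 : (0 : ℝ) < n := by
      have : 0 < n := by omega
      exact_mod_cast this
    have h2 : (n : ℝ) ≤ 2 * (j * W) := by
      have h3 : (n : ℝ) ≤ (j + 1) * W := by exact_mod_cast hn'.2
      nlinarith
    rw [← mul_assoc, mul_one_div]
    exact le_mul_of_one_le_left (hF0 n) ((one_le_div hn0).2 h2)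
  have h2 : ∀ m ∈ S, F m ≤ (2 * (j * W) * T + W * V) / W := by
    intro m hm
    rw [le_div_iff₀ hW0]
    have h3 : ∑ n ∈ I, F m ≤ ∑ n ∈ I, (F n + V) := Finset.sum_le_sum fun n hn => hF m (hS hm) n hn
    rw [Finset.sum_const, Finset.sum_add_distrib, Finset.sum_const, hIc, nsmul_eq_mul,
      nsmul_eq_mul] at h3
    linarith
  have hT0 : 0 ≤ T := Finset.sum_nonneg fun n _ => mul_nonneg (by positivity) (hF0 n)
  calc _ ≤ ∑ m ∈ S, 1 / (j * W : ℝ) * ((2 * (j * W) * T + W * V) / W) := by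
        refine Finset.sum_le_sum fun m hm => mul_le_mul ?_ (h2 m hm) (hF0 m) (by positivity)
        have hm' := mem_Ioc.1 (hS hm)
        exact one_div_le_one_div_of_le (by positivity) (by exact_mod_cast hm'.1.le)
    _ = #S * (1 / (j * W : ℝ) * ((2 * (j * W) * T + W * V) / W)) := by
        rw [Finset.sum_const, nsmul_eq_mul]
    _ ≤ (μ * W) * (1 / (j * W : ℝ) * ((2 * (j * W) * T + W * V) / W)) :=
        mul_le_mul_of_nonneg_right hcard (by positivity)
    _ = _ := by field_simp

lemma sum_inv_mul_abs_windowSum_sparse_le (a : ℕ) {W Y M : ℕ} (hW : 1 ≤ W) (hM : Y + W ≤ M)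
    {μ : ℝ} (hμ : 0 ≤ μ) (p : ℕ → Prop) [DecidablePred p]
    (hp : ∀ j, 1 ≤ j → (#{m ∈ Ioc (j * W) ((j + 1) * W) | p m} : ℝ) ≤ μ * W) (x y : ℝ) :
    ∑ m ∈ Ioc (W * W) Y with p m, (1 : ℝ) / m * |windowSum a m x y|
      ≤ 2 * μ * (∑ n ∈ Icc 1 M, (1 : ℝ) / n * |windowSum a n x y|) + 2 * μ * #a.divisors / W := by
  have hW0 : (0 : ℝ) < W := by exact_mod_cast hW
  set J := (Y - 1) / W with hJ
  have hmap : ∀ Y', ∀ m ∈ Ioc (W * W) Y', Y' ≤ (J + 1) * W → (m - 1) / W ∈ Icc W J := by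
    intro Y' m hm hY
    have hm := mem_Ioc.1 hm
    rw [mem_Icc, Nat.le_div_iff_mul_le (by omega)]
    refine ⟨by omega, ?_⟩
    rw [← Nat.lt_add_one_iff, Nat.div_lt_iff_lt_mul (by omega)]
    have : 0 < W * W := by positivity
    omega
  have hYJ : Y ≤ (J + 1) * W := by
    have := Nat.lt_div_mul_add (a := Y - 1) (b := W) (by omega)
    rw [← hJ] at this
    rw [add_mul]
    omega
  have hJM : (J + 1) * W ≤ M := by
    have := Nat.div_mul_le_self (Y - 1) W
    rw [← hJ] at this
    rw [add_mul]
    omega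
  have hblock : ∀ m j, W ≤ j → (m - 1) / W = j → 1 ≤ m → m ∈ Ioc (j * W) ((j + 1) * W) := by
    rintro m j hj rfl hm
    have h1 := Nat.lt_div_mul_add (a := m - 1) (b := W) (by omega)
    have h2 := Nat.div_mul_le_self (m - 1) W
    rw [mem_Ioc, add_mul]
    omega
  rw [← Finset.sum_fiberwise_of_maps_to (g := fun m => (m - 1) / W) (t := Icc W J)
    (fun m hm => hmap Y m (mem_filter.1 hm).1 hYJ)]
  have h1 : ∀ j ∈ Icc W J, ∑ m ∈ (Ioc (W * W) Y).filter p with (m - 1) / W = j,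
      (1 : ℝ) / m * |windowSum a m x y|
      ≤ 2 * μ * (∑ n ∈ Ioc (j * W) ((j + 1) * W), (1 : ℝ) / n * |windowSum a n x y|)
        + μ / W * windowJump a (j * W) ((j + 1) * W) x y := by
    intro j hj
    have hj := mem_Icc.1 hj
    have hWj : (W : ℝ) ≤ j := by exact_mod_cast hj.1
    have hsub : ((Ioc (W * W) Y).filter p).filter (fun m => (m - 1) / W = j)
        ⊆ {m ∈ Ioc (j * W) ((j + 1) * W) | p m} := by
      intro m hm
      simp only [mem_filter] at hm
      have h2 := (mem_Ioc.1 hm.1.1).1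
      exact mem_filter.2 ⟨hblock m j hj.1 hm.2 (by omega), hm.1.2⟩
    have h3 := sum_inv_mul_block_le (j := j) (W := W) (by omega) hW
      (F := fun m => |windowSum a m x y|) (fun _ => abs_nonneg _)
      (windowJump_nonneg a (j * W) ((j + 1) * W) x y)
      (fun m hm n hn => abs_windowSum_le_add_windowJump a hm hn x y)
      (hsub.trans (filter_subset _ _))
      ((Nat.cast_le.2 (card_le_card hsub)).trans (hp j (by omega)))
    refine h3.trans (add_le_add le_rfl ?_)
    rw [div_mul_eq_mul_div]
    exact div_le_div_of_nonneg_left (mul_nonneg hμ (windowJump_nonneg _ _ _ _ _)) hW0 hWj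
  refine (Finset.sum_le_sum h1).trans ?_
  rw [Finset.sum_add_distrib, ← Finset.mul_sum, ← Finset.mul_sum]
  refine add_le_add (mul_le_mul_of_nonneg_left ?_ (by positivity)) ?_
  · have h2 := Finset.sum_fiberwise_of_maps_to (s := Ioc (W * W) ((J + 1) * W))
      (g := fun m => (m - 1) / W) (t := Icc W J) (fun m hm => hmap _ m hm le_rfl)
      (fun n => (1 : ℝ) / n * |windowSum a n x y|)
    calc _ = ∑ j ∈ Icc W J, ∑ n ∈ Ioc (W * W) ((J + 1) * W) with (n - 1) / W = j,
          (1 : ℝ) / n * |windowSum a n x y| := by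
          refine Finset.sum_congr rfl fun j hj => Finset.sum_congr ?_ fun _ _ => rfl
          have hj := mem_Icc.1 hj
          ext n
          simp only [mem_filter]
          constructor
          · intro hn
            have hn := mem_Ioc.1 hn
            have k1 : W * W ≤ j * W := Nat.mul_le_mul_right W hj.1
            have k2 : (j + 1) * W ≤ (J + 1) * W := Nat.mul_le_mul_right W (by omega)
            refine ⟨mem_Ioc.2 ⟨by omega, by omega⟩, ?_⟩
            rw [Nat.div_eq_iff (by omega)]
            rw [add_mul] at hn
            omega
          · rintro ⟨hn, hnj⟩
            exact hblock n j hj.1 hnj (by have := mem_Ioc.1 hn; omega)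
      _ = ∑ n ∈ Ioc (W * W) ((J + 1) * W), (1 : ℝ) / n * |windowSum a n x y| := h2
      _ ≤ _ := by
          refine Finset.sum_le_sum_of_subset_of_nonneg (fun n hn => ?_) fun _ _ _ => by positivity
          have hn := mem_Ioc.1 hn
          rw [mem_Icc]
          omega
  · calc _ ≤ μ / W * (2 * #a.divisors) :=
        mul_le_mul_of_nonneg_left (sum_windowJump_le _ _ _ _ _) (by positivity)
      _ = _ := by ring

/-- `n` has no prime factor up to `z`. -/
def IsRough (z n : ℕ) : Prop := ∀ p ∈ primesUpTo z, ¬ p ∣ n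

instance (z : ℕ) : DecidablePred (IsRough z) := fun n =>
  inferInstanceAs (Decidable (∀ p ∈ primesUpTo z, ¬ p ∣ n))

lemma IsRough.of_dvd {z m n : ℕ} (h : IsRough z n) (hmn : m ∣ n) : IsRough z m :=
  fun p hp hd => h p hp (hd.trans hmn)

/-- The length of the short intervals over which rough numbers are counted. -/
def blockLength (N : ℕ) : ℕ := ⌈Real.exp (Real.log N / 10)⌉₊

lemma le_smoothPart {a z k : ℕ} (ha : a ≠ 0) (hz : 1 ≤ z) (h : ∀ p, p.Prime → p ∣ a → p ≤ z)
    (hk : a.primeFactorsList.length ≤ k) : a ≤ z ^ k := by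
  calc a = a.primeFactorsList.prod := (Nat.prod_primeFactorsList ha).symm
    _ ≤ z ^ a.primeFactorsList.length := List.prod_le_pow_card _ _ fun p hp =>
        h p (Nat.prime_of_mem_primeFactorsList hp) (Nat.dvd_of_mem_primeFactorsList hp)
    _ ≤ _ := Nat.pow_le_pow_right hz hk

lemma abs_windowSum_one_le (m : ℕ) {x y : ℝ} (hy : 0 ≤ y) : |windowSum m 1 x y| ≤ y := by
  have h1 : |windowSum m 1 x y| ≤ #(m.divisors.filter fun d : ℕ => (d : ℝ) ≤ y) := by
    rw [windowSum, ← Finset.sum_boole]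
    refine (Finset.abs_sum_le_sum_abs _ _).trans (Finset.sum_le_sum fun d _ => ?_)
    rw [Nat.cast_one, mul_one]
    by_cases h : (d : ℝ) ≤ y
    · rw [if_pos h]
      split_ifs
      · exact abs_chi4_le d
      · simp
    · simp [h]
  have h2 : #(m.divisors.filter fun d : ℕ => (d : ℝ) ≤ y) ≤ #(Icc 1 ⌊y⌋₊) := by
    refine card_le_card fun d hd => ?_
    have hd := mem_filter.1 hd
    exact mem_Icc.2 ⟨Nat.pos_of_mem_divisors hd.1, Nat.le_floor hd.2⟩
  rw [Nat.card_Icc, Nat.add_sub_cancel] at h2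
  exact h1.trans ((Nat.cast_le.2 h2).trans (Nat.floor_le hy))

namespace Scale

variable {c : ℝ} {N R : ℕ}

lemma le_blockLength : Real.exp (Real.log N / 10) ≤ blockLength N := Nat.le_ceil _

lemma blockLength_le (h : Scale c N R) : (blockLength N : ℝ) ≤ 2 * Real.exp (Real.log N / 10) := by
  have h1 := Nat.ceil_lt_add_one (Real.exp_pos (Real.log N / 10)).le
  have h2 : 1 ≤ Real.exp (Real.log N / 10) := Real.one_le_exp (by linarith [h.log_ge])
  rw [blockLength]
  linarith

lemma blockLength_pos : 1 ≤ blockLength N := Nat.one_le_iff_ne_zero.2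
  (Nat.ceil_pos.2 (Real.exp_pos _)).ne'

lemma sieveLevel_pos (h : Scale c N R) : 1 ≤ sieveLevel N R := by
  rw [Nat.one_le_iff_ne_zero]
  intro h0
  have h1 := h.log_sieveLevel
  rw [h0, Nat.cast_zero, Real.log_zero] at h1
  have h2 : 0 < Real.log N / (400 * R) := by
    have := h.log_ge
    have := h.hR'
    positivity
  linarith

lemma sieveLevel_pow_le : (sieveLevel N R : ℝ) ^ R ≤ Real.exp (Real.log N / 100) := by
  rcases Nat.eq_zero_or_pos N with rfl | hN
  · have h1 := sieveLevel_le_exp (N := 0) (R := R)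
    simp only [Nat.cast_zero, Real.log_zero, zero_div, Real.exp_zero] at h1 ⊢
    exact pow_le_one₀ (Nat.cast_nonneg _) h1
  have hL : 0 ≤ Real.log N := Real.log_natCast_nonneg N
  calc (sieveLevel N R : ℝ) ^ R ≤ Real.exp (Real.log N / (100 * (R + 1))) ^ R :=
        pow_le_pow_left₀ (Nat.cast_nonneg _) sieveLevel_le_exp R
    _ = Real.exp (R * (Real.log N / (100 * (R + 1)))) := (Real.exp_nat_mul _ _).symm
    _ ≤ _ := by
        apply Real.exp_le_exp.2
        rw [← mul_div_assoc, div_le_div_iff₀ (by positivity) (by norm_num)]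
        nlinarith

lemma card_sifted_zmod_le (h : Scale c N R) {k : ℕ} (hk1 : 1 ≤ k) (hk3 : k ≤ 3) {n : ℕ} (hn : n ≠ 0)
    (hn6 : Real.log n ≤ 6 * Real.log N) (S : ∀ p : ℕ, Finset (ZMod p))
    (hS : ∀ p ∈ sievePrimes N R n, (S p).card = k) {X : ℕ}
    (hX : Real.exp (Real.log N / 10) ≤ X) (Q : ℕ → Prop) [DecidablePred Q]
    (hQ : ∀ m, Q m → ∀ p ∈ sievePrimes N R n, (m : ZMod p) ∉ S p) :
    (#{m ∈ Ioc 0 X | Q m} : ℝ) ≤ (R ^ 6 / Real.log N) ^ k * X := by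
  refine le_trans ?_ (h.card_sifted_le hk1 hk3 hn hn6
    (fun p => (S p).image ZMod.val) (fun p hp => ?_) hX)
  · rw [Nat.cast_le]
    refine card_le_card fun m hm => ?_
    have hm := mem_filter.1 hm
    refine mem_filter.2 ⟨hm.1, fun p hp hmem => hQ m hm.2 p hp ?_⟩
    obtain ⟨s, hs, hsm⟩ := mem_image.1 hmem
    have : NeZero p := ⟨(prime_of_mem (filter_subset _ _ hp)).ne_zero⟩
    have h1 : (m : ZMod p) = s := by
      rw [← ZMod.natCast_mod m p, ← hsm, ZMod.natCast_zmod_val]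
    rwa [h1]
  · have : NeZero p := ⟨(prime_of_mem (filter_subset _ _ hp)).ne_zero⟩
    refine ⟨fun r hr => ?_, ?_⟩
    · obtain ⟨s, -, rfl⟩ := mem_image.1 hr
      exact mem_range.2 (ZMod.val_lt s)
    · rw [card_image_of_injective _ (ZMod.val_injective p), hS p hp]

lemma card_rough_block_le (h : Scale c N R) (j : ℕ) :
    (#{m ∈ Ioc (j * blockLength N) ((j + 1) * blockLength N) | IsRough (sieveLevel N R) m} : ℝ)
      ≤ R ^ 6 / Real.log N * blockLength N := by
  set W := blockLength N
  have h1 := h.card_sifted_zmod_le le_rfl (by norm_num) one_ne_zero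
    (by rw [Nat.cast_one, Real.log_one]; linarith [h.log_ge])
    (fun p => {-((j * W : ℕ) : ZMod p)}) (fun p _ => card_singleton _) le_blockLength
    (fun i => IsRough (sieveLevel N R) (j * W + i)) (fun i hi p hp hmem => by
      refine hi p (filter_subset _ _ hp) ?_
      rw [mem_singleton] at hmem
      rw [← ZMod.natCast_eq_zero_iff, Nat.cast_add, hmem, add_neg_cancel])
  rw [pow_one] at h1
  refine le_trans (Nat.cast_le.2 ?_) h1
  refine (card_le_card (t := ({i ∈ Ioc 0 W | IsRough (sieveLevel N R) (j * W + i)}).image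
    (fun i => j * W + i)) fun m hm => ?_).trans card_image_le
  obtain ⟨hm1, hm2⟩ := mem_filter.1 hm
  rw [mem_Ioc, add_mul] at hm1
  refine mem_image.2 ⟨m - j * W, mem_filter.2 ⟨mem_Ioc.2 (by omega), ?_⟩, by omega⟩
  rwa [show j * W + (m - j * W) = m by omega]

/-- `p` is a prime exceeding the sieving level. -/
def _root_.IsLargePrime (z p : ℕ) : Prop := p.Prime ∧ z < p

instance _root_.instDecidablePredIsLargePrime (z : ℕ) : DecidablePred (IsLargePrime z) := fun p =>
  inferInstanceAs (Decidable (p.Prime ∧ z < p))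

lemma _root_.IsLargePrime.cast_ne_zero {N R n p q : ℕ} (hq : IsLargePrime (sieveLevel N R) q)
    (hp : p ∈ sievePrimes N R n) : (q : ZMod p) ≠ 0 := by
  obtain ⟨h1, h2⟩ := mem_primesUpTo.1 (filter_subset _ _ hp)
  intro h0
  rw [ZMod.natCast_eq_zero_iff, Nat.prime_dvd_prime_iff_eq h1 hq.1] at h0
  have := hq.2
  omega

lemma _root_.IsRough.cast_ne_zero {N R n p b : ℕ} (hb : IsRough (sieveLevel N R) b)
    (hp : p ∈ sievePrimes N R n) : (b : ZMod p) ≠ 0 := fun h0 =>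
  hb p (filter_subset _ _ hp) ((ZMod.natCast_eq_zero_iff _ _).1 h0)

lemma card_large_prime_le (h : Scale c N R) {α X : ℕ} (hα : 1 ≤ α) (hαN : α ≤ N)
    (hX : Real.exp (Real.log N / 10) ≤ X) :
    (#{b ∈ Ioc 0 X | IsRough (sieveLevel N R) b ∧ IsLargePrime (sieveLevel N R) (α * b + 1)} : ℝ)
      ≤ (R ^ 6 / Real.log N) ^ 2 * X := by
  have hα0 : (0 : ℝ) < α := by exact_mod_cast hα
  refine h.card_sifted_zmod_le (by norm_num) (by norm_num) (n := α) (by omega) ?_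
    (fun p => {0, -(α : ZMod p)⁻¹}) (fun p hp => ?_) hX _ (fun b hb p hp hmem => ?_)
  · have := Real.log_le_log hα0 (Nat.cast_le.2 hαN)
    linarith [h.log_ge]
  · have hpp := (mem_primesUpTo.1 (filter_subset _ _ hp)).1
    have : Fact p.Prime := ⟨hpp⟩
    have hαp : (α : ZMod p) ≠ 0 := by
      rw [Ne, ZMod.natCast_eq_zero_iff]; exact (mem_filter.1 hp).2
    exact card_pair (neg_ne_zero.2 (inv_ne_zero hαp)).symm
  · have hpp := (mem_primesUpTo.1 (filter_subset _ _ hp)).1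
    have : Fact p.Prime := ⟨hpp⟩
    have hαp : (α : ZMod p) ≠ 0 := by
      rw [Ne, ZMod.natCast_eq_zero_iff]; exact (mem_filter.1 hp).2
    rw [mem_insert, mem_singleton] at hmem
    rcases hmem with h0 | h0
    · exact hb.1.cast_ne_zero hp h0
    · refine hb.2.cast_ne_zero hp ?_
      push_cast
      rw [h0]
      field_simp
      ring

lemma card_large_prime_pair_le (h : Scale c N R) {K : ℕ} (hK : 2 ≤ K) (hKN : K ≤ N) {α X : ℕ}
    (hα : 1 ≤ α) (hαN : α ≤ N) (hX : Real.exp (Real.log N / 10) ≤ X) :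
    (#{b ∈ Ioc 0 X | IsRough (sieveLevel N R) b ∧ IsLargePrime (sieveLevel N R) (α * b + 1) ∧
        IsLargePrime (sieveLevel N R) (K - (α * b + 1))} : ℝ)
      ≤ (R ^ 6 / Real.log N) ^ 3 * X := by
  have hα0 : (0 : ℝ) < α := by exact_mod_cast hα
  have hn0 : α * (K * (K - 1)) ≠ 0 := by
    refine mul_ne_zero (by omega) (mul_ne_zero (by omega) (by omega))
  have hcast : ∀ p ∈ sievePrimes N R (α * (K * (K - 1))), (α : ZMod p) ≠ 0 ∧ (K : ZMod p) ≠ 0 ∧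
      (K : ZMod p) - 1 ≠ 0 := by
    intro p hp
    have h1 := (mem_filter.1 hp).2
    refine ⟨?_, ?_, ?_⟩
    · rw [Ne, ZMod.natCast_eq_zero_iff]
      exact fun h2 => h1 (h2.mul_right _)
    · rw [Ne, ZMod.natCast_eq_zero_iff]
      exact fun h2 => h1 ((h2.mul_right _).mul_left _)
    · rw [← Nat.cast_one, ← Nat.cast_sub (by omega), Ne, ZMod.natCast_eq_zero_iff]
      exact fun h2 => h1 ((h2.mul_left _).mul_left _)
  refine h.card_sifted_zmod_le (by norm_num) (by norm_num) hn0 ?_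
    (fun p => {0, -(α : ZMod p)⁻¹, ((K : ZMod p) - 1) * (α : ZMod p)⁻¹}) (fun p hp => ?_) hX _
    (fun b hb p hp hmem => ?_)
  · have h1 : α * (K * (K - 1)) ≤ N ^ 3 := by
      calc _ ≤ N * (N * N) := Nat.mul_le_mul hαN (Nat.mul_le_mul hKN (by omega))
        _ = N ^ 3 := by ring
    have h2 : Real.log ((α * (K * (K - 1)) : ℕ) : ℝ) ≤ Real.log ((N ^ 3 : ℕ) : ℝ) :=
      Real.log_le_log (by exact_mod_cast Nat.pos_of_ne_zero hn0) (Nat.cast_le.2 h1)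
    rw [Nat.cast_pow, Real.log_pow] at h2
    push_cast at h2 ⊢
    linarith [h.log_ge]
  · have hpp := (mem_primesUpTo.1 (filter_subset _ _ hp)).1
    have : Fact p.Prime := ⟨hpp⟩
    obtain ⟨k1, k2, k3⟩ := hcast p hp
    have k4 := inv_ne_zero k1
    refine card_eq_three.2 ⟨_, _, _, (neg_ne_zero.2 k4).symm, (mul_ne_zero k3 k4).symm, ?_, rfl⟩
    intro h0
    refine mul_ne_zero k2 k4 ?_
    linear_combination -h0
  · have hpp := (mem_primesUpTo.1 (filter_subset _ _ hp)).1
    have : Fact p.Prime := ⟨hpp⟩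
    obtain ⟨k1, k2, k3⟩ := hcast p hp
    simp only [mem_insert, mem_singleton] at hmem
    rcases hmem with h0 | h0 | h0
    · exact hb.1.cast_ne_zero hp h0
    · refine hb.2.1.cast_ne_zero hp ?_
      push_cast
      rw [h0]
      field_simp
      ring
    · have hle : α * b + 1 ≤ K := by
        have := hb.2.2.1.pos
        omega
      refine hb.2.2.cast_ne_zero hp ?_
      rw [Nat.cast_sub hle]
      push_cast
      rw [h0]
      field_simp
      ring

end Scale

/-- An upper bound for the smooth parts of the integers up to `N` with few prime factors. -/
def smoothBound (N : ℕ) : ℕ := ⌊Real.exp (Real.log N / 100)⌋₊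

lemma abs_windowSum_mul_le {a b : ℕ} (hab : a.Coprime b) (x : ℝ) {y : ℝ} :
    |windowSum (a * b) 1 x y|
      ≤ ∑ d ∈ Icc 1 ⌊y⌋₊ with d ∣ b, |windowSum a d x y| := by
  by_cases hb : b = 0
  · rw [hb, mul_zero, windowSum, Nat.divisors_zero, Finset.sum_empty, abs_zero]
    exact Finset.sum_nonneg fun _ _ => abs_nonneg _
  rw [mul_comm, windowSum_mul_of_coprime hab.symm]
  calc _ ≤ ∑ d ∈ b.divisors, |windowSum a d x y| := by
        refine (Finset.abs_sum_le_sum_abs _ _).trans (Finset.sum_le_sum fun d _ => ?_)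
        rw [abs_mul, mul_one]
        exact mul_le_of_le_one_left (abs_nonneg _) (abs_chi4_le d)
    _ = ∑ d ∈ b.divisors with d ≤ ⌊y⌋₊, |windowSum a d x y| := by
        symm
        refine Finset.sum_subset (filter_subset _ _) fun d hd hdy => ?_
        have hd0 := Nat.pos_of_mem_divisors hd
        have hy : y < d := by
          by_contra hy
          exact hdy (mem_filter.2 ⟨hd, Nat.le_floor (not_lt.1 hy)⟩)
        rw [abs_eq_zero]
        refine Finset.sum_eq_zero fun e he => if_neg fun hw => ?_
        have he1 : (1 : ℝ) ≤ e := by exact_mod_cast Nat.pos_of_mem_divisors he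
        have hd1 : (0 : ℝ) < d := by exact_mod_cast hd0
        nlinarith [hw.2]
    _ ≤ _ := by
        refine Finset.sum_le_sum_of_subset_of_nonneg (fun d hd => ?_) fun _ _ _ => abs_nonneg _
        have hd := mem_filter.1 hd
        exact mem_filter.2 ⟨mem_Icc.2 ⟨Nat.pos_of_mem_divisors hd.1, hd.2⟩,
          Nat.dvd_of_mem_divisors hd.1⟩

namespace Scale

variable {c : ℝ} {N R : ℕ}

lemma smoothBound_le : (smoothBound N : ℝ) ≤ Real.exp (Real.log N / 100) :=
  Nat.floor_le (Real.exp_pos _).le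

lemma smoothBound_le_self (h : Scale c N R) : smoothBound N ≤ N := by
  have : (smoothBound N : ℝ) ≤ N := by
    refine smoothBound_le.trans ?_
    rw [← h.exp_log, Real.log_exp]
    exact Real.exp_le_exp.2 (by linarith [h.log_ge])
  exact_mod_cast this

lemma exp_mul_log_ge (h : Scale c N R) {t : ℝ} (ht : 1 / 100 ≤ t) :
    10 * Real.log N ^ 2 ≤ Real.exp (t * Real.log N) := by
  have hL := h.log_ge
  have h1 := Real.quadratic_le_exp_of_nonneg (x := Real.log N / 400) (by linarith)
  have h2 : Real.exp (Real.log N / 400) ^ 4 ≤ Real.exp (t * Real.log N) := by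
    rw [← Real.exp_nat_mul]
    apply Real.exp_le_exp.2
    push_cast
    nlinarith
  have h3 : Real.log N ≤ Real.exp (Real.log N / 400) := by nlinarith
  have h4 : Real.log N ^ 4 ≤ Real.exp (Real.log N / 400) ^ 4 :=
    pow_le_pow_left₀ (by linarith) h3 4
  have h5 : 10 * Real.log N ^ 2 ≤ Real.log N ^ 2 * Real.log N ^ 2 :=
    mul_le_mul_of_nonneg_right (by nlinarith) (by positivity)
  linarith [show Real.log N ^ 2 * Real.log N ^ 2 = Real.log N ^ 4 by ring]

lemma sum_abs_windowSum_le_of_count (h : Scale c N R) {κ : ℝ} (P : ℕ → Prop)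
    [DecidablePred P]
    (hP : ∀ α X : ℕ, 1 ≤ α → α ≤ N → Real.exp (Real.log N / 10) ≤ X →
      (#{b ∈ Ioc 0 X | IsRough (sieveLevel N R) b ∧ P (α * b)} : ℝ) ≤ κ * X)
    (hκ : 0 ≤ κ) (x : ℝ) {y : ℝ} (hy0 : 0 ≤ y) (hy : y ≤ Real.exp (3 / 5 * Real.log N)) :
    ∑ m ∈ Icc 1 N with P m ∧ m.primeFactorsList.length ≤ R, |windowSum m 1 x y|
      ≤ κ * N * ∑ a ∈ Icc 1 (smoothBound N), (1 : ℝ) / a *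
        ∑ d ∈ Icc 1 ⌊y⌋₊ with IsRough (sieveLevel N R) d, (1 : ℝ) / d * |windowSum a d x y| := by
  set z := sieveLevel N R with hz
  set A := smoothBound N with hA
  have hL := h.log_ge
  set T := {t ∈ Icc 1 A ×ˢ Icc 1 N | (∀ p ∈ t.1.primeFactors, p ≤ z) ∧ IsRough z t.2 ∧
    t.1 * t.2 ≤ N ∧ P (t.1 * t.2)} with hT
  have hrough : ∀ b, IsRough z b → ∀ p, p.Prime → p ∣ b → ¬ p ≤ z := fun b hb p hp hd hpz =>
    hb p (mem_primesUpTo.2 ⟨hp, hpz⟩) hd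
  have hcover : ∑ m ∈ Icc 1 N with P m ∧ m.primeFactorsList.length ≤ R, |windowSum m 1 x y|
      ≤ ∑ t ∈ T, |windowSum (t.1 * t.2) 1 x y| := by
    refine sum_le_sum_of_cover _ T (fun t => t.1 * t.2) (fun m => |windowSum m 1 x y|)
      (fun _ _ => abs_nonneg _) fun m hm => ?_
    obtain ⟨hm1, hPm, hmR⟩ := mem_filter.1 hm
    have hm1 := mem_Icc.1 hm1
    obtain ⟨a, b, hab, ha, hb⟩ := exists_mul_eq_prime_split (fun p => p ≤ z)
      (show m ≠ 0 by omega)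
    have ha0 : a ≠ 0 := by rintro rfl; omega
    have hb0 : b ≠ 0 := by rintro rfl; omega
    have haR : a.primeFactorsList.length ≤ R := by
      have h1 := (Nat.perm_primeFactorsList_mul ha0 hb0).length_eq
      rw [List.length_append, ← hab] at h1
      omega
    have haA : a ≤ A := by
      refine Nat.le_floor (le_trans ?_ (sieveLevel_pow_le (N := N) (R := R)))
      exact_mod_cast le_smoothPart ha0 h.sieveLevel_pos ha haR
    refine ⟨(a, b), mem_filter.2 ⟨mem_product.2 ⟨mem_Icc.2 ⟨by omega, haA⟩,
      mem_Icc.2 ⟨by omega, ?_⟩⟩, fun p hp => ha p (Nat.prime_of_mem_primeFactors hp)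
      (Nat.dvd_of_mem_primeFactors hp), fun p hp hd => ?_, hab ▸ hm1.2, hab ▸ hPm⟩, hab.symm⟩
    · exact (Nat.le_of_dvd (by omega) ⟨a, by rw [hab]; ring⟩).trans hm1.2
    · exact hb p (prime_of_mem hp) hd (mem_primesUpTo.1 hp).2
  refine hcover.trans ?_
  calc ∑ t ∈ T, |windowSum (t.1 * t.2) 1 x y|
      ≤ ∑ t ∈ T, ∑ d ∈ Icc 1 ⌊y⌋₊ with d ∣ t.2, |windowSum t.1 d x y| := by
        refine Finset.sum_le_sum fun t ht => ?_
        have ht0 := (mem_Icc.1 (mem_product.1 (mem_filter.1 ht).1).1).1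
        have ht := (mem_filter.1 ht).2
        exact abs_windowSum_mul_le (coprime_of_prime_split (Q := fun p => p ≤ z)
          (fun p hp hd => ht.1 p (Nat.mem_primeFactors.2 ⟨hp, hd, by have := ht0; omega⟩))
          (hrough t.2 ht.2.1)) x
    _ = ∑ a ∈ Icc 1 A, ∑ b ∈ Icc 1 N, if (∀ p ∈ a.primeFactors, p ≤ z) ∧ IsRough z b ∧
          a * b ≤ N ∧ P (a * b) then ∑ d ∈ Icc 1 ⌊y⌋₊ with d ∣ b, |windowSum a d x y| else 0 := by
        rw [hT, Finset.sum_filter, Finset.sum_product]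
    _ ≤ ∑ a ∈ Icc 1 A, ∑ b ∈ Icc 1 N, ∑ d ∈ Icc 1 ⌊y⌋₊,
          if d ∣ b ∧ IsRough z b ∧ a * b ≤ N ∧ P (a * b) then |windowSum a d x y| else 0 := by
        refine Finset.sum_le_sum fun a _ => Finset.sum_le_sum fun b _ => ?_
        split_ifs with h1
        · rw [Finset.sum_filter]
          refine Finset.sum_le_sum fun d _ => ?_
          simp only [h1.2, and_true, le_refl]
        · exact Finset.sum_nonneg fun d _ => by split_ifs <;> positivity
    _ = ∑ a ∈ Icc 1 A, ∑ d ∈ Icc 1 ⌊y⌋₊,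
          #{b ∈ Icc 1 N | d ∣ b ∧ IsRough z b ∧ a * b ≤ N ∧ P (a * b)} * |windowSum a d x y| := by
        refine Finset.sum_congr rfl fun a _ => ?_
        rw [Finset.sum_comm]
        refine Finset.sum_congr rfl fun d _ => ?_
        rw [← Finset.sum_filter, Finset.sum_const, nsmul_eq_mul]
    _ ≤ ∑ a ∈ Icc 1 A, ∑ d ∈ Icc 1 ⌊y⌋₊,
          (if IsRough z d then κ * N * (1 / a * (1 / d)) else 0) * |windowSum a d x y| := by
        refine Finset.sum_le_sum fun a ha => Finset.sum_le_sum fun d hd =>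
          mul_le_mul_of_nonneg_right ?_ (abs_nonneg _)
        obtain ⟨ha1, haA⟩ := mem_Icc.1 ha
        obtain ⟨hd1, hdy⟩ := mem_Icc.1 hd
        split_ifs with hdr
        · have hW : blockLength N * (a * d) ≤ N := by
            have h1 : (d : ℝ) ≤ Real.exp (3 / 5 * Real.log N) :=
              ((Nat.le_floor_iff hy0).1 hdy).trans hy
            have h2 : (a : ℝ) ≤ Real.exp (Real.log N / 100) := (Nat.cast_le.2 haA).trans smoothBound_le
            have h3 : (2 : ℝ) ≤ Real.exp (1 / 10 * Real.log N) := by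
              nlinarith [h.exp_mul_log_ge (t := 1 / 10) (by norm_num)]
            have h4 : ((blockLength N * (a * d) : ℕ) : ℝ) ≤ N := by
              push_cast
              calc (blockLength N : ℝ) * (a * d)
                  ≤ (2 * Real.exp (Real.log N / 10)) *
                    (Real.exp (Real.log N / 100) * Real.exp (3 / 5 * Real.log N)) := by
                    have := h.blockLength_le
                    gcongr
                _ ≤ (Real.exp (1 / 10 * Real.log N) * Real.exp (Real.log N / 10)) *
                    (Real.exp (Real.log N / 100) * Real.exp (3 / 5 * Real.log N)) := by
                    gcongr
                _ = Real.exp (81 / 100 * Real.log N) := by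
                    rw [← Real.exp_add, ← Real.exp_add, ← Real.exp_add]
                    congr 1; ring
                _ ≤ Real.exp (Real.log N) := Real.exp_le_exp.2 (by linarith)
                _ = N := h.exp_log
            exact_mod_cast h4
          have had : 1 ≤ a * d := Nat.mul_pos ha1 hd1
          have hadN : a * d ≤ N := (Nat.le_mul_of_pos_left _ blockLength_pos).trans hW
          have hX : Real.exp (Real.log N / 10) ≤ (N / (a * d) : ℕ) :=
            le_blockLength.trans (Nat.cast_le.2 ((Nat.le_div_iff_mul_le had).2 hW))
          have hsub : {b ∈ Icc 1 N | d ∣ b ∧ IsRough z b ∧ a * b ≤ N ∧ P (a * b)}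
              ⊆ {b ∈ Ioc 0 (N / (a * d)) | IsRough z b ∧ P (a * d * b)}.image (fun b => d * b) := by
            intro b hb
            obtain ⟨hb1, ⟨e, rfl⟩, hbr, hbN, hPb⟩ := mem_filter.1 hb
            have he : 0 < e := Nat.pos_of_ne_zero (by rintro rfl; simp at hb1)
            refine mem_image.2 ⟨e, mem_filter.2 ⟨mem_Ioc.2 ⟨he, ?_⟩, hbr.of_dvd ⟨d, by ring⟩, ?_⟩, rfl⟩
            · rw [Nat.le_div_iff_mul_le had]
              calc e * (a * d) = a * (d * e) := by ring
                _ ≤ N := hbN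
            · rwa [mul_assoc]
          calc (#{b ∈ Icc 1 N | d ∣ b ∧ IsRough z b ∧ a * b ≤ N ∧ P (a * b)} : ℝ)
              ≤ #{b ∈ Ioc 0 (N / (a * d)) | IsRough z b ∧ P (a * d * b)} :=
                Nat.cast_le.2 ((card_le_card hsub).trans card_image_le)
            _ ≤ κ * (N / (a * d) : ℕ) := hP (a * d) _ had hadN hX
            _ ≤ κ * (N / (a * d : ℕ)) := mul_le_mul_of_nonneg_left Nat.cast_div_le hκ
            _ = _ := by push_cast; rw [one_div_mul_one_div]; ring
        · rw [Finset.filter_eq_empty_iff.2, card_empty, Nat.cast_zero]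
          exact fun b _ hb => hdr (hb.2.1.of_dvd hb.1)
    _ = _ := by
        rw [Finset.mul_sum]
        refine Finset.sum_congr rfl fun a _ => ?_
        rw [Finset.sum_filter, Finset.mul_sum, Finset.mul_sum]
        refine Finset.sum_congr rfl fun d _ => ?_
        split_ifs <;> ring

lemma sum_card_divisors_many_primes_le (h : Scale c N R) :
    ∑ m ∈ Icc 1 N with ¬ m.primeFactorsList.length ≤ R, (#m.divisors : ℝ) ≤ N / Real.log N ^ 3 := by
  have hL := h.log_ge
  have hR := h.hR'
  have h1 := sum_card_divisors_mul_pow_le (primesUpTo N) (fun p hp => prime_of_mem hp) (Icc 1 N)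
    (fun a ha => by
      have h2 := mem_Icc.1 ha
      exact ⟨by omega, fun p hp hd => mem_primesUpTo.2 ⟨hp, (Nat.le_of_dvd (by omega) hd).trans h2.2⟩⟩)
  have h2 : ∑ m ∈ Icc 1 N with ¬ m.primeFactorsList.length ≤ R, (#m.divisors : ℝ)
      ≤ N / (5 / 4) ^ R * ∑ a ∈ Icc 1 N, #a.divisors * (5 / 4 : ℝ) ^ a.primeFactorsList.length / a := by
    rw [Finset.mul_sum]
    refine le_trans (Finset.sum_le_sum fun m hm => ?_)
      (Finset.sum_le_sum_of_subset_of_nonneg (filter_subset _ _) fun _ _ _ => by positivity)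
    obtain ⟨hm1, hm2⟩ := mem_filter.1 hm
    have hm1 := mem_Icc.1 hm1
    have hm0 : (0 : ℝ) < m := by exact_mod_cast (by omega : 0 < m)
    have hmN : (m : ℝ) ≤ N := by exact_mod_cast hm1.2
    have h3 : (5 / 4 : ℝ) ^ R ≤ (5 / 4) ^ m.primeFactorsList.length :=
      pow_le_pow_right₀ (by norm_num) (by omega)
    rw [div_mul_div_comm, le_div_iff₀ (by positivity)]
    calc (#m.divisors : ℝ) * ((5 / 4) ^ R * m)
        ≤ #m.divisors * ((5 / 4) ^ m.primeFactorsList.length * N) := by gcongr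
      _ = _ := by ring
  have h3 : Real.exp (5 / 2 * primeRecip N + 21) ≤ R ^ 6 * Real.log N ^ 3 := by
    rw [Real.exp_add]
    have h4 : Real.exp (5 / 2 * primeRecip N) ≤ (R * Real.log N) ^ 3 := by
      calc _ ≤ Real.exp ((3 : ℕ) * primeRecip N) := Real.exp_le_exp.2
            (mul_le_mul_of_nonneg_right (by norm_num) (primeRecip_nonneg N))
        _ = Real.exp (primeRecip N) ^ 3 := Real.exp_nat_mul _ _
        _ ≤ _ := pow_le_pow_left₀ (Real.exp_pos _).le (h.exp_primeRecip h.three_le le_rfl) 3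
    calc _ ≤ (R * Real.log N) ^ 3 * (R : ℝ) ^ 3 :=
          mul_le_mul h4 h.exp_twentyone_le (Real.exp_pos _).le (by positivity)
      _ = _ := by ring
  have h4 : Real.log N ^ 7 ≤ (5 / 4) ^ R := by
    have h5 : (1 / 5 : ℝ) ≤ Real.log (5 / 4) := by
      have := Real.one_sub_inv_le_log_of_pos (show (0 : ℝ) < 5 / 4 by norm_num)
      norm_num at this ⊢
      exact this
    rw [← Real.log_le_log_iff (by positivity) (by positivity), Real.log_pow, Real.log_pow]
    have h6 := h.hll
    have h7 := h.loglog_nonneg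
    push_cast
    nlinarith
  have h5 : (R : ℝ) ^ 6 ≤ Real.log N := h.pow_le (by norm_num)
  refine h2.trans ?_
  calc _ ≤ N / (5 / 4) ^ R * (R ^ 6 * Real.log N ^ 3) :=
        mul_le_mul_of_nonneg_left (h1.trans h3) (by positivity)
    _ ≤ N / Real.log N ^ 7 * (Real.log N * Real.log N ^ 3) := by gcongr
    _ = _ := by field_simp

end Scale

lemma windowSum_zero_eq_rSum {a d : ℕ} (hd : 1 ≤ d) {y : ℝ} (h : (a * d : ℝ) ≤ y) :
    windowSum a d 0 y = rSum a := by
  refine Finset.sum_congr rfl fun e he => if_pos ⟨?_, ?_⟩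
  · have := Nat.pos_of_mem_divisors he
    positivity
  · refine le_trans ?_ h
    have h1 : (e : ℝ) ≤ a := by exact_mod_cast Nat.divisor_le he
    gcongr

lemma windowSum_eq_zero_of_le {a d : ℕ} {x y : ℝ} (h : (a * d : ℝ) ≤ x) :
    windowSum a d x y = 0 := by
  refine Finset.sum_eq_zero fun e he => if_neg fun hw => ?_
  have h1 : (e : ℝ) ≤ a := by exact_mod_cast Nat.divisor_le he
  have h2 : (e * d : ℝ) ≤ a * d := by gcongr
  linarith [hw.1]

namespace Scale

variable {c : ℝ} {N R : ℕ}

lemma smoothBound_mul_blockLength_sq_le (h : Scale c N R) :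
    (smoothBound N * (blockLength N * blockLength N) : ℝ) ≤ Real.exp (2 / 5 * Real.log N) := by
  have h1 : (4 : ℝ) ≤ Real.exp (1 / 10 * Real.log N) := by
    nlinarith [h.exp_mul_log_ge (t := 1 / 10) (by norm_num), h.log_ge]
  have h2 := h.blockLength_le
  have h3 := smoothBound_le (N := N)
  calc _ ≤ Real.exp (Real.log N / 100) *
        ((2 * Real.exp (Real.log N / 10)) * (2 * Real.exp (Real.log N / 10))) := by gcongr
    _ = 4 * (Real.exp (Real.log N / 100) *
        (Real.exp (Real.log N / 10) * Real.exp (Real.log N / 10))) := by ring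
    _ ≤ Real.exp (1 / 10 * Real.log N) * (Real.exp (Real.log N / 100) *
        (Real.exp (Real.log N / 10) * Real.exp (Real.log N / 10))) :=
        mul_le_mul_of_nonneg_right h1 (by positivity)
    _ = Real.exp (31 / 100 * Real.log N) := by
        rw [← Real.exp_add, ← Real.exp_add, ← Real.exp_add]; congr 1; ring
    _ ≤ _ := Real.exp_le_exp.2 (by linarith [h.log_ge])

lemma smoothBound_pos (h : Scale c N R) : 1 ≤ smoothBound N :=
  Nat.le_floor (by rw [Nat.cast_one]; exact Real.one_le_exp (by linarith [h.log_ge]))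

lemma blockLength_sq_le (h : Scale c N R) : blockLength N * blockLength N ≤ N := by
  have h1 := h.smoothBound_mul_blockLength_sq_le
  have h2 : Real.exp (2 / 5 * Real.log N) ≤ Real.exp (Real.log N) :=
    Real.exp_le_exp.2 (by linarith [h.log_ge])
  rw [h.exp_log] at h2
  have h3 : smoothBound N * (blockLength N * blockLength N) ≤ N := by exact_mod_cast h1.trans h2
  exact (Nat.le_mul_of_pos_left _ h.smoothBound_pos).trans h3

lemma sum_inv_rough_le (h : Scale c N R) :
    ∑ d ∈ Icc 1 (blockLength N * blockLength N) with IsRough (sieveLevel N R) d, (1 : ℝ) / d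
      ≤ R ^ 5 := by
  have hR := h.hR'
  have hL := h.log_ge
  refine (sum_inv_smooth_le (s := roughPrimes (sieveLevel N R) N)
    (fun p hp => prime_of_mem_roughPrimes hp) _ fun d hd => ?_).trans
    ((h.exp_roughPrimes_le' h.sieveLevel_pos h.sieveLevel_le).trans ?_)
  · obtain ⟨hd1, hd2⟩ := mem_filter.1 hd
    have hd1 := mem_Icc.1 hd1
    have := h.blockLength_sq_le
    exact ⟨by omega, (primeFactors_subset_roughPrimes_iff (by omega) (by omega)).2 hd2⟩
  · have h1 := h.log_sieveLevel
    have hz : (0 : ℝ) < sieveLevel N R := by exact_mod_cast h.sieveLevel_pos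
    have h2 : Real.log (sieveLevel N R) ≤ Real.log (sieveLevel N R + 1) :=
      Real.log_le_log hz (by linarith)
    have h4 : 0 < Real.log N / (400 * R) := by positivity
    have h3 : Real.log N / Real.log (sieveLevel N R + 1) ≤ 400 * R := by
      rw [div_le_iff₀ (by linarith)]
      have h5 : Real.log N / (400 * R) ≤ Real.log (sieveLevel N R + 1) := h1.trans h2
      rw [div_le_iff₀ (by positivity)] at h5
      linarith
    calc _ ≤ (R : ℝ) ^ 3 * (400 * R) := mul_le_mul_of_nonneg_left h3 (by positivity)
      _ ≤ (R : ℝ) ^ 3 * (R * R) := by gcongr; linarith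
      _ = _ := by ring

lemma sum_rough_abs_windowSum_le (h : Scale c N R) (x : ℝ) {y : ℝ} (hy0 : 0 ≤ y)
    (hy : y ≤ Real.exp (3 / 5 * Real.log N)) :
    ∑ a ∈ Icc 1 (smoothBound N), (1 : ℝ) / a *
        ∑ d ∈ Icc 1 ⌊y⌋₊ with IsRough (sieveLevel N R) d, (1 : ℝ) / d * |windowSum a d x y|
      ≤ (∑ a ∈ Icc 1 (smoothBound N), (1 : ℝ) / a *
          ∑ d ∈ Icc 1 (blockLength N * blockLength N) with IsRough (sieveLevel N R) d,
            (1 : ℝ) / d * |windowSum a d x y|)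
        + 2 * (R ^ 6 / Real.log N) * (∑ a ∈ Icc 1 (smoothBound N), (1 : ℝ) / a *
          ∑ n ∈ Icc 1 N, (1 : ℝ) / n * |windowSum a n x y|)
        + 1 / Real.log N := by
  have hL := h.log_ge
  set z := sieveLevel N R
  set W := blockLength N with hW
  set A := smoothBound N with hA
  set μ := (R : ℝ) ^ 6 / Real.log N with hμ
  have hμ0 : 0 ≤ μ := by positivity
  have hμ1 : μ ≤ 1 := (div_le_one (by linarith)).2 (h.pow_le (by norm_num))
  have hW0 : (0 : ℝ) < W := by exact_mod_cast blockLength_pos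
  have hYW : ⌊y⌋₊ + W ≤ N := by
    have h1 : (⌊y⌋₊ : ℝ) ≤ Real.exp (9 / 10 * Real.log N) :=
      (Nat.floor_le hy0).trans (hy.trans (Real.exp_le_exp.2 (by linarith)))
    have h2 : (W : ℝ) ≤ 2 * Real.exp (9 / 10 * Real.log N) :=
      h.blockLength_le.trans (mul_le_mul_of_nonneg_left (Real.exp_le_exp.2 (by linarith))
        (by norm_num))
    have h3 : (3 : ℝ) ≤ Real.exp (1 / 10 * Real.log N) := by
      nlinarith [h.exp_mul_log_ge (t := 1 / 10) (by norm_num)]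
    have h4 : 3 * Real.exp (9 / 10 * Real.log N) ≤ N := by
      calc _ ≤ Real.exp (1 / 10 * Real.log N) * Real.exp (9 / 10 * Real.log N) :=
            mul_le_mul_of_nonneg_right h3 (Real.exp_pos _).le
        _ = N := by rw [← Real.exp_add, ← h.exp_log, Real.log_exp]; congr 1; ring
    have h5 : ((⌊y⌋₊ + W : ℕ) : ℝ) ≤ N := by push_cast; linarith
    exact_mod_cast h5
  have h1 : ∀ a ∈ Icc 1 A, (1 : ℝ) / a *
      ∑ d ∈ Icc 1 ⌊y⌋₊ with IsRough z d, (1 : ℝ) / d * |windowSum a d x y|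
      ≤ (1 : ℝ) / a * (∑ d ∈ Icc 1 (W * W) with IsRough z d, (1 : ℝ) / d * |windowSum a d x y|)
        + 2 * μ * ((1 : ℝ) / a * ∑ n ∈ Icc 1 N, (1 : ℝ) / n * |windowSum a n x y|) + 2 / W := by
    intro a ha
    have ha1 := (mem_Icc.1 ha).1
    have ha0 : (0 : ℝ) < a := by exact_mod_cast ha1
    have hsplit : ∑ d ∈ Icc 1 ⌊y⌋₊ with IsRough z d, (1 : ℝ) / d * |windowSum a d x y|
        ≤ ∑ d ∈ Icc 1 (W * W) with IsRough z d, (1 : ℝ) / d * |windowSum a d x y|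
          + ∑ d ∈ Ioc (W * W) ⌊y⌋₊ with IsRough z d, (1 : ℝ) / d * |windowSum a d x y| := by
      rw [← Finset.sum_union]
      · refine Finset.sum_le_sum_of_subset_of_nonneg (fun d hd => ?_) fun _ _ _ => by positivity
        obtain ⟨hd1, hd2⟩ := mem_filter.1 hd
        have hd1 := mem_Icc.1 hd1
        simp only [mem_union, mem_filter, mem_Icc, mem_Ioc, hd2, and_true]
        omega
      · rw [Finset.disjoint_left]
        intro d hd hd'
        have h2 := mem_Icc.1 (mem_filter.1 hd).1
        have h3 := mem_Ioc.1 (mem_filter.1 hd').1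
        omega
    have h2 := sum_inv_mul_abs_windowSum_sparse_le a blockLength_pos hYW hμ0 (IsRough z)
      (fun j _ => h.card_rough_block_le j) x y
    have hτ : (#a.divisors : ℝ) ≤ a := by exact_mod_cast Nat.card_divisors_le_self a
    have h3 : (1 : ℝ) / a * (2 * μ * #a.divisors / W) ≤ 2 / W := by
      rw [← mul_div_assoc]
      refine div_le_div_of_nonneg_right ?_ hW0.le
      rw [div_mul_eq_mul_div, one_mul, div_le_iff₀ ha0]
      have : μ * #a.divisors ≤ 1 * a := mul_le_mul hμ1 hτ (Nat.cast_nonneg _) zero_le_one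
      linarith
    calc _ ≤ (1 : ℝ) / a * (∑ d ∈ Icc 1 (W * W) with IsRough z d, (1 : ℝ) / d * |windowSum a d x y|
          + (2 * μ * (∑ n ∈ Icc 1 N, (1 : ℝ) / n * |windowSum a n x y|)
            + 2 * μ * #a.divisors / W)) :=
          mul_le_mul_of_nonneg_left (hsplit.trans (add_le_add le_rfl h2)) (by positivity)
      _ = (1 : ℝ) / a * (∑ d ∈ Icc 1 (W * W) with IsRough z d, (1 : ℝ) / d * |windowSum a d x y|)
          + 2 * μ * ((1 : ℝ) / a * ∑ n ∈ Icc 1 N, (1 : ℝ) / n * |windowSum a n x y|)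
          + (1 : ℝ) / a * (2 * μ * #a.divisors / W) := by ring
      _ ≤ _ := add_le_add le_rfl h3
  refine (Finset.sum_le_sum h1).trans ?_
  rw [Finset.sum_add_distrib, Finset.sum_add_distrib, ← Finset.mul_sum, Finset.sum_const,
    Nat.card_Icc, Nat.add_sub_cancel, nsmul_eq_mul]
  refine add_le_add le_rfl ?_
  rw [← mul_div_assoc, div_le_div_iff₀ hW0 (by linarith), one_mul]
  have h4 := h.exp_mul_log_ge (t := 9 / 100) (by norm_num)
  calc (A : ℝ) * 2 * Real.log N = A * (2 * Real.log N) := by ring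
    _ ≤ Real.exp (Real.log N / 100) * Real.exp (9 / 100 * Real.log N) :=
        mul_le_mul smoothBound_le (by nlinarith) (by positivity) (Real.exp_pos _).le
    _ = Real.exp (Real.log N / 10) := by rw [← Real.exp_add]; congr 1; ring
    _ ≤ W := le_blockLength

lemma sum_abs_windowSum_le_of_exceptional (h : Scale c N R) {κ : ℝ} (P Q : ℕ → Prop)
    [DecidablePred P] [DecidablePred Q]
    (hP : ∀ α X : ℕ, 1 ≤ α → α ≤ N → Real.exp (Real.log N / 10) ≤ X →
      (#{b ∈ Ioc 0 X | IsRough (sieveLevel N R) b ∧ P (α * b)} : ℝ) ≤ κ * X)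
    (hQ : #{m ∈ Icc 1 N | Q m ∧ ¬ P m} ≤ 2 * sieveLevel N R)
    (hκ : 0 ≤ κ) (x : ℝ) {y : ℝ} (hy0 : 0 ≤ y) (hy : y ≤ Real.exp (3 / 5 * Real.log N)) :
    ∑ m ∈ Icc 1 N with Q m, |windowSum m 1 x y|
      ≤ κ * N * (∑ a ∈ Icc 1 (smoothBound N), (1 : ℝ) / a *
        ∑ d ∈ Icc 1 ⌊y⌋₊ with IsRough (sieveLevel N R) d, (1 : ℝ) / d * |windowSum a d x y|)
        + 2 * (N / Real.log N ^ 3) := by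
  have hL := h.log_ge
  have h1 : ∑ m ∈ Icc 1 N with Q m, |windowSum m 1 x y|
      ≤ ∑ m ∈ Icc 1 N with P m ∧ m.primeFactorsList.length ≤ R, |windowSum m 1 x y|
        + ∑ m ∈ Icc 1 N with ¬ m.primeFactorsList.length ≤ R, |windowSum m 1 x y|
        + ∑ m ∈ Icc 1 N with Q m ∧ ¬ P m, |windowSum m 1 x y| := by
    simp only [Finset.sum_filter]
    rw [← Finset.sum_add_distrib, ← Finset.sum_add_distrib]
    refine Finset.sum_le_sum fun m _ => ?_
    have := abs_nonneg (windowSum m 1 x y)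
    by_cases k1 : P m <;> by_cases k2 : Q m <;> by_cases k3 : m.primeFactorsList.length ≤ R <;>
      simp [k1, k2, k3]
  have h2 := h.sum_abs_windowSum_le_of_count P hP hκ x hy0 hy
  have h3 : ∑ m ∈ Icc 1 N with ¬ m.primeFactorsList.length ≤ R, |windowSum m 1 x y|
      ≤ N / Real.log N ^ 3 :=
    (Finset.sum_le_sum fun m _ => abs_windowSum_le m 1 x y).trans h.sum_card_divisors_many_primes_le
  have h4 : ∑ m ∈ Icc 1 N with Q m ∧ ¬ P m, |windowSum m 1 x y| ≤ N / Real.log N ^ 3 := by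
    have h5 : (sieveLevel N R : ℝ) ≤ Real.exp (1 / 100 * Real.log N) := by
      refine sieveLevel_le_exp.trans (Real.exp_le_exp.2 ?_)
      rw [div_le_iff₀ (by positivity)]
      nlinarith [h.hR']
    have h6 := h.exp_mul_log_ge (t := 19 / 100) (by norm_num)
    have h7 : Real.log N ^ 3 * 2 ≤ Real.exp (19 / 100 * Real.log N) * Real.exp (19 / 100 * Real.log N) :=
      calc Real.log N ^ 3 * 2 ≤ (10 * Real.log N ^ 2) * (10 * Real.log N ^ 2) := by
            nlinarith [pow_pos (show 0 < Real.log N by linarith) 3]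
        _ ≤ _ := mul_le_mul h6 h6 (by positivity) (Real.exp_pos _).le
    calc _ ≤ ∑ m ∈ Icc 1 N with Q m ∧ ¬ P m, y :=
          Finset.sum_le_sum fun m _ => abs_windowSum_one_le m hy0
      _ = #{m ∈ Icc 1 N | Q m ∧ ¬ P m} * y := by rw [Finset.sum_const, nsmul_eq_mul]
      _ ≤ (2 * Real.exp (1 / 100 * Real.log N)) * Real.exp (3 / 5 * Real.log N) := by
          refine mul_le_mul ?_ hy hy0 (by positivity)
          calc (#{m ∈ Icc 1 N | Q m ∧ ¬ P m} : ℝ) ≤ 2 * sieveLevel N R := by exact_mod_cast hQ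
            _ ≤ _ := by linarith
      _ ≤ N / Real.log N ^ 3 := by
          rw [le_div_iff₀ (by positivity)]
          calc _ = (Real.exp (1 / 100 * Real.log N) * Real.exp (3 / 5 * Real.log N)) *
                (Real.log N ^ 3 * 2) := by ring
            _ ≤ (Real.exp (1 / 100 * Real.log N) * Real.exp (3 / 5 * Real.log N)) *
                (Real.exp (19 / 100 * Real.log N) * Real.exp (19 / 100 * Real.log N)) :=
                mul_le_mul_of_nonneg_left h7 (by positivity)
            _ = Real.exp (99 / 100 * Real.log N) := by
                rw [← Real.exp_add, ← Real.exp_add, ← Real.exp_add]; congr 1; ring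
            _ ≤ Real.exp (Real.log N) := Real.exp_le_exp.2 (by linarith)
            _ = N := h.exp_log
  linarith

lemma exp_le_self (h : Scale c N R) {y : ℝ} (hy : y ≤ Real.exp (3 / 5 * Real.log N)) : y ≤ N := by
  refine hy.trans ?_
  rw [← h.exp_log, Real.log_exp]
  exact Real.exp_le_exp.2 (by linarith [h.log_ge])

lemma mul_le_of_mem (h : Scale c N R) {a d : ℕ} (ha : a ∈ Icc 1 (smoothBound N))
    (hd : d ∈ Icc 1 (blockLength N * blockLength N)) :
    (a * d : ℝ) ≤ Real.exp (2 / 5 * Real.log N) := by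
  refine le_trans ?_ h.smoothBound_mul_blockLength_sq_le
  exact_mod_cast Nat.mul_le_mul (mem_Icc.1 ha).2 (mem_Icc.1 hd).2

lemma sum_prime_abs_windowSum_zero_le (h : Scale c N R) {y : ℝ}
    (hy1 : Real.exp (2 / 5 * Real.log N) ≤ y) (hy2 : y ≤ Real.exp (3 / 5 * Real.log N)) :
    ∑ m ∈ Icc 1 N with (m + 1).Prime, |windowSum m 1 0 y| ≤ R ^ 37 * (N / Real.log N) := by
  have hL := h.log_ge
  have hR := h.hR'
  have hy0 : 0 < y := (Real.exp_pos _).trans_le hy1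
  set z := sieveLevel N R with hz
  set μ := (R : ℝ) ^ 6 / Real.log N with hμ
  have h1 := h.sum_abs_windowSum_le_of_exceptional (κ := μ ^ 2)
    (fun m => IsLargePrime z (m + 1)) (fun m => (m + 1).Prime)
    (fun α X hα hαN hX => h.card_large_prime_le hα hαN hX)
    (by
      have h2 : #{m ∈ Icc 1 N | (m + 1).Prime ∧ ¬ IsLargePrime z (m + 1)} ≤ #(Icc 1 z) :=
        card_le_card fun m hm => by
          obtain ⟨k1, k2, k3⟩ := mem_filter.1 hm
          have k4 : ¬ z < m + 1 := fun k5 => k3 ⟨k2, k5⟩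
          have := mem_Icc.1 k1
          exact mem_Icc.2 (by omega)
      rw [Nat.card_Icc] at h2
      omega) (by positivity) 0 hy0.le hy2
  have h2 := h.sum_rough_abs_windowSum_le 0 hy0.le hy2
  have h3 := h.sum_abs_windowSum_zero_le hy0 (h.exp_le_self hy2) h.smoothBound_le_self
  have h4 : ∑ a ∈ Icc 1 (smoothBound N), (1 : ℝ) / a *
      ∑ d ∈ Icc 1 (blockLength N * blockLength N) with IsRough z d, (1 : ℝ) / d * |windowSum a d 0 y|
      ≤ R ^ 6 * Real.log N := by
    calc _ ≤ ∑ a ∈ Icc 1 (smoothBound N), rSum a / a * R ^ 5 := by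
          refine Finset.sum_le_sum fun a ha => ?_
          calc _ = 1 / (a : ℝ) * ∑ d ∈ Icc 1 (blockLength N * blockLength N) with IsRough z d,
                (1 : ℝ) / d * rSum a := by
                congr 1
                refine Finset.sum_congr rfl fun d hd => ?_
                have hd1 := (mem_filter.1 hd).1
                rw [windowSum_zero_eq_rSum (mem_Icc.1 hd1).1 ((h.mul_le_of_mem ha hd1).trans hy1),
                  abs_of_nonneg (rSum_nonneg a)]
            _ = rSum a / a * ∑ d ∈ Icc 1 (blockLength N * blockLength N) with IsRough z d,
                (1 : ℝ) / d := by
                rw [← Finset.sum_mul]; ring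
            _ ≤ _ := mul_le_mul_of_nonneg_left h.sum_inv_rough_le
                (div_nonneg (rSum_nonneg a) (Nat.cast_nonneg _))
      _ ≤ (1 + Real.log (smoothBound N)) * R ^ 5 := by
          rw [← Finset.sum_mul]
          exact mul_le_mul_of_nonneg_right (sum_rSum_div_le h.smoothBound_pos) (by positivity)
      _ ≤ (R * Real.log N) * R ^ 5 := by
          refine mul_le_mul_of_nonneg_right ?_ (by positivity)
          have h5 : Real.log (smoothBound N) ≤ Real.log N :=
            Real.log_le_log (by exact_mod_cast h.smoothBound_pos)
              (by exact_mod_cast h.smoothBound_le_self)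
          nlinarith
      _ = _ := by ring
  have h5 : 2 * μ * (∑ a ∈ Icc 1 (smoothBound N), (1 : ℝ) / a *
      ∑ n ∈ Icc 1 N, (1 : ℝ) / n * |windowSum a n 0 y|) ≤ 2 * R ^ 22 * Real.log N := by
    calc _ ≤ 2 * μ * (R ^ 16 * Real.log N ^ 2) := mul_le_mul_of_nonneg_left h3 (by positivity)
      _ = _ := by rw [hμ]; field_simp
  have h6 : 1 / Real.log N ≤ Real.log N :=
    ((div_le_one (by linarith)).2 (by linarith)).trans (by linarith)
  have h7 : (R : ℝ) ^ 6 ≤ R ^ 22 := h.le_pow (by norm_num)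
  have h8 : (1 : ℝ) ≤ R ^ 22 := by simpa using h.le_pow (show 0 ≤ 22 by norm_num)
  have h9 : ∑ a ∈ Icc 1 (smoothBound N), (1 : ℝ) / a *
        ∑ d ∈ Icc 1 ⌊y⌋₊ with IsRough (sieveLevel N R) d, (1 : ℝ) / d * |windowSum a d 0 y|
      ≤ R ^ 23 * Real.log N := by
    calc _ ≤ R ^ 6 * Real.log N + 2 * R ^ 22 * Real.log N + Real.log N := by linarith
      _ = (R ^ 6 + 2 * R ^ 22 + 1) * Real.log N := by ring
      _ ≤ (R * R ^ 22) * Real.log N := by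
          refine mul_le_mul_of_nonneg_right ?_ (by linarith)
          nlinarith
      _ = _ := by ring
  have h10 : (N : ℝ) / Real.log N ^ 3 ≤ N / Real.log N := by
    refine div_le_div_of_nonneg_left (by positivity) (by linarith) ?_
    exact le_self_pow₀ (by linarith) (by norm_num)
  have h11 : (1 : ℝ) ≤ R ^ 35 := by simpa using h.le_pow (show 0 ≤ 35 by norm_num)
  calc _ ≤ μ ^ 2 * N * (R ^ 23 * Real.log N) + 2 * (N / Real.log N ^ 3) :=
        h1.trans (add_le_add (mul_le_mul_of_nonneg_left h9 (by positivity)) le_rfl)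
    _ = R ^ 35 * (N / Real.log N) + 2 * (N / Real.log N ^ 3) := by rw [hμ]; field_simp
    _ ≤ R ^ 35 * (N / Real.log N) + 2 * (1 * (N / Real.log N)) := by linarith
    _ ≤ R ^ 35 * (N / Real.log N) + 2 * (R ^ 35 * (N / Real.log N)) := by gcongr
    _ = 3 * (R ^ 35 * (N / Real.log N)) := by ring
    _ ≤ (R * R) * (R ^ 35 * (N / Real.log N)) := by gcongr; nlinarith
    _ = _ := by ring

lemma sum_prime_pair_abs_windowSum_le (h : Scale c N R) {K : ℕ} (hK : 2 ≤ K) (hKN : K ≤ N) {y H : ℝ}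
    (hH : 1 ≤ H) (hHR : Real.log H ≤ R) (hy1 : Real.exp (2 / 5 * Real.log N) ≤ y / H)
    (hy2 : y ≤ Real.exp (3 / 5 * Real.log N)) :
    ∑ m ∈ Icc 1 N with (m + 1).Prime ∧ (K - (m + 1)).Prime, |windowSum m 1 (y / H) y|
      ≤ R ^ 39 * (N * Real.log N ^ ((√2 + 5 / 2) / 2) / Real.log N ^ 4) := by
  have hL := h.log_ge
  have hL0 : 0 < Real.log N := by linarith
  have hR := h.hR'
  have hy0 : 0 < y := by
    have h0 : 0 < y / H := (Real.exp_pos _).trans_le hy1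
    exact (div_pos_iff_of_pos_right (by linarith)).1 h0
  set z := sieveLevel N R with hz
  set μ := (R : ℝ) ^ 6 / Real.log N with hμ
  set E := Real.log N ^ ((√2 + 5 / 2) / 2) with hE
  have hE1 : Real.log N ≤ E := by
    rw [hE]
    refine Real.self_le_rpow_of_one_le (by linarith) ?_
    have : 0 ≤ √2 := Real.sqrt_nonneg 2
    linarith
  have h1 := h.sum_abs_windowSum_le_of_exceptional (κ := μ ^ 3)
    (fun m => IsLargePrime z (m + 1) ∧ IsLargePrime z (K - (m + 1)))
    (fun m => (m + 1).Prime ∧ (K - (m + 1)).Prime)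
    (fun α X hα hαN hX => h.card_large_prime_pair_le hK hKN hα hαN hX)
    (by
      have h2 : {m ∈ Icc 1 N | ((m + 1).Prime ∧ (K - (m + 1)).Prime) ∧
          ¬ (IsLargePrime z (m + 1) ∧ IsLargePrime z (K - (m + 1)))}
          ⊆ Icc 1 z ∪ (Icc 1 z).image (fun q => K - 1 - q) := fun m hm => by
        obtain ⟨k1, ⟨k2, k3⟩, k4⟩ := mem_filter.1 hm
        have k1 := mem_Icc.1 k1
        have k5 := k3.pos
        rw [mem_union]
        by_cases k6 : z < m + 1
        · have k7 : ¬ z < K - (m + 1) := fun k8 => k4 ⟨⟨k2, k6⟩, ⟨k3, k8⟩⟩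
          exact Or.inr (mem_image.2 ⟨K - (m + 1), mem_Icc.2 (by omega), by omega⟩)
        · exact Or.inl (mem_Icc.2 (by omega))
      refine (card_le_card h2).trans ((card_union_le _ _).trans ?_)
      have h3 : #((Icc 1 z).image (fun q => K - 1 - q)) ≤ #(Icc 1 z) := card_image_le
      rw [Nat.card_Icc] at h3 ⊢
      omega) (by positivity) (y / H) hy0.le hy2
  have h2 := h.sum_rough_abs_windowSum_le (y / H) hy0.le hy2
  have h3 := h.sum_abs_windowSum_short_le hy0 (h.exp_le_self hy2) hH hHR h.smoothBound_le_self
  have h4 : ∑ a ∈ Icc 1 (smoothBound N), (1 : ℝ) / a *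
      ∑ d ∈ Icc 1 (blockLength N * blockLength N) with IsRough z d,
        (1 : ℝ) / d * |windowSum a d (y / H) y| = 0 := by
    refine Finset.sum_eq_zero fun a ha => ?_
    rw [Finset.sum_eq_zero, mul_zero]
    intro d hd
    rw [windowSum_eq_zero_of_le ((h.mul_le_of_mem ha (mem_filter.1 hd).1).trans hy1), abs_zero,
      mul_zero]
  have h9 : ∑ a ∈ Icc 1 (smoothBound N), (1 : ℝ) / a *
        ∑ d ∈ Icc 1 ⌊y⌋₊ with IsRough (sieveLevel N R) d, (1 : ℝ) / d * |windowSum a d (y / H) y|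
      ≤ R ^ 20 * (E / Real.log N) := by
    have h5 : 1 / Real.log N ≤ E / Real.log N := by gcongr; linarith
    have h6 : (1 : ℝ) ≤ R ^ 19 := by simpa using h.le_pow (show 0 ≤ 19 by norm_num)
    calc _ ≤ 0 + 2 * μ * (R ^ 13 * E) + E / Real.log N := by
          rw [h4] at h2
          refine h2.trans (add_le_add (add_le_add le_rfl ?_) h5)
          exact mul_le_mul_of_nonneg_left h3 (by positivity)
      _ = (2 * R ^ 19 + 1) * (E / Real.log N) := by rw [hμ]; field_simp; ring
      _ ≤ (R * R ^ 19) * (E / Real.log N) := by gcongr; nlinarith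
      _ = _ := by ring
  have h10 : (N : ℝ) / Real.log N ^ 3 ≤ N * E / Real.log N ^ 4 := by
    rw [div_le_div_iff₀ (by positivity) (by positivity)]
    calc (N : ℝ) * Real.log N ^ 4 = N * Real.log N * Real.log N ^ 3 := by ring
      _ ≤ N * E * Real.log N ^ 3 := by gcongr
  have h11 : (1 : ℝ) ≤ R ^ 38 := by simpa using h.le_pow (show 0 ≤ 38 by norm_num)
  set B := N * E / Real.log N ^ 4 with hB
  have hB0 : 0 ≤ B := by positivity
  calc _ ≤ μ ^ 3 * N * (R ^ 20 * (E / Real.log N)) + 2 * (N / Real.log N ^ 3) :=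
        h1.trans (add_le_add (mul_le_mul_of_nonneg_left h9 (by positivity)) le_rfl)
    _ = R ^ 38 * B + 2 * (N / Real.log N ^ 3) := by rw [hμ, hB]; field_simp
    _ ≤ R ^ 38 * B + 2 * B := by linarith
    _ ≤ R ^ 38 * B + 2 * (R ^ 38 * B) := by linarith [le_mul_of_one_le_left hB0 h11]
    _ = 3 * (R ^ 38 * B) := by ring
    _ ≤ R * (R ^ 38 * B) := by gcongr; linarith
    _ = _ := by ring

end Scale

lemma r1_eq_windowSum (D : ℝ) (m : ℕ) : r1 D m = windowSum m 1 0 D := by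
  refine Finset.sum_congr rfl fun d hd => ?_
  have : (0 : ℝ) < d := by exact_mod_cast Nat.pos_of_mem_divisors hd
  simp [this]

lemma r2_eq_windowSum (D M : ℝ) (m : ℕ) :
    r2 D M m = windowSum m 1 D ((⌈M / D⌉₊ : ℝ) - 1) := by
  refine Finset.sum_congr rfl fun d _ => ?_
  have : (d : ℝ) < M / D ↔ (d : ℝ) * (1 : ℕ) ≤ (⌈M / D⌉₊ : ℝ) - 1 := by
    rw [← Nat.lt_ceil, ← Nat.add_one_le_iff, Nat.cast_one, mul_one, le_sub_iff_add_le]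
    exact_mod_cast Iff.rfl
  simp only [this]
  simp

lemma sum_prime_abs_pred_le (N : ℕ) (P : ℕ → Prop) [DecidablePred P] (f : ℕ → ℝ)
    (hP : ∀ p, P p → p.Prime) :
    ∑ p ∈ range (N + 1) with P p, |f (p - 1)| ≤ ∑ m ∈ Icc 1 N with P (m + 1), |f m| := by
  rw [← Finset.sum_image (f := fun m => |f m|) (g := fun p => p - 1)]
  · refine Finset.sum_le_sum_of_subset_of_nonneg ?_ fun _ _ _ => abs_nonneg _
    intro m hm
    obtain ⟨p, hp, rfl⟩ := mem_image.1 hm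
    obtain ⟨hp1, hp2⟩ := mem_filter.1 hp
    have h2 := (hP p hp2).two_le
    have h3 := mem_range.1 hp1
    refine mem_filter.2 ⟨mem_Icc.2 ⟨by omega, by omega⟩, ?_⟩
    rwa [Nat.sub_add_cancel (by omega)]
  · intro p hp q hq hpq
    have h1 := (hP p (mem_filter.1 hp).2).two_le
    have h2 := (hP q (mem_filter.1 hq).2).two_le
    simp only at hpq
    omega

/-- A weighted ternary sum is bounded through the two weights separately, provided the second one
is controlled uniformly along pairs of primes with a prescribed sum. -/
lemma abs_tripleSum_le {N : ℕ} (hN : 1 ≤ N) (u v : ℕ → ℝ) {A : ℝ} (hA0 : 0 ≤ A)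
    (hA : ∀ K, 2 ≤ K → K ≤ N →
      ∑ m ∈ Icc 1 N with (m + 1).Prime ∧ (K - (m + 1)).Prime, |v m| ≤ A) :
    |tripleSum N (fun p => u (p - 1)) (fun p => v (p - 1))| ≤
      Real.log N ^ 3 * ((∑ m ∈ Icc 1 N with (m + 1).Prime, |u m|) * A) := by
  have hL : 0 ≤ Real.log N := Real.log_nonneg (by exact_mod_cast hN)
  have hlog : ∀ p : ℕ, p ≤ N → |Real.log p| ≤ Real.log N := by
    intro p hp
    rcases Nat.eq_zero_or_pos p with rfl | h0
    · simpa using hL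
    · rw [abs_of_nonneg (Real.log_natCast_nonneg p)]
      exact Real.log_le_log (by exact_mod_cast h0) (by exact_mod_cast hp)
  have hterm : ∀ p₁ ∈ range (N + 1), ∀ p₂ ∈ range (N + 1), ∀ p₃ ∈ range (N + 1),
      |if p₁.Prime ∧ p₂.Prime ∧ p₃.Prime ∧ p₁ + p₂ + p₃ = N then
        u (p₁ - 1) * v (p₂ - 1) * Real.log p₁ * Real.log p₂ * Real.log p₃ else 0| ≤
      if N - p₁ - p₂ = p₃ then if p₁.Prime then
        if p₂.Prime ∧ (N - p₁ - p₂).Prime then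
          Real.log N ^ 3 * |u (p₁ - 1)| * |v (p₂ - 1)| else 0 else 0 else 0 := by
    intro p₁ h₁ p₂ h₂ p₃ h₃
    have l₁ := hlog p₁ (Nat.lt_succ_iff.1 (mem_range.1 h₁))
    have l₂ := hlog p₂ (Nat.lt_succ_iff.1 (mem_range.1 h₂))
    have l₃ := hlog p₃ (Nat.lt_succ_iff.1 (mem_range.1 h₃))
    by_cases h : p₁.Prime ∧ p₂.Prime ∧ p₃.Prime ∧ p₁ + p₂ + p₃ = N
    · have e : N - p₁ - p₂ = p₃ := by omega
      rw [if_pos h, e, if_pos rfl, if_pos h.1, if_pos ⟨h.2.1, h.2.2.1⟩]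
      simp only [abs_mul]
      calc _ ≤ |u (p₁ - 1)| * |v (p₂ - 1)| * Real.log N * Real.log N * Real.log N := by gcongr
        _ = _ := by ring
    · rw [if_neg h, abs_zero]
      split_ifs <;> positivity
  have hinner : ∀ p₁, ∑ p₂ ∈ range (N + 1) with p₂.Prime ∧ (N - p₁ - p₂).Prime, |v (p₂ - 1)|
      ≤ A := by
    intro p₁
    rcases lt_or_ge (N - p₁) 2 with hK | hK
    · rw [Finset.sum_eq_zero]
      · exact hA0
      · intro p hp
        have := (mem_filter.1 hp).2.2.two_le
        omega
    · exact (sum_prime_abs_pred_le N (fun p => p.Prime ∧ (N - p₁ - p).Prime) v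
        fun _ h => h.1).trans (hA _ hK (by omega))
  calc |tripleSum N (fun p => u (p - 1)) (fun p => v (p - 1))|
      ≤ ∑ p₁ ∈ range (N + 1), ∑ p₂ ∈ range (N + 1), ∑ p₃ ∈ range (N + 1),
          |if p₁.Prime ∧ p₂.Prime ∧ p₃.Prime ∧ p₁ + p₂ + p₃ = N then
            u (p₁ - 1) * v (p₂ - 1) * Real.log p₁ * Real.log p₂ * Real.log p₃ else 0| := by
        refine (Finset.abs_sum_le_sum_abs _ _).trans (Finset.sum_le_sum fun p₁ _ => ?_)
        refine (Finset.abs_sum_le_sum_abs _ _).trans (Finset.sum_le_sum fun p₂ _ => ?_)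
        exact Finset.abs_sum_le_sum_abs _ _
    _ ≤ ∑ p₁ ∈ range (N + 1), if p₁.Prime then Real.log N ^ 3 * |u (p₁ - 1)| * A else 0 := by
        refine Finset.sum_le_sum fun p₁ h₁ => ?_
        refine (Finset.sum_le_sum fun p₂ h₂ =>
          Finset.sum_le_sum fun p₃ h₃ => hterm p₁ h₁ p₂ h₂ p₃ h₃).trans ?_
        have hmem : ∀ p₂, N - p₁ - p₂ ∈ range (N + 1) := fun p₂ => mem_range.2 (by omega)
        simp only [Finset.sum_ite_eq, hmem, if_true]
        by_cases hp : p₁.Prime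
        · simp only [hp, if_true]
          rw [← Finset.sum_filter, ← Finset.mul_sum]
          exact mul_le_mul_of_nonneg_left (hinner p₁) (by positivity)
        · simp [hp]
    _ = Real.log N ^ 3 * ((∑ p ∈ range (N + 1) with p.Prime, |u (p - 1)|) * A) := by
        rw [← Finset.sum_filter, Finset.sum_mul, Finset.mul_sum]
        exact Finset.sum_congr rfl fun _ _ => by ring
    _ ≤ _ := by
        gcongr
        exact sum_prime_abs_pred_le N Nat.Prime u fun _ h => h

/-- The exponents of `log N` add up to less than `-theta0`. -/
lemma rpow_saving_le {x : ℝ} (hx : 1 ≤ x) :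
    x ^ (1 / 100 : ℝ) * (x ^ ((√2 + 5 / 2) / 2) / x ^ 2) ≤ x ^ (-theta0) := by
  have hx0 : 0 < x := by linarith
  rw [← Real.rpow_natCast, ← Real.rpow_sub hx0, ← Real.rpow_add hx0]
  refine Real.rpow_le_rpow_of_exponent_le hx ?_
  have h1 : √2 ≤ 1.4143 := Real.sqrt_le_iff.2 (by norm_num)
  have h2 := Real.exp_one_gt_d9
  have h3 := Real.log_two_gt_d9
  have h4 : (2.7182818283 : ℝ) * 0.6931471803 ≤ Real.exp 1 * Real.log 2 := by gcongr
  unfold theta0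
  norm_num at h1 h4 ⊢
  linarith

namespace Scale

variable {c : ℝ} {N R : ℕ}

lemma pow_le_rpow (h : Scale c N R) {k : ℕ} (hk : k ≤ 100) :
    (R : ℝ) ^ k ≤ Real.log N ^ (1 / 100 : ℝ) := by
  have hL := h.log_ge
  refine (h.le_pow hk).trans ?_
  rw [one_div, Real.le_rpow_inv_iff_of_pos (by positivity) (by linarith) (by norm_num)]
  have := h.pow_le (k := 100 * 100) (by norm_num)
  rw [pow_mul] at this
  exact_mod_cast this

/-- Location of the cutoffs `√N (log N)^(-c)` and `√N (log N)^c`. -/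
lemma cutoff_bounds (h : Scale c N R) (hc : 1 ≤ c) {D : ℝ} (hD : D = √N * Real.log N ^ (-c)) :
    Real.exp (2 / 5 * Real.log N) ≤ D ∧
    D + 1 ≤ N / D ∧ N / D ≤ Real.exp (3 / 5 * Real.log N) ∧ Real.log (N / D / D) ≤ R := by
  have hL := h.log_ge
  have hLR := h.mul_le
  have hRc := h.hc
  have hR := h.hR'
  have hll : 1 ≤ Real.log (Real.log N) := by
    rw [Real.le_log_iff_exp_le (by linarith)]
    linarith [Real.exp_one_lt_d9]
  set L := Real.log N with hLdef
  set t := c * Real.log L with ht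
  have ht1 : 1 ≤ t := one_le_mul_of_one_le_of_one_le hc hll
  have htR : 10 ^ 4 * t ≤ R := by linarith
  have hDexp : D = Real.exp (L / 2 - t) := by
    rw [hD, Real.rpow_def_of_pos (by linarith), sub_eq_add_neg, Real.exp_add, Real.exp_half,
      h.exp_log]
    congr 2
    ring
  have hND : N / D = Real.exp (L / 2 + t) := by
    rw [hDexp, ← h.exp_log, ← hLdef, ← Real.exp_sub]
    congr 1
    ring
  have hratio : N / D / D = Real.exp (2 * t) := by
    rw [hND, hDexp, ← Real.exp_sub]
    congr 1
    ring
  refine ⟨?_, ?_, ?_, ?_⟩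
  · rw [hDexp]
    exact Real.exp_le_exp.2 (by linarith)
  · have hD1 : 1 ≤ D := by
      rw [hDexp]
      exact Real.one_le_exp (by linarith)
    rw [div_eq_iff (by linarith)] at hratio
    rw [hratio]
    nlinarith [Real.add_one_le_exp (2 * t)]
  · rw [hND]
    exact Real.exp_le_exp.2 (by linarith)
  · rw [hratio, Real.log_exp]
    linarith

theorem abs_tripleSum_le (h : Scale c N R) (hc : 1 ≤ c) {D : ℝ}
    (hD : D = √N * Real.log N ^ (-c)) :
    |tripleSum N (fun p => r1 D (p - 1)) (fun p => r2 D N (p - 1))| ≤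
      (N : ℝ) ^ 2 * Real.log N ^ (-theta0) := by
  have hL := h.log_ge
  have hL0 : 0 < Real.log N := by linarith
  obtain ⟨h1, h2, h3, h4⟩ := h.cutoff_bounds hc hD
  have hD0 : 0 < D := (Real.exp_pos _).trans_le h1
  set Y : ℝ := (⌈N / D⌉₊ : ℝ) - 1 with hY
  have hYlt : Y ≤ N / D := by
    have := Nat.ceil_lt_add_one (a := (N : ℝ) / D) (by positivity)
    linarith
  have hYD : D ≤ Y := by linarith [Nat.le_ceil ((N : ℝ) / D)]
  have hY0 : 0 < Y := by linarith
  have hyH : Y / (Y / D) = D := by field_simp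
  have hu := h.sum_prime_abs_windowSum_zero_le h1 (by linarith : D ≤ _)
  have hv := fun K hK hKN => h.sum_prime_pair_abs_windowSum_le (K := K) hK hKN (y := Y)
    (H := Y / D) ((one_le_div hD0).2 hYD) ((Real.log_le_log (by positivity) (by gcongr)).trans h4)
    (by rwa [hyH]) (hYlt.trans h3)
  rw [hyH] at hv
  set E := Real.log N ^ ((√2 + 5 / 2) / 2) with hE
  have hN := h.N_pos
  have key := _root_.abs_tripleSum_le hN (r1 D) (r2 D N) (A := R ^ 39 * (N * E / Real.log N ^ 4))
    (by positivity) (by simpa only [r2_eq_windowSum, ← hY] using hv)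
  simp only [r1_eq_windowSum] at key hu ⊢
  refine key.trans ?_
  calc _ ≤ Real.log N ^ 3 * (R ^ 37 * (N / Real.log N) * (R ^ 39 * (N * E / Real.log N ^ 4))) := by
        gcongr
    _ = R ^ 76 * (E / Real.log N ^ 2) * N ^ 2 := by field_simp
    _ ≤ Real.log N ^ (1 / 100 : ℝ) * (E / Real.log N ^ 2) * N ^ 2 := by
        gcongr
        exact h.pow_le_rpow (by norm_num)
    _ ≤ Real.log N ^ (-theta0) * N ^ 2 := by
        gcongr
        exact rpow_saving_le (by linarith)
    _ = _ := by ring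

end Scale

lemma exists_scale (c : ℝ) : ∃ N₀ : ℕ, ∀ N : ℕ, N₀ ≤ N → ∃ R : ℕ, Scale c N R := by
  have hlittle : (fun x : ℝ => 10 ^ 4 * (1 + |c|) * (1 + Real.log x) + 1) =o[Filter.atTop]
      fun x : ℝ => x ^ (10000⁻¹ : ℝ) := by
    have hconst : ∀ a : ℝ, (fun _ : ℝ => a) =o[Filter.atTop] fun x : ℝ => x ^ (10000⁻¹ : ℝ) :=
      fun a => Asymptotics.isLittleO_const_left.2 <| .inr <|
        Filter.tendsto_abs_atTop_atTop.comp (tendsto_rpow_atTop (by norm_num))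
    exact (((hconst 1).add (isLittleO_log_rpow_atTop (by norm_num))).const_mul_left _).add (hconst 1)
  have hlarge : ∀ᶠ x : ℝ in Filter.atTop,
      10 ^ 4 * (1 + |c|) * (1 + Real.log x) + 1 ≤ x ^ (10000⁻¹ : ℝ) := by
    filter_upwards [hlittle.bound one_pos, Filter.eventually_ge_atTop 1] with x hx hx1
    have h0 := Real.log_nonneg hx1
    rwa [one_mul, Real.norm_of_nonneg (by positivity), Real.norm_of_nonneg (by positivity)] at hx
  have hlog := Real.tendsto_log_atTop.comp (tendsto_natCast_atTop_atTop (R := ℝ))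
  obtain ⟨N₀, hN₀⟩ := Filter.eventually_atTop.1
    (hlog.eventually (hlarge.and (Filter.eventually_ge_atTop 1)))
  refine ⟨N₀, fun N hN => ⟨⌊Real.log N ^ (10000⁻¹ : ℝ)⌋₊, ?_⟩⟩
  obtain ⟨h1, h2⟩ := hN₀ N hN
  simp only [Function.comp_apply] at h1 h2
  have hll := Real.log_nonneg h2
  set y := Real.log N ^ (10000⁻¹ : ℝ) with hy
  have hfl := Nat.lt_floor_add_one y
  have hc := abs_nonneg c
  have hR : 10 ^ 4 * (1 + |c|) * (1 + Real.log (Real.log N)) ≤ (⌊y⌋₊ : ℝ) := by linarith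
  have hR₁ : 10 ^ 4 * (1 + Real.log (Real.log N)) ≤ (⌊y⌋₊ : ℝ) := by nlinarith
  refine ⟨?_, hR₁, le_trans ?_ hR, ?_⟩
  · have : ((10 ^ 4 : ℕ) : ℝ) ≤ (⌊y⌋₊ : ℝ) := by push_cast; linarith
    exact_mod_cast this
  · gcongr
    exact le_abs_self c
  · calc (⌊y⌋₊ : ℝ) ^ 10000 ≤ y ^ 10000 := by
          gcongr
          exact Nat.floor_le (by positivity)
      _ = Real.log N := by
          rw [hy, ← Real.rpow_natCast, ← Real.rpow_mul (by linarith)]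
          norm_num

/-- with D = √N (log N)^{-c} for any large enough constant c,
R₁,₂(N) ≪ N² (log N)^{-θ₀} (log log N)⁷ for large odd N. -/
theorem R_one_two_bound :
    ∃ c0 : ℝ, 0 < c0 ∧ ∀ c : ℝ, c0 ≤ c → ∃ C : ℝ, 0 < C ∧ ∃ N0 : ℕ,
      ∀ N : ℕ, N0 ≤ N → Odd N →
        |tripleSum N (fun p => r1 (Real.sqrt N * Real.log N ^ (-c)) (p - 1))
            (fun p => r2 (Real.sqrt N * Real.log N ^ (-c)) (N : ℝ) (p - 1))| ≤
          C * (N : ℝ) ^ 2 * Real.log N ^ (-theta0) * Real.log (Real.log N) ^ 7 := by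
  refine ⟨1, one_pos, fun c hc => ⟨1, one_pos, ?_⟩⟩
  obtain ⟨N₀, hN₀⟩ := exists_scale c
  refine ⟨N₀, fun N hN _ => ?_⟩
  obtain ⟨R, h⟩ := hN₀ N hN
  have hL := h.log_ge
  have hll : 1 ≤ Real.log (Real.log N) := by
    rw [Real.le_log_iff_exp_le (by linarith)]
    linarith [Real.exp_one_lt_d9]
  have hL0 : 0 < Real.log N := by linarith
  refine (h.abs_tripleSum_le hc rfl).trans ?_
  rw [one_mul]
  exact le_mul_of_one_le_right (by positivity) (one_le_pow₀ hll)
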